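/- Every (P2+P3, gem)-free graph G (with at least one vertex) satisfies χ(G) ≤ φ(ω(G)), where φ: ℕ → ℕ is defined by φ(1)=1, φ(2)=4, φ(3)=6, and φ(x)=⌈(5x−1)/4⌉ for x ≥ 4. -/

import Mathlib

open SimpleGraph

/-- The graph `P2 + P3` (disjoint union of a path on 2 and a path on 3 vertices). -/
def graphP2P3 : SimpleGraph (Fin 5) :=
  SimpleGraph.fromRel (fun x y => (x, y) ∈ ([(0,1),(2,3),(3,4)] : List (Fin 5 × Fin 5)))

/-- The gem: a path `P4` (0-1-2-3) plus a vertex 4 adjacent to all of it. -/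
def graphGem : SimpleGraph (Fin 5) :=
  SimpleGraph.fromRel (fun x y =>
    (x, y) ∈ ([(0,1),(1,2),(2,3),(4,0),(4,1),(4,2),(4,3)] : List (Fin 5 × Fin 5)))

/-- The path on three vertices. -/
def graphP3 : SimpleGraph (Fin 3) :=
  SimpleGraph.fromRel (fun x y => (x, y) ∈ ([(0,1),(1,2)] : List (Fin 3 × Fin 3)))

/-- The cycle on five vertices. -/
def graphC5 : SimpleGraph (Fin 5) :=
  SimpleGraph.fromRel (fun x y => y = x + 1)

/-- `F1`: a 5-cycle `v1 v2 v3 v4 v5` (vertices 0..4) plus a vertex 5 adjacent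
exactly to `v5, v1, v2` (i.e. 4, 0, 1). -/
def graphF1 : SimpleGraph (Fin 6) :=
  SimpleGraph.fromRel (fun x y =>
    (x, y) ∈ ([(0,1),(1,2),(2,3),(3,4),(4,0),(5,4),(5,0),(5,1)] : List (Fin 6 × Fin 6)))

/-- `F1'`: a 5-cycle (0..4) plus adjacent vertices 5, 6, where 5 is adjacent to 4,0,1
and 6 is adjacent to 0,1,2. -/
def graphF1' : SimpleGraph (Fin 7) :=
  SimpleGraph.fromRel (fun x y =>
    (x, y) ∈ ([(0,1),(1,2),(2,3),(3,4),(4,0),(5,4),(5,0),(5,1),(6,0),(6,1),(6,2),(5,6)] :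
      List (Fin 7 × Fin 7)))

/-- `F1''`: a 5-cycle (0..4) plus nonadjacent vertices 5, 6, where 5 is adjacent to 4,0,1
and 6 is adjacent to 1,2,3. -/
def graphF1'' : SimpleGraph (Fin 7) :=
  SimpleGraph.fromRel (fun x y =>
    (x, y) ∈ ([(0,1),(1,2),(2,3),(3,4),(4,0),(5,4),(5,0),(5,1),(6,1),(6,2),(6,3)] :
      List (Fin 7 × Fin 7)))

/-- `F2`: a 5-cycle (0..4) plus adjacent vertices 5, 6, each adjacent to `v1,v3,v4`
(i.e. 0, 2, 3). -/
def graphF2 : SimpleGraph (Fin 7) :=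
  SimpleGraph.fromRel (fun x y =>
    (x, y) ∈ ([(0,1),(1,2),(2,3),(3,4),(4,0),(5,6),(5,0),(5,2),(5,3),(6,0),(6,2),(6,3)] :
      List (Fin 7 × Fin 7)))

/-- `F3`: a 5-cycle (0..4) plus adjacent vertices 5 (adjacent to 0,2,3) and
6 (adjacent to 2,3). -/
def graphF3 : SimpleGraph (Fin 7) :=
  SimpleGraph.fromRel (fun x y =>
    (x, y) ∈ ([(0,1),(1,2),(2,3),(3,4),(4,0),(5,6),(5,0),(5,2),(5,3),(6,2),(6,3)] :
      List (Fin 7 × Fin 7)))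

/-- `G` contains no induced copy of `H`. -/
def IsFreeOf {W V : Type*} (G : SimpleGraph V) (H : SimpleGraph W) : Prop :=
  IsEmpty (H ↪g G)

/-- The disjoint union of a clique blowup `C5⟨K_{t 0},…,K_{t 4}⟩` of the 5-cycle and
`ℓ` isolated vertices. -/
def blowupC5 (t : Fin 5 → ℕ) (ℓ : ℕ) :
    SimpleGraph ((Σ i : Fin 5, Fin (t i)) ⊕ Fin ℓ) :=
  SimpleGraph.fromRel (fun x y => ∃ a b, x = Sum.inl a ∧ y = Sum.inl b ∧
    (a.1 = b.1 ∨ b.1 = a.1 + 1))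

/-- Membership in the class `𝒞`: `G` is isomorphic to the disjoint union of a clique
blowup of `C5` and some number of isolated vertices. -/
def InClassC {V : Type*} (G : SimpleGraph V) : Prop :=
  ∃ (t : Fin 5 → ℕ) (ℓ : ℕ), (∀ i, 0 < t i) ∧ Nonempty (G ≃g blowupC5 t ℓ)

/-- The function φ from the paper. -/
noncomputable def phi (x : ℕ) : ℕ :=
  if x = 1 then 1 else if x = 2 then 4 else if x = 3 then 6
  else ⌈(5 * (x : ℚ) - 1) / 4⌉₊

section Stmt
variable {V : Type*} (G : SimpleGraph V)

/-- `S` is complete to `S'`. -/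
def CompleteTo (S S' : Set V) : Prop := ∀ x ∈ S, ∀ y ∈ S', G.Adj x y

/-- `S` is anticomplete to `S'`. -/
def AnticompleteTo (S S' : Set V) : Prop := ∀ x ∈ S, ∀ y ∈ S', ¬ G.Adj x y

/-- `S` is a stable (independent) set. -/
def IsStableSet (S : Set V) : Prop := S.Pairwise (fun x y => ¬ G.Adj x y)

/-- A graph is perfect if every induced subgraph has chromatic number equal to
its clique number. -/
def IsPerfect : Prop :=
  ∀ S : Set V, (G.induce S).chromaticNumber = ((G.induce S).cliqueNum : ℕ∞)

variable (v : Fin 5 → V)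

/-- `v` induces a `C5` in `G`: two cycle vertices are adjacent iff consecutive. -/
def IsInducedC5 : Prop :=
  Function.Injective v ∧ ∀ i j : Fin 5, G.Adj (v i) (v j) ↔ (j = i + 1 ∨ i = j + 1)

def setA (i : Fin 5) : Set V :=
  {u | u ∉ Set.range v ∧ ∀ j, G.Adj u (v j) ↔ j = i}

def setB (i : Fin 5) : Set V :=
  {u | u ∉ Set.range v ∧ ∀ j, G.Adj u (v j) ↔ (j = i ∨ j = i + 1)}

def setX (i : Fin 5) : Set V :=
  {u | u ∉ Set.range v ∧ ∀ j, G.Adj u (v j) ↔ (j = i - 1 ∨ j = i + 1)}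

def setY (i : Fin 5) : Set V :=
  {u | u ∉ Set.range v ∧ ∀ j, G.Adj u (v j) ↔ (j = i - 1 ∨ j = i ∨ j = i + 1)}

def setZ (i : Fin 5) : Set V :=
  {u | u ∉ Set.range v ∧ ∀ j, G.Adj u (v j) ↔ (j = i - 2 ∨ j = i ∨ j = i + 2)}

def setT : Set V :=
  {u | u ∉ Set.range v ∧ ∀ j, ¬ G.Adj u (v j)}

end Stmt


/-- `W` induces a disjoint union of cliques. -/
def IsCluster {V : Type*} (G : SimpleGraph V) (W : Set V) : Prop :=
  ∀ ⦃a⦄, a ∈ W → ∀ ⦃b⦄, b ∈ W → ∀ ⦃c⦄, c ∈ W → G.Adj a b → G.Adj b c → a ≠ c → G.Adj a c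

/-- Adjacency form of gem-freeness. -/
def NoGem {V : Type*} (G : SimpleGraph V) : Prop :=
  ∀ ⦃c p₀ p₁ p₂ p₃ : V⦄, G.Adj c p₀ → G.Adj c p₁ → G.Adj c p₂ → G.Adj c p₃ →
    G.Adj p₀ p₁ → G.Adj p₁ p₂ → G.Adj p₂ p₃ →
    ¬ G.Adj p₀ p₂ → ¬ G.Adj p₀ p₃ → ¬ G.Adj p₁ p₃ → False

/-- Adjacency form of `P2 + P3`-freeness. -/
def NoP2P3 {V : Type*} (G : SimpleGraph V) : Prop :=
  ∀ ⦃a b x y z : V⦄, G.Adj a b → G.Adj x y → G.Adj y z → x ≠ z → ¬ G.Adj x z →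
    ¬ G.Adj a x → ¬ G.Adj a y → ¬ G.Adj a z → ¬ G.Adj b x → ¬ G.Adj b y → ¬ G.Adj b z → False

theorem noGem_of_isFreeOf {V : Type*} {G : SimpleGraph V} (h : IsFreeOf G graphGem) :
    NoGem G := by
  intro c p₀ p₁ p₂ p₃ c0 c1 c2 c3 h01 h12 h23 n02 n03 n13
  refine h.false ⟨⟨![p₀, p₁, p₂, p₃, c], ?_⟩, ?_⟩
  · intro i j hij
    have e1 := c0.ne; have e2 := c1.ne; have e3 := c2.ne; have e4 := c3.ne
    have e5 := h01.ne; have e6 := h12.ne; have e7 := h23.ne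
    have e8 : p₀ ≠ p₂ := by rintro rfl; exact n03 h23
    have e9 : p₀ ≠ p₃ := by rintro rfl; exact n02 h23.symm
    have e10 : p₁ ≠ p₃ := by rintro rfl; exact n03 h01
    fin_cases i <;> fin_cases j <;> simp_all
  · intro i j
    clear h
    change G.Adj (![p₀, p₁, p₂, p₃, c] i) (![p₀, p₁, p₂, p₃, c] j) ↔ _
    fin_cases i <;> fin_cases j <;>
      simp [graphGem, SimpleGraph.fromRel_adj, SimpleGraph.adj_comm] <;>
      assumption

theorem noP2P3_of_isFreeOf {V : Type*} {G : SimpleGraph V} (h : IsFreeOf G graphP2P3) :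
    NoP2P3 G := by
  intro a b x y z hab hxy hyz nxz hxz ax ay az bx by' bz
  refine h.false ⟨⟨![a, b, x, y, z], ?_⟩, ?_⟩
  · intro i j hij
    have e1 := hab.ne; have e2 := hxy.ne; have e3 := hyz.ne
    have e4 : a ≠ x := by rintro rfl; exact bx hab.symm
    have e5 : a ≠ y := by rintro rfl; exact by' hab.symm
    have e6 : a ≠ z := by rintro rfl; exact bz hab.symm
    have e7 : b ≠ x := by rintro rfl; exact ax hab
    have e8 : b ≠ y := by rintro rfl; exact ay hab
    have e9 : b ≠ z := by rintro rfl; exact az hab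
    fin_cases i <;> fin_cases j <;> simp_all
  · intro i j
    clear h
    change G.Adj (![a, b, x, y, z] i) (![a, b, x, y, z] j) ↔ _
    fin_cases i <;> fin_cases j <;>
      simp [graphP2P3, SimpleGraph.fromRel_adj, SimpleGraph.adj_comm] <;>
      assumption

/-- List colouring of a disjoint union of cliques, by Hall's theorem on each clique. -/
theorem IsCluster.exists_list_coloring {V : Type*} [Fintype V] {G : SimpleGraph V} {W : Set V}
    (hW : IsCluster G W) {α : Type*} [Nonempty α] [DecidableEq α] (L : V → Finset α)
    (hall : ∀ X : Finset V, (∀ u ∈ X, u ∈ W) → (∀ u ∈ X, ∀ v ∈ X, u ≠ v → G.Adj u v) →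
      X.Nonempty → X.card ≤ (X.biUnion L).card) :
    ∃ c : V → α, (∀ u ∈ W, c u ∈ L u) ∧ ∀ u ∈ W, ∀ v ∈ W, G.Adj u v → c u ≠ c v := by
  classical
  have key : ∀ X : Finset V, ∃ f : V → α, (∀ u ∈ X, u ∈ W) →
      (∀ u ∈ X, ∀ v ∈ X, u ≠ v → G.Adj u v) →
      (∀ u ∈ X, f u ∈ L u) ∧ ∀ u ∈ X, ∀ v ∈ X, f u = f v → u = v := by
    intro X
    by_cases hX : (∀ u ∈ X, u ∈ W) ∧ (∀ u ∈ X, ∀ v ∈ X, u ≠ v → G.Adj u v)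
    · obtain ⟨hX1, hX2⟩ := hX
      obtain ⟨f, hf, hfL⟩ := (Finset.all_card_le_biUnion_card_iff_exists_injective
        (fun u : X => L u)).1 (by
          intro s
          rcases s.eq_empty_or_nonempty with rfl | hs
          · simp
          have h1 := hall (s.map (Function.Embedding.subtype _))
            (by intro u hu; simp only [Finset.mem_map, Function.Embedding.subtype_apply] at hu
                obtain ⟨a, -, rfl⟩ := hu; exact hX1 _ a.2)
            (by intro u hu v hv
                simp only [Finset.mem_map, Function.Embedding.subtype_apply] at hu hv
                obtain ⟨a, -, rfl⟩ := hu
                obtain ⟨b, -, rfl⟩ := hv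
                exact hX2 _ a.2 _ b.2)
            (hs.map)
          rw [Finset.card_map] at h1
          refine h1.trans (Finset.card_le_card ?_)
          intro a ha
          simp only [Finset.mem_biUnion, Finset.mem_map, Function.Embedding.subtype_apply] at ha ⊢
          obtain ⟨u, ⟨b, hb, rfl⟩, hu⟩ := ha
          exact ⟨b, hb, hu⟩)
      refine ⟨fun v => if h : v ∈ X then f ⟨v, h⟩ else Classical.arbitrary α, fun _ _ => ⟨?_, ?_⟩⟩
      · intro u hu
        simpa [hu] using hfL ⟨u, hu⟩
      · intro u hu v hv huv
        simp only [hu, hv, dif_pos] at huv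
        simpa using hf huv
    · exact ⟨fun _ => Classical.arbitrary α, fun h1 h2 => absurd ⟨h1, h2⟩ hX⟩
  choose f hf using key
  let cl : V → Finset V := fun u => Finset.univ.filter (fun w => w ∈ W ∧ (w = u ∨ G.Adj u w))
  have hcl : ∀ u ∈ W, (∀ w ∈ cl u, w ∈ W) ∧ ∀ w ∈ cl u, ∀ w' ∈ cl u, w ≠ w' → G.Adj w w' := by
    intro u hu
    refine ⟨fun w hw => (Finset.mem_filter.1 hw).2.1, ?_⟩
    intro w hw w' hw' hne
    obtain ⟨h1, h2⟩ := (Finset.mem_filter.1 hw).2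
    obtain ⟨h3, h4⟩ := (Finset.mem_filter.1 hw').2
    rcases h2 with rfl | h2
    · rcases h4 with rfl | h4
      · exact absurd rfl hne
      · exact h4
    · rcases h4 with rfl | h4
      · exact h2.symm
      · exact hW h1 hu h3 h2.symm h4 hne
  refine ⟨fun u => f (cl u) u, ?_, ?_⟩
  · intro u hu
    exact (hf (cl u) (hcl u hu).1 (hcl u hu).2).1 u (by simp [cl, hu])
  · intro u hu v hv huv heq
    have hc : cl u = cl v := by
      ext w
      simp only [cl, Finset.mem_filter, Finset.mem_univ, true_and, and_congr_right_iff]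
      intro hw
      constructor
      · rintro (rfl | h)
        · exact Or.inr huv.symm
        · by_cases hwv : w = v
          · exact Or.inl hwv
          · exact Or.inr (hW hv hu hw huv.symm h (Ne.symm hwv))
      · rintro (rfl | h)
        · exact Or.inr huv
        · by_cases hwv : w = u
          · exact Or.inl hwv
          · exact Or.inr (hW hu hv hw huv h (Ne.symm hwv))
    simp only [← hc] at heq
    exact huv.ne ((hf (cl u) (hcl u hu).1 (hcl u hu).2).2 u (by simp [cl, hu]) v
      (by simp [cl, hv, huv]) heq)

/-- List colouring of a disjoint union of cliques from a single list. -/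
theorem IsCluster.exists_coloring {V : Type*} [Fintype V] {G : SimpleGraph V} {W : Set V}
    (hW : IsCluster G W) {α : Type*} [Nonempty α] [DecidableEq α] (L : Finset α)
    (hL : ∀ X : Finset V, (∀ u ∈ X, u ∈ W) → (∀ u ∈ X, ∀ v ∈ X, u ≠ v → G.Adj u v) →
      X.card ≤ L.card) :
    ∃ c : V → α, (∀ u ∈ W, c u ∈ L) ∧ ∀ u ∈ W, ∀ v ∈ W, G.Adj u v → c u ≠ c v := by
  refine hW.exists_list_coloring (fun _ => L) fun X h1 h2 h3 => (hL X h1 h2).trans ?_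
  refine Finset.card_le_card fun a ha => ?_
  obtain ⟨u, hu⟩ := h3
  exact Finset.mem_biUnion.2 ⟨u, hu, ha⟩

/-- List colouring of a disjoint union of cliques when one part of the vertices is restricted
to a smaller list. -/
theorem IsCluster.exists_coloring_of_subset {V : Type*} [Fintype V] {G : SimpleGraph V}
    {W : Set V} (hW : IsCluster G W) {α : Type*} [Nonempty α] [DecidableEq α] (P : V → Prop)
    {L₁ L₂ : Finset α} (h12 : L₁ ⊆ L₂)
    (hL₁ : ∀ X : Finset V, (∀ u ∈ X, u ∈ W ∧ P u) →
      (∀ u ∈ X, ∀ v ∈ X, u ≠ v → G.Adj u v) → X.card ≤ L₁.card)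
    (hL₂ : ∀ X : Finset V, (∀ u ∈ X, u ∈ W) →
      (∀ u ∈ X, ∀ v ∈ X, u ≠ v → G.Adj u v) → X.card ≤ L₂.card) :
    ∃ c : V → α, (∀ u ∈ W, c u ∈ L₂ ∧ (P u → c u ∈ L₁)) ∧
      ∀ u ∈ W, ∀ v ∈ W, G.Adj u v → c u ≠ c v := by
  classical
  obtain ⟨c, hc, hc'⟩ := hW.exists_list_coloring (fun u => if P u then L₁ else L₂) (by
    intro X h1 h2 h3
    by_cases hP : ∀ u ∈ X, P u
    · refine (hL₁ X (fun u hu => ⟨h1 u hu, hP u hu⟩) h2).trans (Finset.card_le_card ?_)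
      intro a ha
      obtain ⟨u, hu⟩ := h3
      exact Finset.mem_biUnion.2 ⟨u, hu, by simpa [hP u hu] using ha⟩
    · push Not at hP
      obtain ⟨u, hu, hPu⟩ := hP
      refine (hL₂ X h1 h2).trans (Finset.card_le_card ?_)
      intro a ha
      exact Finset.mem_biUnion.2 ⟨u, hu, by simpa [hPu] using ha⟩)
  refine ⟨c, fun u hu => ?_, hc'⟩
  have := hc u hu
  by_cases hP : P u
  · simp only [hP, if_true] at this
    exact ⟨h12 this, fun _ => this⟩
  · simp only [hP, if_false] at this
    exact ⟨this, fun h => absurd h hP⟩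


/-- A decomposition of the vertex set of a (`P2 + P3`, gem)-free graph with clique number
`Fintype.card ι`: a complete multipartite part with classes indexed by `ι`, and remaining
vertices `u` attached to the classes listed in `typ u`. -/
structure Frame {V : Type*} (G : SimpleGraph V) (ι : Type*) [Fintype ι] where
  /-- The class of a vertex, `none` outside the multipartite part. -/
  part : V → Option ι
  /-- The classes in which a vertex has a neighbour. -/
  typ : V → Finset ι
  /-- A representative of each class. -/
  rep : ι → V
  part_rep : ∀ q, part (rep q) = some q
  adj_iff : ∀ ⦃v w p q⦄, part v = some p → part w = some q → (G.Adj v w ↔ p ≠ q)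
  mem_typ : ∀ ⦃u q⦄, part u = none → (q ∈ typ u ↔ ∃ d, part d = some q ∧ G.Adj u d)
  complete : ∀ ⦃u q d⦄, part u = none → 2 ≤ (typ u).card → q ∈ typ u → part d = some q →
    G.Adj u d
  card_typ : ∀ ⦃u⦄, part u = none → (typ u).card + 2 ≤ Fintype.card ι
  card_clique : ∀ X : Finset V, (∀ u ∈ X, ∀ v ∈ X, u ≠ v → G.Adj u v) →
    X.card ≤ Fintype.card ι
  noGem : NoGem G
  noP2P3 : NoP2P3 G
  three_le : 3 ≤ Fintype.card ι

theorem NoGem.nonempty_frame {V : Type*} {G : SimpleGraph V} (hgem : NoGem G)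
    (hp : NoP2P3 G) (Q : Finset V) (hQ : ∀ u ∈ Q, ∀ v ∈ Q, u ≠ v → G.Adj u v)
    (hmax : ∀ X : Finset V, (∀ u ∈ X, ∀ v ∈ X, u ≠ v → G.Adj u v) → X.card ≤ Q.card)
    (h3 : 3 ≤ Q.card) : Nonempty (Frame G {x // x ∈ Q}) := by
  classical
  set ι := {x // x ∈ Q} with hι
  have hcard : Fintype.card ι = Q.card := Fintype.card_coe Q
  let S : V → ι → Prop := fun v q => ∀ p : ι, G.Adj v p ↔ p ≠ q
  let part : V → Option ι := fun v => if h : ∃ q, S v q then some h.choose else none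
  have hpart : ∀ v q, part v = some q ↔ S v q := by
    intro v q
    constructor
    · intro h
      by_cases h' : ∃ q, S v q
      · simp only [part, dif_pos h', Option.some.injEq] at h
        rw [← h]; exact h'.choose_spec
      · simp [part, dif_neg h'] at h
    · intro h
      have h' : ∃ q, S v q := ⟨q, h⟩
      simp only [part, dif_pos h', Option.some.injEq]
      by_contra hne
      exact (h'.choose_spec _).1 ((h h'.choose).2 hne) rfl
  have hnone : ∀ v, part v = none → ∀ q, ¬ S v q := by
    intro v h q hq
    rw [(hpart v q).2 hq] at h
    simp at h
  have hQadj : ∀ p q : ι, p ≠ q → G.Adj p q := fun p q h =>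
    hQ p p.2 q q.2 (fun h' => h (Subtype.ext h'))
  have hself : ∀ q : ι, part q = some q := by
    intro q
    rw [hpart]
    intro p
    exact ⟨fun h h' => h.ne (by rw [h']), fun h => hQadj _ _ (Ne.symm h)⟩
  have hthird : ∀ p q : ι, ∃ r : ι, r ≠ p ∧ r ≠ q := by
    intro p q
    have : ({p, q} : Finset ι).card < (Finset.univ : Finset ι).card := by
      rw [Finset.card_univ, hcard]
      exact lt_of_le_of_lt Finset.card_le_two (by omega)
    obtain ⟨r, -, hr⟩ := Finset.exists_mem_notMem_of_card_lt_card this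
    simp only [Finset.mem_insert, Finset.mem_singleton, not_or] at hr
    exact ⟨r, hr⟩
  have hadj : ∀ ⦃v w p q⦄, part v = some p → part w = some q → (G.Adj v w ↔ p ≠ q) := by
    intro v w p q hv hw
    rw [hpart] at hv hw
    constructor
    · rintro h rfl
      have h1 : v ∉ Q.erase p := fun h' => by
        have := (hv ⟨v, Finset.mem_of_mem_erase h'⟩).2
          (fun h2 => Finset.ne_of_mem_erase h' (congrArg Subtype.val h2))
        exact this.ne rfl
      have h2 : w ∉ Q.erase p := fun h' => by
        have := (hw ⟨w, Finset.mem_of_mem_erase h'⟩).2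
          (fun h2 => Finset.ne_of_mem_erase h' (congrArg Subtype.val h2))
        exact this.ne rfl
      have hv' : ∀ x ∈ Q.erase (p : V), G.Adj v x := fun x hx =>
        (hv ⟨x, Finset.mem_of_mem_erase hx⟩).2
          (fun h2 => Finset.ne_of_mem_erase hx (congrArg Subtype.val h2))
      have hw' : ∀ x ∈ Q.erase (p : V), G.Adj w x := fun x hx =>
        (hw ⟨x, Finset.mem_of_mem_erase hx⟩).2
          (fun h2 => Finset.ne_of_mem_erase hx (congrArg Subtype.val h2))
      have := hmax (insert v (insert w (Q.erase p))) (by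
        intro x hx y hy hxy
        simp only [Finset.mem_insert] at hx hy
        rcases hx with rfl | rfl | hx <;> rcases hy with rfl | rfl | hy
        · exact absurd rfl hxy
        · exact h
        · exact hv' _ hy
        · exact h.symm
        · exact absurd rfl hxy
        · exact hw' _ hy
        · exact (hv' _ hx).symm
        · exact (hw' _ hx).symm
        · exact hQ _ (Finset.mem_of_mem_erase hx) _ (Finset.mem_of_mem_erase hy) hxy)
      rw [Finset.card_insert_of_notMem, Finset.card_insert_of_notMem h2,
        Finset.card_erase_of_mem p.2] at this
      · omega
      · simp only [Finset.mem_insert, not_or]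
        exact ⟨h.ne, h1⟩
    · intro hpq
      by_contra h
      obtain ⟨r, hr1, hr2⟩ := hthird p q
      exact hgem ((hv r).2 hr1).symm (hQadj r q hr2) (hQadj r p hr1) ((hw r).2 hr2).symm
        ((hv q).2 hpq.symm) (hQadj q p hpq.symm) ((hw p).2 hpq).symm
        (fun h' => (hv p).1 h' rfl) h (fun h' => (hw q).1 h'.symm rfl)
  let N : V → Finset ι := fun u => Finset.univ.filter (fun q => G.Adj u q)
  have hN : ∀ u q, q ∈ N u ↔ G.Adj u q := fun u q => by simp [N]
  have hNcard : ∀ u, part u = none → (N u).card + 2 ≤ Fintype.card ι := by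
    intro u hu
    by_contra hlt
    have hc : (N u)ᶜ.card ≤ 1 := by rw [Finset.card_compl]; omega
    rcases (N u)ᶜ.eq_empty_or_nonempty with he | ⟨q, hq⟩
    · have hall : ∀ q : ι, G.Adj u q := fun q => by
        rw [← hN]
        by_contra h
        have : q ∈ (N u)ᶜ := Finset.mem_compl.2 h
        rw [he] at this; simp at this
      have huQ : u ∉ Q := fun h => (hall ⟨u, h⟩).ne rfl
      have := hmax (insert u Q) (by
        intro x hx y hy hxy
        simp only [Finset.mem_insert] at hx hy
        rcases hx with rfl | hx <;> rcases hy with rfl | hy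
        · exact absurd rfl hxy
        · exact hall ⟨y, hy⟩
        · exact (hall ⟨x, hx⟩).symm
        · exact hQ _ hx _ hy hxy)
      rw [Finset.card_insert_of_notMem huQ] at this
      omega
    · apply hnone u hu q
      intro p
      rw [← hN]
      constructor
      · rintro h rfl
        exact Finset.mem_compl.1 hq h
      · intro hpq
        by_contra h
        exact hpq (Finset.card_le_one.1 hc _ (Finset.mem_compl.2 h) _ hq)
  have hnon : ∀ u, part u = none → ∀ q, ∃ p, p ≠ q ∧ p ∉ N u := by
    intro u hu q
    have h1 := hNcard u hu
    have : (insert q (N u)).card < (Finset.univ : Finset ι).card := by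
      rw [Finset.card_univ]
      exact lt_of_le_of_lt (Finset.card_insert_le _ _) (by omega)
    obtain ⟨r, -, hr⟩ := Finset.exists_mem_notMem_of_card_lt_card this
    simp only [Finset.mem_insert, not_or] at hr
    exact ⟨r, hr⟩
  have hsame : ∀ u, part u = none → ∀ c ∈ N u, ∀ q, c ≠ q → ∀ w, part w = some q →
      (G.Adj u w ↔ q ∈ N u) := by
    intro u hu c hc q hcq w hw
    rw [hN] at hc
    obtain ⟨p, hpq, hpN⟩ := hnon u hu q
    have hpc : p ≠ c := by rintro rfl; exact hpN ((hN _ _).2 hc)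
    rw [hN] at hpN
    rw [hN]
    have hqw : ¬ G.Adj q w := fun h => (hadj (hself q) hw).1 h rfl
    constructor
    · intro h
      by_contra hq
      exact hgem (hQadj c q hcq) (hQadj c p hpc.symm) ((hadj (hself c) hw).2 hcq) hc.symm
        (hQadj q p hpq.symm) ((hadj (hself p) hw).2 hpq) h.symm hqw
        (fun h => hq h.symm) (fun h => hpN h.symm)
    · intro h
      by_contra hq
      exact hgem hc.symm (hQadj c q hcq) (hQadj c p hpc.symm) ((hadj (hself c) hw).2 hcq)
        h (hQadj q p hpq.symm) ((hadj (hself p) hw).2 hpq) hpN hq hqw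
  let typ : V → Finset ι := fun u =>
    Finset.univ.filter (fun q => ∃ d, part d = some q ∧ G.Adj u d)
  have htyp : ∀ u q, q ∈ typ u ↔ ∃ d, part d = some q ∧ G.Adj u d := fun u q => by simp [typ]
  have hsub : ∀ u, N u ⊆ typ u := fun u q hq => (htyp u q).2 ⟨q, hself q, (hN u q).1 hq⟩
  have hcases : ∀ u, part u = none → (typ u).card ≤ 1 ∨ (2 ≤ (N u).card ∧ typ u = N u) := by
    intro u hu
    rcases Nat.lt_or_ge (N u).card 2 with h | h
    · left
      rcases (N u).eq_empty_or_nonempty with he | ⟨c, hc⟩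
      · rw [Finset.card_le_one]
        intro q hq q' hq'
        by_contra hne
        obtain ⟨w, hw, huw⟩ := (htyp u q).1 hq
        obtain ⟨w', hw', huw'⟩ := (htyp u q').1 hq'
        obtain ⟨p, hp1, hp2⟩ := hthird q q'
        have hno : ∀ p : ι, ¬ G.Adj u p := fun p h => by
          have := (hN u p).2 h
          rw [he] at this; simp at this
        exact hgem huw.symm ((hadj hw hw').2 hne) ((hadj hw (hself p)).2 hp1.symm)
          ((hadj hw (hself q')).2 hne) huw' ((hadj hw' (hself p)).2 hp2.symm)
          (hQadj p q' hp2) (hno p) (hno q') (fun h => (hadj hw' (hself q')).1 h rfl)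
      · have hle : (N u).card ≤ 1 := by omega
        rw [Finset.card_le_one]
        have : ∀ q ∈ typ u, c = q := by
          intro q hq
          by_contra hne
          obtain ⟨w, hw, huw⟩ := (htyp u q).1 hq
          exact hne (Finset.card_le_one.1 hle _ hc _ ((hsame u hu c hc q hne w hw).1 huw))
        intro q hq q' hq'
        rw [← this q hq, ← this q' hq']
    · right
      refine ⟨h, (Finset.Subset.antisymm (hsub u) ?_).symm⟩
      intro q hq
      obtain ⟨w, hw, huw⟩ := (htyp u q).1 hq
      obtain ⟨c, hc, hcq⟩ := Finset.exists_mem_ne (show 1 < (N u).card by omega) q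
      exact (hsame u hu c hc q hcq w hw).1 huw
  refine ⟨⟨part, typ, fun q => q, hself, hadj, fun u q _ => htyp u q, ?_, ?_, ?_, hgem, hp, ?_⟩⟩
  · intro u q d hu h2 hq hd
    rcases hcases u hu with h | ⟨h, he⟩
    · omega
    · rw [he] at hq
      obtain ⟨c, hc, hcq⟩ := Finset.exists_mem_ne (show 1 < (N u).card by omega) q
      exact (hsame u hu c hc q hcq d hd).2 hq
  · intro u hu
    rcases hcases u hu with h | ⟨h, he⟩
    · rw [hcard]; omega
    · rw [he]; exact hNcard u hu
  · rw [hcard]; exact hmax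
  · rw [hcard]; exact h3

/-- Vertices of `X` are pairwise adjacent. -/
abbrev PairAdj {V : Type*} (G : SimpleGraph V) (X : Finset V) : Prop :=
  ∀ u ∈ X, ∀ v ∈ X, u ≠ v → G.Adj u v

theorem PairAdj.mono {V : Type*} {G : SimpleGraph V} {X Y : Finset V} (h : PairAdj G Y)
    (hXY : X ⊆ Y) : PairAdj G X :=
  fun u hu v hv => h u (hXY hu) v (hXY hv)

theorem PairAdj.insert {V : Type*} [DecidableEq V] {G : SimpleGraph V} {X : Finset V}
    (h : PairAdj G X) {a : V} (ha : ∀ u ∈ X, a ≠ u → G.Adj a u) : PairAdj G (insert a X) := by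
  intro u hu v hv huv
  rcases Finset.mem_insert.1 hu with h1 | h1 <;> rcases Finset.mem_insert.1 hv with h2 | h2
  · exact absurd (h1.trans h2.symm) huv
  · subst h1; exact ha v h2 huv
  · subst h2; exact (ha u h1 huv.symm).symm
  · exact h u h1 v h2 huv

theorem PairAdj.union {V : Type*} [DecidableEq V] {G : SimpleGraph V} {X Y : Finset V}
    (hX : PairAdj G X) (hY : PairAdj G Y) (hXY : ∀ u ∈ X, ∀ v ∈ Y, u ≠ v → G.Adj u v) :
    PairAdj G (X ∪ Y) := by
  intro u hu v hv huv
  rcases Finset.mem_union.1 hu with hu | hu <;> rcases Finset.mem_union.1 hv with hv | hv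
  · exact hX u hu v hv huv
  · exact hXY u hu v hv huv
  · exact (hXY v hv u hu huv.symm).symm
  · exact hY u hu v hv huv

theorem pairAdj_pair {V : Type*} [DecidableEq V] {G : SimpleGraph V} {a b : V}
    (h : G.Adj a b) : PairAdj G {a, b} := by
  intro u hu v hv huv
  simp only [Finset.mem_insert, Finset.mem_singleton] at hu hv
  rcases hu with rfl | rfl <;> rcases hv with rfl | rfl
  · exact absurd rfl huv
  · exact h
  · exact h.symm
  · exact absurd rfl huv

theorem IsCluster.mono {V : Type*} {G : SimpleGraph V} {W W' : Set V} (h : IsCluster G W)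
    (hs : W' ⊆ W) : IsCluster G W' :=
  fun _ ha _ hb _ hc => h (hs ha) (hs hb) (hs hc)

namespace Frame

set_option linter.unusedSectionVars false

variable {V ι : Type*} [Fintype ι] [DecidableEq ι] {G : SimpleGraph V} (F : Frame G ι)

/-- The vertices outside the multipartite part. -/
def R (u : V) : Prop := F.part u = none

variable {F}

theorem R.not_adj {u d : V} {q : ι} (hu : F.R u) (hq : q ∉ F.typ u)
    (hd : F.part d = some q) : ¬ G.Adj u d :=
  fun h => hq ((F.mem_typ hu).2 ⟨d, hd, h⟩)

theorem R.not_adj_rep {u : V} {q : ι} (hu : F.R u) (hq : q ∉ F.typ u) :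
    ¬ G.Adj u (F.rep q) :=
  hu.not_adj hq (F.part_rep q)

theorem R.exists_adj {u : V} {q : ι} (hu : F.R u) (hq : q ∈ F.typ u) :
    ∃ d, F.part d = some q ∧ G.Adj u d :=
  (F.mem_typ hu).1 hq

theorem R.adj_rep {u : V} {q : ι} (hu : F.R u) (h2 : 2 ≤ (F.typ u).card)
    (hq : q ∈ F.typ u) : G.Adj u (F.rep q) :=
  F.complete hu h2 hq (F.part_rep q)

theorem R.ne {u d : V} {q : ι} (hu : F.R u) (hd : F.part d = some q) : u ≠ d := by
  rintro rfl
  unfold R at hu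
  rw [hu] at hd
  simp at hd

theorem adj_of_ne {v w : V} {p q : ι} (hv : F.part v = some p) (hw : F.part w = some q)
    (h : p ≠ q) : G.Adj v w :=
  (F.adj_iff hv hw).2 h

theorem adj_rep_rep {p q : ι} (h : p ≠ q) : G.Adj (F.rep p) (F.rep q) :=
  adj_of_ne (F.part_rep p) (F.part_rep q) h

theorem typ_ne_univ {u : V} (hu : F.R u) : F.typ u ≠ Finset.univ := by
  intro h
  have := F.card_typ hu
  rw [h, Finset.card_univ] at this
  omega

theorem exists_notMem (S : Finset ι) (h : S.card < Fintype.card ι) : ∃ q, q ∉ S := by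
  by_contra hn
  push Not at hn
  rw [Finset.eq_univ_iff_forall.2 hn, Finset.card_univ] at h
  omega

theorem exists_two_notMem (S : Finset ι) (h : S.card + 2 ≤ Fintype.card ι) :
    ∃ p q, p ≠ q ∧ p ∉ S ∧ q ∉ S := by
  have hc : 1 < Sᶜ.card := by rw [Finset.card_compl]; omega
  obtain ⟨p, hp, q, hq, hpq⟩ := Finset.one_lt_card.1 hc
  exact ⟨p, q, hpq, Finset.mem_compl.1 hp, Finset.mem_compl.1 hq⟩

theorem isCluster_avoid {p q : ι} (hpq : p ≠ q) :
    IsCluster G {u | F.R u ∧ p ∉ F.typ u ∧ q ∉ F.typ u} := by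
  rintro a ⟨ha, hap, haq⟩ b ⟨hb, hbp, hbq⟩ c ⟨hc, hcp, hcq⟩ hab hbc hac
  by_contra hn
  exact F.noP2P3 (adj_rep_rep hpq) hab hbc hac hn
    (fun h => ha.not_adj_rep hap h.symm) (fun h => hb.not_adj_rep hbp h.symm)
    (fun h => hc.not_adj_rep hcp h.symm) (fun h => ha.not_adj_rep haq h.symm)
    (fun h => hb.not_adj_rep hbq h.symm) (fun h => hc.not_adj_rep hcq h.symm)

theorem isCluster_subset (S : Finset ι) (h : S.card + 2 ≤ Fintype.card ι) :
    IsCluster G {u | F.R u ∧ F.typ u ⊆ S} := by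
  obtain ⟨p, q, hpq, hp, hq⟩ := exists_two_notMem S h
  exact (isCluster_avoid hpq).mono fun u hu => ⟨hu.1, fun h => hp (hu.2 h), fun h => hq (hu.2 h)⟩

theorem touch {u w w' : V} (hu : F.R u) (hw : F.R w) (hw' : F.R w') (hww : G.Adj w w')
    {a q : ι} (hau : a ∈ F.typ u) (haw : a ∉ F.typ w) (haw' : a ∉ F.typ w')
    (hqu : q ∉ F.typ u) (hqw : q ∉ F.typ w) (hqw' : q ∉ F.typ w') :
    G.Adj u w ∨ G.Adj u w' := by
  by_contra! hn
  obtain ⟨d, hd, hud⟩ := hu.exists_adj hau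
  have haq : a ≠ q := by rintro rfl; exact hqu hau
  exact F.noP2P3 hww hud (adj_of_ne hd (F.part_rep q) haq) (hu.ne (F.part_rep q))
    (hu.not_adj_rep hqu) (fun h => hn.1 h.symm) (hw.not_adj haw hd) (hw.not_adj_rep hqw)
    (fun h => hn.2 h.symm) (hw'.not_adj haw' hd) (hw'.not_adj_rep hqw')

theorem typ_subset_of_adj {u w : V} (hu : F.R u) (hw : F.R w) (h : G.Adj u w) {c : ι}
    (hcu : c ∈ F.typ u) (hcw : c ∈ F.typ w) {q : ι} (hqu : q ∉ F.typ u) (hqw : q ∉ F.typ w) :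
    F.typ u ⊆ F.typ w := by
  intro a ha
  by_contra haw
  have hac : a ≠ c := by rintro rfl; exact haw hcw
  have haq : a ≠ q := by rintro rfl; exact hqu ha
  have hcq : c ≠ q := by rintro rfl; exact hqu hcu
  have h2 : 2 ≤ (F.typ u).card := Finset.one_lt_card.2 ⟨a, ha, c, hcu, hac⟩
  obtain ⟨d, hd, hwd⟩ := hw.exists_adj hcw
  exact F.noGem hwd.symm (F.complete hu h2 hcu hd).symm (adj_of_ne hd (F.part_rep a) hac.symm)
    (adj_of_ne hd (F.part_rep q) hcq) h.symm (hu.adj_rep h2 ha) (adj_rep_rep haq)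
    (hw.not_adj_rep haw) (hw.not_adj_rep hqw) (hu.not_adj_rep hqu)

theorem typ_eq_or_union {u w : V} (hu : F.R u) (hw : F.R w) (h : G.Adj u w) {c : ι}
    (hcu : c ∈ F.typ u) (hcw : c ∈ F.typ w) :
    F.typ u = F.typ w ∨ F.typ u ∪ F.typ w = Finset.univ := by
  by_contra! hn
  obtain ⟨q, hq⟩ : ∃ q, q ∉ F.typ u ∪ F.typ w := by
    by_contra! h'
    exact hn.2 (Finset.eq_univ_iff_forall.2 h')
  rw [Finset.mem_union, not_or] at hq
  exact hn.1 (Finset.Subset.antisymm (typ_subset_of_adj hu hw h hcu hcw hq.1 hq.2)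
    (typ_subset_of_adj hw hu h.symm hcw hcu hq.2 hq.1))

theorem not_adj_of_ssubset {u w : V} (hu : F.R u) (hw : F.R w) (hn : (F.typ u).Nonempty)
    (h : F.typ u ⊂ F.typ w) : ¬ G.Adj u w := by
  intro hadj
  obtain ⟨c, hc⟩ := hn
  rcases typ_eq_or_union hu hw hadj hc (h.1 hc) with h' | h'
  · exact h.ne h'
  · rw [Finset.union_eq_right.2 h.1] at h'
    exact typ_ne_univ hw h'

theorem adj_of_incomparable {u w : V} (hu : F.R u) (hw : F.R w) {a b c : ι}
    (hcu : c ∈ F.typ u) (hcw : c ∈ F.typ w) (hau : a ∈ F.typ u) (haw : a ∉ F.typ w)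
    (hbu : b ∉ F.typ u) (hbw : b ∈ F.typ w) :
    G.Adj u w ∧ F.typ u ∪ F.typ w = Finset.univ := by
  have hac : a ≠ c := by rintro rfl; exact haw hcw
  have hbc : b ≠ c := by rintro rfl; exact hbu hcu
  have hab : a ≠ b := by rintro rfl; exact hbu hau
  have h2u : 2 ≤ (F.typ u).card := Finset.one_lt_card.2 ⟨a, hau, c, hcu, hac⟩
  have h2w : 2 ≤ (F.typ w).card := Finset.one_lt_card.2 ⟨b, hbw, c, hcw, hbc⟩
  have hadj : G.Adj u w := by
    by_contra hn
    exact F.noGem (hu.adj_rep h2u hcu).symm (adj_rep_rep hac.symm) (adj_rep_rep hbc.symm)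
      (hw.adj_rep h2w hcw).symm (hu.adj_rep h2u hau) (adj_rep_rep hab)
      (hw.adj_rep h2w hbw).symm (hu.not_adj_rep hbu) hn (fun h => hw.not_adj_rep haw h.symm)
  refine ⟨hadj, (typ_eq_or_union hu hw hadj hcu hcw).resolve_left fun h => ?_⟩
  rw [h] at hau
  exact haw hau

theorem adj_of_common {u u' x w d : V} {a : ι} (hd : F.part d = some a) (hud : G.Adj u d)
    (hud' : G.Adj u' d) (hx : F.R x) (hw : F.R w) (hax : a ∉ F.typ x) (haw : a ∉ F.typ w)
    (huu : G.Adj u u') (hux : G.Adj u x) (hux' : G.Adj u' x) (hxw : G.Adj x w)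
    (huw : G.Adj u w) : G.Adj u' w := by
  by_contra hn
  exact F.noGem hud huu hux huw hud'.symm hux' hxw (fun h => hx.not_adj hax hd h.symm)
    (fun h => hw.not_adj haw hd h.symm) hn

theorem adj_of_typ_eq {u u' x w : V} {a : ι} (hu : F.R u) (hu' : F.R u')
    (ht : F.typ u = F.typ u') (h2 : 2 ≤ (F.typ u).card) (ha : a ∈ F.typ u)
    (hx : F.R x) (hw : F.R w) (hax : a ∉ F.typ x) (haw : a ∉ F.typ w)
    (huu : G.Adj u u') (hux : G.Adj u x) (hux' : G.Adj u' x) (hxw : G.Adj x w)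
    (huw : G.Adj u w) : G.Adj u' w :=
  adj_of_common (F.part_rep a) (hu.adj_rep h2 ha) (hu'.adj_rep (ht ▸ h2) (ht ▸ ha)) hx hw hax haw
    huu hux hux' hxw huw

theorem card_add_le {X : Finset V} (hX : PairAdj G X) (hR : ∀ u ∈ X, F.R u) (S : Finset ι)
    (hS : ∀ u ∈ X, ∀ q ∈ S, G.Adj u (F.rep q)) : X.card + S.card ≤ Fintype.card ι := by
  classical
  have hinj : Function.Injective F.rep := fun p q h => by
    have := F.part_rep p
    rw [h, F.part_rep q] at this
    exact (Option.some.inj this).symm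
  have h1 : PairAdj G (S.image F.rep) := by
    intro u hu v hv huv
    obtain ⟨p, -, rfl⟩ := Finset.mem_image.1 hu
    obtain ⟨q, -, rfl⟩ := Finset.mem_image.1 hv
    exact adj_rep_rep fun h => huv (by rw [h])
  have := F.card_clique _ (hX.union h1 (by
    intro u hu v hv _
    obtain ⟨q, hq, rfl⟩ := Finset.mem_image.1 hv
    exact hS u hu q hq))
  rwa [Finset.card_union_of_disjoint, Finset.card_image_of_injective _ hinj] at this
  rw [Finset.disjoint_left]
  intro u hu hv
  obtain ⟨q, -, rfl⟩ := Finset.mem_image.1 hv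
  exact (hR _ hu).ne (F.part_rep q) rfl

theorem card_add_card_le {X : Finset V} (hX : PairAdj G X) (A : Finset ι) (h2 : 2 ≤ A.card)
    (hR : ∀ u ∈ X, F.R u ∧ F.typ u = A) : X.card + A.card ≤ Fintype.card ι :=
  card_add_le hX (fun u hu => (hR u hu).1) A fun u hu _ hq =>
    (hR u hu).1.adj_rep ((hR u hu).2 ▸ h2) ((hR u hu).2 ▸ hq)

variable (F) in
/-- No maximum clique outside the multipartite part has all its vertices attached to the same
single class. -/
def NoBig : Prop :=
  ∀ (q : ι) (X : Finset V), PairAdj G X → (∀ u ∈ X, F.R u ∧ F.typ u = {q}) →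
    X.card < Fintype.card ι

theorem NoBig.card_add_inter_le (hb : F.NoBig) {X : Finset V} (hX : PairAdj G X)
    (hR : ∀ u ∈ X, F.R u) (S : Finset ι) (hS : ∀ u ∈ X, S ⊆ F.typ u) :
    X.card + S.card ≤ Fintype.card ι := by
  rcases S.eq_empty_or_nonempty with rfl | ⟨q, hq⟩
  · simpa using F.card_clique X hX
  by_cases h1 : ∃ u ∈ X, (F.typ u).card ≤ 1
  · obtain ⟨u, hu, h1⟩ := h1
    have htu : F.typ u = {q} :=
      (Finset.eq_of_subset_of_card_le (Finset.singleton_subset_iff.2 (hS u hu hq))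
        (by simpa using h1)).symm
    have hSq : S.card ≤ 1 := (Finset.card_le_card (hS u hu)).trans h1
    have := hb q X hX (by
      intro w hw
      refine ⟨hR w hw, ?_⟩
      by_cases huw : u = w
      · rw [← huw, htu]
      rcases typ_eq_or_union (hR u hu) (hR w hw) (hX u hu w hw huw) (hS u hu hq) (hS w hw hq)
        with h | h
      · rw [← h, htu]
      · rw [htu, Finset.union_eq_right.2 (Finset.singleton_subset_iff.2 (hS w hw hq))] at h
        exact absurd h (typ_ne_univ (hR w hw)))
    omega
  · push Not at h1
    exact card_add_le hX hR S fun u hu p hp => (hR u hu).adj_rep (h1 u hu) (hS u hu hp)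

theorem NoBig.card_le_biUnion (hb : F.NoBig) {X : Finset V} (hX : PairAdj G X)
    (hR : ∀ u ∈ X, F.R u) :
    X.card ≤ (X.biUnion fun u => (F.typ u)ᶜ).card := by
  have := hb.card_add_inter_le hX hR (X.biUnion fun u => (F.typ u)ᶜ)ᶜ (by
    intro u hu q hq
    by_contra h
    exact Finset.mem_compl.1 hq (Finset.mem_biUnion.2 ⟨u, hu, Finset.mem_compl.2 h⟩))
  rw [Finset.card_compl] at this
  have h2 := Finset.card_le_univ (X.biUnion fun u => (F.typ u)ᶜ)
  omega

theorem NoBig.card_add_card_le (hb : F.NoBig) {X : Finset V} (hX : PairAdj G X)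
    (A : Finset ι) (hR : ∀ u ∈ X, F.R u ∧ F.typ u = A) :
    X.card + A.card ≤ Fintype.card ι :=
  hb.card_add_inter_le hX (fun u hu => (hR u hu).1) A fun u hu => (hR u hu).2.ge

theorem colorable_of_coloring {κ : Type*} [Fintype κ] (c : V → ι ⊕ κ)
    (h1 : ∀ u, F.R u → ∀ q ∈ F.typ u, c u ≠ Sum.inl q)
    (h2 : ∀ u, F.R u → ∀ v, F.R v → G.Adj u v → c u ≠ c v) :
    G.Colorable (Fintype.card ι + Fintype.card κ) := by
  let f : V → ι ⊕ κ := fun v => (F.part v).elim (c v) Sum.inl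
  have hcol : G.Coloring (ι ⊕ κ) := SimpleGraph.Coloring.mk f (by
    have key : ∀ u v p, F.part u = none → F.part v = some p → G.Adj u v →
        c u ≠ Sum.inl p := fun u v p hu hv huv =>
      h1 u hu p ((F.mem_typ hu).2 ⟨v, hv, huv⟩)
    intro u v huv
    rcases hu : F.part u with _ | p <;> rcases hv : F.part v with _ | q
    · simpa [f, hu, hv] using h2 u hu v hv huv
    · simpa [f, hu, hv] using key u v q hu hv huv
    · simpa [f, hu, hv] using (key v u p hv hu huv.symm).symm
    · simpa [f, hu, hv] using (F.adj_iff hu hv).1 huv)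
  have := hcol.colorable
  rwa [Fintype.card_sum] at this

theorem NoBig.colorable_of_stable_cluster [Fintype V] (hb : F.NoBig) (I : V → Prop)
    (hI : ∀ u v, F.R u → F.R v → I u → I v → ¬ G.Adj u v)
    (hW : IsCluster G {u | F.R u ∧ ¬ I u}) : G.Colorable (Fintype.card ι + 1) := by
  classical
  have : Nonempty ι := Fintype.card_pos_iff.1 (by have := F.three_le; omega)
  obtain ⟨c, hc, hc'⟩ := hW.exists_list_coloring (fun u => (F.typ u)ᶜ)
    fun X h1 h2 _ => hb.card_le_biUnion h2 fun u hu => (h1 u hu).1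
  refine colorable_of_coloring (F := F) (κ := Fin 1)
    (fun u => if I u then Sum.inr 0 else Sum.inl (c u)) ?_ ?_
  · intro u hu q hq
    by_cases h : I u
    · simp [h]
    · simp only [h, if_false, ne_eq, Sum.inl.injEq]
      rintro rfl
      exact Finset.mem_compl.1 (hc u ⟨hu, h⟩) hq
  · intro u hu v hv huv
    by_cases h : I u <;> by_cases h' : I v <;> simp only [h, h', if_true, if_false, ne_eq,
      Sum.inl.injEq, reduceCtorEq, not_false_eq_true, not_true_eq_false]
    · exact hI u v hu hv h h' huv
    · exact hc' u ⟨hu, h⟩ v ⟨hv, h'⟩ huv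

theorem NoBig.colorable_of_cluster [Fintype V] (hb : F.NoBig)
    (hW : IsCluster G {u | F.R u}) : G.Colorable (Fintype.card ι + 1) :=
  hb.colorable_of_stable_cluster (fun _ => False) (fun _ _ _ _ h => h.elim)
    (hW.mono fun _ hu => hu.1)

theorem nonempty_index (F : Frame G ι) : Nonempty ι :=
  Fintype.card_pos_iff.1 (by have := F.three_le; omega)

variable (F) in
/-- An inclusionwise maximal nonempty type. -/
def IsMaxTyp (A : Finset ι) : Prop :=
  A.Nonempty ∧ (∃ u, F.R u ∧ F.typ u = A) ∧ ∀ u, F.R u → A ⊆ F.typ u → F.typ u = A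

theorem exists_isMaxTyp {u : V} (hu : F.R u) (hn : (F.typ u).Nonempty) :
    ∃ A, F.IsMaxTyp A ∧ F.typ u ⊆ A := by
  classical
  let T : Finset (Finset ι) := Finset.univ.filter fun A => ∃ w, F.R w ∧ F.typ w = A
  have hT : ∀ A, A ∈ T ↔ ∃ w, F.R w ∧ F.typ w = A := fun A => by simp [T]
  obtain ⟨A, hA, hmax⟩ := T.exists_le_maximal ((hT _).2 ⟨u, hu, rfl⟩)
  refine ⟨A, ⟨hn.mono hA, (hT A).1 hmax.1, fun w hw h => ?_⟩, hA⟩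
  exact Finset.Subset.antisymm (hmax.2 ((hT _).2 ⟨w, hw, rfl⟩) h) h

theorem IsMaxTyp.card_add_two_le {A : Finset ι} (h : F.IsMaxTyp A) :
    A.card + 2 ≤ Fintype.card ι := by
  obtain ⟨u, hu, rfl⟩ := h.2.1
  exact F.card_typ hu

theorem adj_of_cluster {S : Finset ι} (h : S.card + 2 ≤ Fintype.card ι) {a b c : V}
    (ha : F.R a) (hb : F.R b) (hc : F.R c) (hSa : F.typ a ⊆ S) (hSb : F.typ b ⊆ S)
    (hSc : F.typ c ⊆ S) (hab : G.Adj a b) (hbc : G.Adj b c) (hac : a ≠ c) : G.Adj a c :=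
  isCluster_subset S h ⟨ha, hSa⟩ ⟨hb, hSb⟩ ⟨hc, hSc⟩ hab hbc hac

/-- If the vertices with a type not contained in `{q}` form a stable set avoiding `q`, they can
all be given colour `q`. -/
theorem colorable_of_stable_off_singleton [Fintype V] (q : ι)
    (hq : ∀ u, F.R u → ¬ F.typ u ⊆ {q} → q ∉ F.typ u)
    (hst : ∀ u v, F.R u → F.R v → ¬ F.typ u ⊆ {q} → ¬ F.typ v ⊆ {q} → ¬ G.Adj u v) :
    G.Colorable (Fintype.card ι + 1) := by
  classical
  have hW := isCluster_subset (F := F) {q} (by have := F.three_le; simpa using this)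
  obtain ⟨c, hc, hc'⟩ := hW.exists_coloring (α := ι ⊕ Fin 1)
    (Finset.univ.erase (Sum.inl q)) (by
      intro X _ h2
      rw [Finset.card_erase_of_mem (Finset.mem_univ _), Finset.card_univ, Fintype.card_sum]
      simpa using F.card_clique X h2)
  have hcq : ∀ u, F.R u → F.typ u ⊆ {q} → c u ≠ Sum.inl q := fun u hu h =>
    Finset.ne_of_mem_erase (hc u ⟨hu, h⟩)
  refine colorable_of_coloring (F := F) (κ := Fin 1)
    (fun u => if F.typ u ⊆ {q} then c u else Sum.inl q) ?_ ?_
  · intro u hu p hp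
    by_cases h : F.typ u ⊆ {q}
    · simp only [h, if_true]
      rw [Finset.mem_singleton.1 (h hp)]
      exact hcq u hu h
    · simp only [h, if_false, ne_eq, Sum.inl.injEq]
      rintro rfl
      exact hq u hu h hp
  · intro u hu v hv huv
    by_cases h : F.typ u ⊆ {q} <;> by_cases h' : F.typ v ⊆ {q} <;>
      simp only [h, h', if_true, if_false]
    · exact hc' u ⟨hu, h⟩ v ⟨hv, h'⟩ huv
    · exact hcq u hu h
    · exact (hcq v hv h').symm
    · exact absurd huv (hst u v hu hv h h')

theorem colorable_of_typ_subset_singleton [Fintype V] (q : ι)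
    (h : ∀ u, F.R u → F.typ u ⊆ {q}) : G.Colorable (Fintype.card ι + 1) :=
  colorable_of_stable_off_singleton q (fun u hu hn => absurd (h u hu) hn)
    fun u _ hu _ hn => absurd (h u hu) hn

theorem isCluster_of_dominating {x : V} (hx : F.R x) (hx0 : F.typ x = ∅)
    (h1 : ∀ w, F.R w → (F.typ w).Nonempty → G.Adj w x)
    (h2 : ∀ v w, F.R v → F.R w → (F.typ v).Nonempty → (F.typ w).Nonempty → v ≠ w → G.Adj v w) :
    IsCluster G {u | F.R u} := by
  have hxs : ∀ S : Finset ι, F.typ x ⊆ S := fun S => by rw [hx0]; exact Finset.empty_subset S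
  have key : ∀ a b c, F.R a → F.R b → F.R c → (F.typ a).Nonempty → F.typ c = ∅ →
      G.Adj a b → G.Adj b c → a ≠ c → G.Adj a c := by
    intro a b c ha hb hc hna hec hab hbc hac
    have hcs : ∀ S : Finset ι, F.typ c ⊆ S := fun S => by rw [hec]; exact Finset.empty_subset S
    rcases (F.typ b).eq_empty_or_nonempty with heb | hnb
    · exact adj_of_cluster (F.card_typ ha) ha hb hc subset_rfl
        (by rw [heb]; exact Finset.empty_subset _) (hcs _) hab hbc hac
    · by_cases hxc : x = c
      · rw [← hxc]; exact h1 a ha hna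
      · exact adj_of_cluster (F.card_typ ha) ha hx hc subset_rfl (hxs _) (hcs _) (h1 a ha hna)
          (adj_of_cluster (F.card_typ hb) hx hb hc (hxs _) subset_rfl (hcs _)
            (h1 b hb hnb).symm hbc hxc) hac
  intro a ha b hb c hc hab hbc hac
  rcases (F.typ a).eq_empty_or_nonempty with hea | hna
  · rcases (F.typ c).eq_empty_or_nonempty with hec | hnc
    · exact adj_of_cluster (F.card_typ hb) ha hb hc (by rw [hea]; exact Finset.empty_subset _)
        subset_rfl (by rw [hec]; exact Finset.empty_subset _) hab hbc hac
    · exact (key c b a hc hb ha hnc hea hbc.symm hab.symm hac.symm).symm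
  · rcases (F.typ c).eq_empty_or_nonempty with hec | hnc
    · exact key a b c ha hb hc hna hec hab hbc hac
    · exact h2 a c ha hc hna hnc hac

/-- An edge between vertices of empty type dominates all vertices of nonempty type. -/
theorem adj_of_empty_edge {x y : V} (hx : F.R x) (hy : F.R y) (hx0 : F.typ x = ∅)
    (hy0 : F.typ y = ∅) (hxy : G.Adj x y) {w : V} (hw : F.R w) (hn : (F.typ w).Nonempty) :
    G.Adj w x := by
  obtain ⟨a, ha⟩ := hn
  obtain ⟨q, hq⟩ := exists_notMem (F.typ w) (by have := F.card_typ hw; omega)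
  rcases touch hw hx hy hxy ha (by simp [hx0]) (by simp [hy0]) hq (by simp [hx0])
    (by simp [hy0]) with h | h
  · exact h
  · refine adj_of_cluster (F.card_typ hw) hw hy hx subset_rfl (by simp [hy0]) (by simp [hx0]) h
      hxy.symm ?_
    rintro rfl
    simp [hx0] at ha

theorem noBig_of_dominating [DecidableEq V] {x : V} (hx0 : F.typ x = ∅)
    (h1 : ∀ w, F.R w → (F.typ w).Nonempty → G.Adj w x) : F.NoBig := by
  intro q X hX hR
  have hxX : x ∉ X := fun h => by
    have := (hR x h).2
    rw [hx0] at this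
    exact Finset.singleton_ne_empty q this.symm
  have := F.card_clique _ (hX.insert (a := x) fun u hu _ =>
    (h1 u (hR u hu).1 (by rw [(hR u hu).2]; exact Finset.singleton_nonempty q)).symm)
  rw [Finset.card_insert_of_notMem hxX] at this
  exact this

theorem IsMaxTyp.card_clique_le {A : Finset ι} (hA : F.IsMaxTyp A) (h2 : 2 ≤ A.card)
    {X : Finset V} (hX : PairAdj G X)
    (hR : ∀ u ∈ X, F.R u ∧ (F.typ u).Nonempty ∧ F.typ u ⊆ A) : X.card ≤ Aᶜ.card := by
  classical
  have hAc := hA.card_add_two_le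
  rw [Finset.card_compl]
  by_cases hall : ∀ u ∈ X, F.typ u = A
  · have := card_add_card_le hX A h2 fun u hu => ⟨(hR u hu).1, hall u hu⟩
    omega
  push Not at hall
  obtain ⟨v, hv, hvA⟩ := hall
  have hss : ∀ w ∈ X, F.typ w ⊂ A := by
    intro w hw
    refine (hR w hw).2.2.ssubset_of_ne fun h => ?_
    by_cases hvw : v = w
    · rw [hvw] at hvA; exact hvA h
    · exact not_adj_of_ssubset (hR v hv).1 (hR w hw).1 (hR v hv).2.1
        (by rw [h]; exact (hR v hv).2.2.ssubset_of_ne hvA) (hX v hv w hw hvw)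
  obtain ⟨u, hu, huA⟩ := hA.2.1
  obtain ⟨q, hq⟩ := exists_notMem A (by omega)
  have hun : ∀ w ∈ X, ∀ w' ∈ X, w ≠ w' → A ⊆ F.typ w ∪ F.typ w' := by
    intro w hw w' hw' hne a ha
    by_contra hn
    rw [Finset.mem_union, not_or] at hn
    rcases touch hu (hR w hw).1 (hR w' hw').1 (hX w hw w' hw' hne) (huA ▸ ha) hn.1 hn.2
      (huA ▸ hq) (fun h => hq ((hR w hw).2.2 h)) (fun h => hq ((hR w' hw').2.2 h)) with h | h
    · exact not_adj_of_ssubset (hR w hw).1 hu (hR w hw).2.1 (huA ▸ hss w hw) h.symm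
    · exact not_adj_of_ssubset (hR w' hw').1 hu (hR w' hw').2.1 (huA ▸ hss w' hw') h.symm
  have hdj : ∀ w ∈ X, ∀ w' ∈ X, w ≠ w' → ∀ c ∈ F.typ w, c ∉ F.typ w' := by
    intro w hw w' hw' hne c hc hc'
    rcases typ_eq_or_union (hR w hw).1 (hR w' hw').1 (hX w hw w' hw' hne) hc hc' with h | h
    · have := hun w hw w' hw' hne
      rw [h, Finset.union_self] at this
      exact (hss w' hw').2 this
    · have := Finset.union_subset (hR w hw).2.2 (hR w' hw').2.2
      rw [h] at this
      exact hq (this (Finset.mem_univ q))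
  have : X.card ≤ 2 := by
    by_contra hlt
    obtain ⟨a, b, c, ha, hb, hc, hab, hac, hbc⟩ := Finset.two_lt_card_iff.1 (not_le.1 hlt)
    obtain ⟨e, he⟩ := (hR c hc).2.1
    have h1 := hun a ha b hb hab ((hR c hc).2.2 he)
    rcases Finset.mem_union.1 h1 with h | h
    · exact hdj a ha c hc hac e h he
    · exact hdj b hb c hc hbc e h he
  omega

theorem colorable_of_cover_of_stable [Fintype V]
    (hcov : ∀ A B, F.IsMaxTyp A → F.IsMaxTyp B → A ≠ B → A ∪ B = Finset.univ)
    (hst : ∀ x y, F.R x → F.R y → F.typ x = ∅ → F.typ y = ∅ → ¬ G.Adj x y) :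
    G.Colorable (Fintype.card ι + 1) := by
  classical
  have := F.nonempty_index
  by_cases hq : ∃ q, ∀ u, F.R u → F.typ u ⊆ {q}
  · obtain ⟨q, hq⟩ := hq
    exact colorable_of_typ_subset_singleton q hq
  push Not at hq
  have hm : ∀ u, ∃ A, F.R u → F.IsMaxTyp A ∧ F.typ u ⊆ A := by
    intro u
    by_cases hu : F.R u
    · rcases (F.typ u).eq_empty_or_nonempty with he | hn
      · obtain ⟨w, hw, hwq⟩ := hq (Classical.arbitrary ι)
        obtain ⟨A, hA, -⟩ := exists_isMaxTyp hw (by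
          rw [Finset.nonempty_iff_ne_empty]
          intro h
          rw [h] at hwq
          exact hwq (Finset.empty_subset _))
        exact ⟨A, fun _ => ⟨hA, by rw [he]; exact Finset.empty_subset _⟩⟩
      · obtain ⟨A, hA⟩ := exists_isMaxTyp hu hn
        exact ⟨A, fun _ => hA⟩
    · exact ⟨∅, fun h => absurd h hu⟩
  choose m hm using hm
  have h2 : ∀ A, F.IsMaxTyp A → 2 ≤ A.card := by
    intro A hA
    by_contra hlt
    have h1 : A.card = 1 := by have := hA.1.card_pos; omega
    obtain ⟨q, rfl⟩ := Finset.card_eq_one.1 h1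
    obtain ⟨u, hu, huq⟩ := hq q
    have hmu := hm u hu
    have h3 := hcov _ _ hmu.1 hA fun h => huq (h ▸ hmu.2)
    have h4 := Finset.card_union_le (m u) {q}
    rw [h3, Finset.card_univ, Finset.card_singleton] at h4
    have := hmu.1.card_add_two_le
    omega
  have hcol : ∀ A, ∃ c : V → ι, F.IsMaxTyp A →
      (∀ u ∈ {u | F.R u ∧ (F.typ u).Nonempty ∧ F.typ u ⊆ A}, c u ∈ Aᶜ) ∧
      ∀ u ∈ {u | F.R u ∧ (F.typ u).Nonempty ∧ F.typ u ⊆ A},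
        ∀ v ∈ {u | F.R u ∧ (F.typ u).Nonempty ∧ F.typ u ⊆ A}, G.Adj u v → c u ≠ c v := by
    intro A
    by_cases hA : F.IsMaxTyp A
    · have hW : IsCluster G {u | F.R u ∧ (F.typ u).Nonempty ∧ F.typ u ⊆ A} :=
        (isCluster_subset A hA.card_add_two_le).mono fun u hu => ⟨hu.1, hu.2.2⟩
      obtain ⟨c, hc⟩ := hW.exists_coloring Aᶜ fun X h1 h3 => hA.card_clique_le (h2 A hA) h3 h1
      exact ⟨c, fun _ => hc⟩
    · exact ⟨fun _ => Classical.arbitrary ι, fun h => absurd h hA⟩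
  choose c hc using hcol
  refine colorable_of_coloring (F := F) (κ := Fin 1)
    (fun u => if (F.typ u).Nonempty then Sum.inl (c (m u) u) else Sum.inr 0) ?_ ?_
  · intro u hu q hq
    have hn : (F.typ u).Nonempty := ⟨q, hq⟩
    simp only [hn, if_true, ne_eq, Sum.inl.injEq]
    rintro rfl
    exact Finset.mem_compl.1 ((hc _ (hm u hu).1).1 u ⟨hu, hn, (hm u hu).2⟩) ((hm u hu).2 hq)
  · intro u hu v hv huv
    by_cases hn : (F.typ u).Nonempty <;> by_cases hn' : (F.typ v).Nonempty <;>
      simp only [hn, hn', if_true, if_false, ne_eq, Sum.inl.injEq, reduceCtorEq,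
        not_false_eq_true, not_true_eq_false]
    · have hu' := (hc _ (hm u hu).1).1 u ⟨hu, hn, (hm u hu).2⟩
      have hv' := (hc _ (hm v hv).1).1 v ⟨hv, hn', (hm v hv).2⟩
      by_cases he : m u = m v
      · rw [← he]
        exact (hc _ (hm u hu).1).2 u ⟨hu, hn, (hm u hu).2⟩ v
          ⟨hv, hn', he ▸ (hm v hv).2⟩ huv
      · intro h
        rw [← h] at hv'
        have h3 := Finset.mem_univ (c (m u) u)
        rw [← hcov _ _ (hm u hu).1 (hm v hv).1 he, Finset.mem_union] at h3
        rcases h3 with h3 | h3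
        · exact Finset.mem_compl.1 hu' h3
        · exact Finset.mem_compl.1 hv' h3
    · exact hst u v hu hv (Finset.not_nonempty_iff_eq_empty.1 hn)
        (Finset.not_nonempty_iff_eq_empty.1 hn') huv

/-- The case of two complementary types, whose vertices form two anticomplete cliques joined to
a clique of vertices of empty type. -/
theorem colorable_of_two_cliques [Fintype V] (h4 : 4 ≤ Fintype.card ι) (A : Finset ι)
    (hA2 : 2 ≤ A.card) (hAc2 : 2 ≤ Aᶜ.card) (K : V → Prop)
    (htyp : ∀ u, F.R u → F.typ u = ∅ ∨ F.typ u = A ∨ F.typ u = Aᶜ)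
    (hKR : ∀ u, K u → F.R u ∧ F.typ u = ∅)
    (hKK : ∀ u v, K u → K v → u ≠ v → G.Adj u v)
    (hKn : ∀ u v, K u → F.R v → (F.typ v).Nonempty → G.Adj u v)
    (hother : ∀ u v, F.R u → F.typ u = ∅ → ¬ K u → F.R v →
      ((F.typ v).Nonempty ∨ K v) → ¬ G.Adj u v)
    (hAA : ∀ u v, F.R u → F.R v → F.typ u = A → F.typ v = A → u ≠ v → G.Adj u v)
    (hBB : ∀ u v, F.R u → F.R v → F.typ u = Aᶜ → F.typ v = Aᶜ → u ≠ v → G.Adj u v)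
    (hAB : ∀ u v, F.R u → F.R v → F.typ u = A → F.typ v = Aᶜ → ¬ G.Adj u v) :
    G.Colorable (Fintype.card ι + (Fintype.card ι + 2) / 4) := by
  classical
  have := F.nonempty_index
  set n := Fintype.card ι with hn
  let XA : Finset V := Finset.univ.filter fun u => F.R u ∧ F.typ u = A
  let XB : Finset V := Finset.univ.filter fun u => F.R u ∧ F.typ u = Aᶜ
  let XK : Finset V := Finset.univ.filter fun u => K u
  have mA : ∀ u, u ∈ XA ↔ F.R u ∧ F.typ u = A := fun u => by simp [XA]
  have mB : ∀ u, u ∈ XB ↔ F.R u ∧ F.typ u = Aᶜ := fun u => by simp [XB]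
  have mK : ∀ u, u ∈ XK ↔ K u := fun u => by simp [XK]
  have neA : A.Nonempty := Finset.card_pos.1 (by omega)
  have neB : Aᶜ.Nonempty := Finset.card_pos.1 (by omega)
  have cA : PairAdj G XA := fun u hu v hv =>
    hAA u v ((mA u).1 hu).1 ((mA v).1 hv).1 ((mA u).1 hu).2 ((mA v).1 hv).2
  have cB : PairAdj G XB := fun u hu v hv =>
    hBB u v ((mB u).1 hu).1 ((mB v).1 hv).1 ((mB u).1 hu).2 ((mB v).1 hv).2
  have cK : PairAdj G XK := fun u hu v hv => hKK u v ((mK u).1 hu) ((mK v).1 hv)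
  have e1 : XA.card + A.card ≤ n := card_add_card_le cA A hA2 fun u hu => (mA u).1 hu
  have e2 : XB.card + Aᶜ.card ≤ n := card_add_card_le cB Aᶜ hAc2 fun u hu => (mB u).1 hu
  have e3 : XK.card + XA.card ≤ n := by
    rw [← Finset.card_union_of_disjoint]
    · exact F.card_clique _ (cK.union cA fun u hu v hv _ =>
        hKn u v ((mK u).1 hu) ((mA v).1 hv).1 (by rw [((mA v).1 hv).2]; exact neA))
    · rw [Finset.disjoint_left]
      intro u hu hv
      have h1 := (hKR u ((mK u).1 hu)).2
      rw [((mA u).1 hv).2] at h1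
      exact neA.ne_empty h1
  have e4 : XK.card + XB.card ≤ n := by
    rw [← Finset.card_union_of_disjoint]
    · exact F.card_clique _ (cK.union cB fun u hu v hv _ =>
        hKn u v ((mK u).1 hu) ((mB v).1 hv).1 (by rw [((mB v).1 hv).2]; exact neB))
    · rw [Finset.disjoint_left]
      intro u hu hv
      have h1 := (hKR u ((mK u).1 hu)).2
      rw [((mB u).1 hv).2] at h1
      exact neB.ne_empty h1
  have hcc : Aᶜ.card = n - A.card := Finset.card_compl A
  have hAn : A.card ≤ n := Finset.card_le_univ A
  let m := (n + 2) / 4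
  let j := min (min XA.card XB.card) m
  obtain ⟨E, hE⟩ := Finset.exists_subset_card_eq (s := (Finset.univ : Finset (Fin m))) (n := j)
    (by simp [j])
  obtain ⟨CA, hCA, hCAc⟩ := Finset.exists_subset_card_eq (s := Aᶜ) (n := XA.card - j) (by omega)
  obtain ⟨CB, hCB, hCBc⟩ := Finset.exists_subset_card_eq (s := A) (n := XB.card - j) (by omega)
  have hEc := hE.2
  let PA : Finset (ι ⊕ Fin m) := CA.disjSum E
  let PB : Finset (ι ⊕ Fin m) := CB.disjSum E
  let PK : Finset (ι ⊕ Fin m) := ((CA ∪ CB).disjSum E)ᶜ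
  have hPK : XK.card ≤ PK.card := by
    have h1 := Finset.card_union_le CA CB
    have h2 : ((CA ∪ CB).disjSum E).card = (CA ∪ CB).card + E.card := Finset.card_disjSum _ _
    have h3 : PK.card = n + m - ((CA ∪ CB).disjSum E).card := by
      rw [Finset.card_compl, Fintype.card_sum, Fintype.card_fin]
    have h5 : m = (n + 2) / 4 := rfl
    have h6 : j = min (min XA.card XB.card) m := rfl
    omega
  have clq : ∀ (X : Finset V), PairAdj G X → IsCluster G {u | u ∈ X} :=
    fun X hX a ha b _ c hc _ _ hac => hX a ha c hc hac
  obtain ⟨fA, hfA, hfA'⟩ := (clq XA cA).exists_coloring PA (by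
    intro X h1 _
    have : PA.card = CA.card + E.card := Finset.card_disjSum _ _
    have h2 : X.card ≤ XA.card := Finset.card_le_card h1
    omega)
  obtain ⟨fB, hfB, hfB'⟩ := (clq XB cB).exists_coloring PB (by
    intro X h1 _
    have : PB.card = CB.card + E.card := Finset.card_disjSum _ _
    have h2 : X.card ≤ XB.card := Finset.card_le_card h1
    omega)
  obtain ⟨fK, hfK, hfK'⟩ := (clq XK cK).exists_coloring PK (by
    intro X h1 _
    exact (Finset.card_le_card h1).trans hPK)
  obtain ⟨f0, -, hf0'⟩ := (isCluster_subset (F := F) ∅ (by simp; omega)).exists_coloring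
    (Finset.univ : Finset (ι ⊕ Fin m)) (by
      intro X _ h2
      have := F.card_clique X h2
      rw [Finset.card_univ, Fintype.card_sum]
      omega)
  let f : V → ι ⊕ Fin m := fun u =>
    if F.typ u = A then fA u else if F.typ u = Aᶜ then fB u else if K u then fK u else f0 u
  have neAB : Aᶜ ≠ A := by
    intro h
    obtain ⟨a, ha⟩ := neA
    exact Finset.mem_compl.1 (h.symm ▸ ha) ha
  have vA : ∀ u, F.typ u = A → f u = fA u := fun u h => by simp [f, h]
  have vB : ∀ u, F.typ u = Aᶜ → f u = fB u := fun u h => by simp [f, h, neAB]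
  have vK : ∀ u, K u → f u = fK u := fun u h => by
    simp [f, h, (hKR u h).2, neA.ne_empty.symm, neB.ne_empty.symm]
  have v0 : ∀ u, F.typ u = ∅ → ¬ K u → f u = f0 u := fun u h h' => by
    simp [f, h, h', neA.ne_empty.symm, neB.ne_empty.symm]
  have key : G.Colorable (n + Fintype.card (Fin m)) := by
    refine colorable_of_coloring (F := F) f ?_ ?_
    · intro u hu q hq
      rcases htyp u hu with h | h | h
      · simp [h] at hq
      · rw [vA u h]
        intro h'
        have := hfA u ((mA u).2 ⟨hu, h⟩)
        rw [h', Finset.inl_mem_disjSum] at this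
        exact Finset.mem_compl.1 (hCA this) (h ▸ hq)
      · rw [vB u h]
        intro h'
        have := hfB u ((mB u).2 ⟨hu, h⟩)
        rw [h', Finset.inl_mem_disjSum] at this
        exact Finset.mem_compl.1 (h ▸ hq) (hCB this)
    · have hKA : ∀ u v, K u → F.R v → F.typ v = A → f u ≠ f v := by
        intro u v hu hv hvA h
        have h1 := hfK u ((mK u).2 hu)
        rw [← vK u hu, h, vA v hvA, Finset.mem_compl] at h1
        have h2 := hfA v ((mA v).2 ⟨hv, hvA⟩)
        exact h1 (Finset.disjSum_mono Finset.subset_union_left subset_rfl h2)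
      have hKB : ∀ u v, K u → F.R v → F.typ v = Aᶜ → f u ≠ f v := by
        intro u v hu hv hvA h
        have h1 := hfK u ((mK u).2 hu)
        rw [← vK u hu, h, vB v hvA, Finset.mem_compl] at h1
        have h2 := hfB v ((mB v).2 ⟨hv, hvA⟩)
        exact h1 (Finset.disjSum_mono Finset.subset_union_right subset_rfl h2)
      have h0 : ∀ u v, F.R u → F.typ u = ∅ → F.R v → G.Adj u v → f u ≠ f v := by
        intro u v hu hu0 hv huv
        by_cases hK : K u
        · rcases htyp v hv with h | h | h
          · by_cases hK' : K v
            · rw [vK u hK, vK v hK']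
              exact hfK' u ((mK u).2 hK) v ((mK v).2 hK') huv
            · exact absurd huv.symm (hother v u hv h hK' hu (Or.inr hK))
          · exact hKA u v hK hv h
          · exact hKB u v hK hv h
        · have hv0 : F.typ v = ∅ := by
            by_contra h
            exact hother u v hu hu0 hK hv (Or.inl (Finset.nonempty_iff_ne_empty.2 h)) huv
          have hvK : ¬ K v := fun h => hother u v hu hu0 hK hv (Or.inr h) huv
          rw [v0 u hu0 hK, v0 v hv0 hvK]
          exact hf0' u ⟨hu, hu0.le⟩ v ⟨hv, hv0.le⟩ huv
      intro u hu v hv huv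
      rcases htyp u hu with h | h | h
      · exact h0 u v hu h hv huv
      · rcases htyp v hv with h' | h' | h'
        · exact (h0 v u hv h' hu huv.symm).symm
        · rw [vA u h, vA v h']
          exact hfA' u ((mA u).2 ⟨hu, h⟩) v ((mA v).2 ⟨hv, h'⟩) huv
        · exact absurd huv (hAB u v hu hv h h')
      · rcases htyp v hv with h' | h' | h'
        · exact (h0 v u hv h' hu huv.symm).symm
        · exact absurd huv.symm (hAB v u hv hu h' h)
        · rw [vB u h, vB v h']
          exact hfB' u ((mB u).2 ⟨hu, h⟩) v ((mB v).2 ⟨hv, h'⟩) huv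
  rwa [Fintype.card_fin] at key

/-- The case in which any two maximal types cover the index set. -/
theorem colorable_of_cover [Fintype V] (h4 : 4 ≤ Fintype.card ι)
    (hcov : ∀ A B, F.IsMaxTyp A → F.IsMaxTyp B → A ≠ B → A ∪ B = Finset.univ) :
    G.Colorable (Fintype.card ι + (Fintype.card ι + 2) / 4) := by
  classical
  have hmono : G.Colorable (Fintype.card ι + 1) →
      G.Colorable (Fintype.card ι + (Fintype.card ι + 2) / 4) := fun h => h.mono (by omega)
  by_cases hst : ∀ x y, F.R x → F.R y → F.typ x = ∅ → F.typ y = ∅ → ¬ G.Adj x y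
  · exact hmono (colorable_of_cover_of_stable hcov hst)
  push Not at hst
  obtain ⟨x, y, hx, hy, hx0, hy0, hxy⟩ := hst
  have hdom : ∀ w, F.R w → (F.typ w).Nonempty → G.Adj w x := fun w hw hn =>
    adj_of_empty_edge hx hy hx0 hy0 hxy hw hn
  by_cases hall : ∀ v w, F.R v → F.R w → (F.typ v).Nonempty → (F.typ w).Nonempty → v ≠ w →
      G.Adj v w
  · exact hmono ((noBig_of_dominating hx0 hdom).colorable_of_cluster
      (isCluster_of_dominating hx hx0 hdom hall))
  push Not at hall
  obtain ⟨u, w, hu, hw, hun, hwn, huw, hnadj⟩ := hall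
  have hxs : ∀ S : Finset ι, F.typ x ⊆ S := fun S => by rw [hx0]; exact Finset.empty_subset S
  have hsub : ∀ v v', F.R v → F.R v' → (F.typ v).Nonempty → F.typ v ⊆ F.typ v' → v ≠ v' →
      G.Adj v v' := fun v v' hv hv' hn hs hne =>
    adj_of_cluster (F.card_typ hv') hv hx hv' hs (hxs _) subset_rfl (hdom v hv hn)
      (hdom v' hv' (hn.mono hs)).symm hne
  have hmax : ∀ v, F.R v → (F.typ v).Nonempty → F.IsMaxTyp (F.typ v) := by
    intro v hv hn
    refine ⟨hn, ⟨v, hv, rfl⟩, fun v' hv' hs => ?_⟩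
    by_contra hne
    have hne' : v ≠ v' := by rintro rfl; exact hne rfl
    exact not_adj_of_ssubset hv hv' hn (hs.ssubset_of_ne (Ne.symm hne))
      (hsub v v' hv hv' hn hs hne')
  have hnsub : ¬ F.typ u ⊆ F.typ w := fun h => hnadj (hsub u w hu hw hun h huw)
  have hnsub' : ¬ F.typ w ⊆ F.typ u := fun h => hnadj (hsub w u hw hu hwn h huw.symm).symm
  have hcover := hcov _ _ (hmax u hu hun) (hmax w hw hwn) fun h => hnsub h.le
  have hdisj : Disjoint (F.typ u) (F.typ w) := by
    rw [Finset.disjoint_left]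
    intro c hc hc'
    obtain ⟨a, ha, ha'⟩ := Finset.not_subset.1 hnsub
    obtain ⟨b, hb, hb'⟩ := Finset.not_subset.1 hnsub'
    exact hnadj (adj_of_incomparable hu hw hc hc' ha ha' hb' hb).1
  have hwc : F.typ w = (F.typ u)ᶜ :=
    (IsCompl.of_eq (disjoint_iff.1 hdisj) hcover).compl_eq.symm
  have c1 := F.card_typ hu
  have c2 := F.card_typ hw
  have c3 : (F.typ u)ᶜ.card = Fintype.card ι - (F.typ u).card := Finset.card_compl _
  have c4 : (F.typ w).card = (F.typ u)ᶜ.card := by rw [hwc]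
  have h2u : 2 ≤ (F.typ u).card := by omega
  have h2w : 2 ≤ (F.typ w).card := by omega
  refine colorable_of_two_cliques (F := F) h4 (F.typ u) h2u (hwc ▸ h2w)
    (fun v => F.R v ∧ F.typ v = ∅ ∧ (v = x ∨ G.Adj v x)) ?_ ?_ ?_ ?_ ?_ ?_ ?_ ?_
  · intro v hv
    by_contra! hn
    have hvn : (F.typ v).Nonempty := hn.1
    have h1 := hcov _ _ (hmax v hv hvn) (hmax u hu hun) hn.2.1
    have h2 := hcov _ _ (hmax v hv hvn) (hmax w hw hwn) (hwc ▸ hn.2.2)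
    apply typ_ne_univ hv
    rw [Finset.eq_univ_iff_forall]
    intro q
    have h3 := Finset.mem_univ q
    have h5 := Finset.mem_univ q
    rw [← h1, Finset.mem_union] at h3
    rw [← h2, Finset.mem_union] at h5
    rcases h3 with h3 | h3
    · exact h3
    · exact h5.resolve_right (Finset.disjoint_left.1 hdisj h3)
  · exact fun v hv => ⟨hv.1, hv.2.1⟩
  · rintro v v' ⟨hv, hv0, h⟩ ⟨hv', hv0', h'⟩ hne
    rcases h with rfl | h
    · exact (h'.resolve_left hne.symm).symm
    · rcases h' with rfl | h'
      · exact h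
      · exact adj_of_cluster (S := ∅) (by simp; omega) hv hx hv' hv0.le hx0.le hv0'.le h h'.symm hne
  · rintro v v' ⟨hv, hv0, h⟩ hv' hn
    rcases h with rfl | h
    · exact (hdom v' hv' hn).symm
    · refine adj_of_cluster (F.card_typ hv') hv hx hv' (by simp [hv0]) (hxs _) subset_rfl h
        (hdom v' hv' hn).symm ?_
      rintro rfl
      simp [hv0] at hn
  · intro v v' hv hv0 hK hv' h hadj
    have hvx : v ≠ x := by rintro rfl; exact hK ⟨hv, hv0, Or.inl rfl⟩
    apply hK
    refine ⟨hv, hv0, Or.inr ?_⟩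
    rcases h with h | ⟨-, h0, h⟩
    · exact adj_of_cluster (F.card_typ hv') hv hv' hx (by simp [hv0]) subset_rfl (hxs _) hadj
        (hdom v' hv' h) hvx
    · rcases h with rfl | h
      · exact hadj
      · exact adj_of_cluster (S := ∅) (by simp; omega) hv hv' hx hv0.le h0.le hx0.le hadj h hvx
  · intro v v' hv hv' h h' hne
    exact hsub v v' hv hv' (h ▸ hun) (h.trans h'.symm).le hne
  · intro v v' hv hv' h h' hne
    exact hsub v v' hv hv' (by rw [h, ← hwc]; exact hwn) (h.trans h'.symm).le hne
  · intro v v' hv hv' h h' hadj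
    rw [← hwc] at h'
    obtain ⟨a, ha⟩ := hun
    obtain ⟨b, hb⟩ := hwn
    have ha' := Finset.disjoint_left.1 hdisj ha
    have hb' := Finset.disjoint_right.1 hdisj hb
    have h1 : G.Adj u v' := by
      by_cases huv : v = u
      · rw [← huv]; exact hadj
      · exact adj_of_typ_eq hv hu h (h ▸ h2u) (h ▸ ha) hx hv' (by simp [hx0]) (h' ▸ ha')
          (hsub v u hv hu (h ▸ ⟨a, ha⟩) h.le huv) (hdom v hv (h ▸ ⟨a, ha⟩)) (hdom u hu ⟨a, ha⟩)
          (hdom v' hv' (h' ▸ ⟨b, hb⟩)).symm hadj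
    have h2 : G.Adj w u := by
      by_cases hwv : v' = w
      · rw [← hwv]; exact h1.symm
      · exact adj_of_typ_eq hv' hw h' (h' ▸ h2w) (h' ▸ hb) hx hu (by simp [hx0]) hb'
          (hsub v' w hv' hw (h' ▸ ⟨b, hb⟩) h'.le hwv) (hdom v' hv' (h' ▸ ⟨b, hb⟩))
          (hdom w hw ⟨b, hb⟩) (hdom u hu ⟨a, ha⟩).symm h1.symm
    exact hnadj h2.symm

end Frame

theorem not_surjective_of_dominated {V : Type*} {G : SimpleGraph V}
    (hcore : ∀ f : G →g G, Function.Surjective f) {b u : V} (hbu : b ≠ u)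
    (h : ∀ w, G.Adj b w → G.Adj u w) : False := by
  classical
  let f : G →g G := ⟨fun v => if v = b then u else v, by
    intro v w hvw
    by_cases hv : v = b <;> by_cases hw : w = b <;> simp only [hv, hw, if_true, if_false]
    · rw [hv, hw] at hvw; exact absurd rfl hvw.ne
    · rw [hv] at hvw; exact h w hvw
    · rw [hw] at hvw; exact (h v hvw.symm).symm
    · exact hvw⟩
  obtain ⟨v, hv⟩ := hcore f b
  change (if v = b then u else v) = b at hv
  by_cases hvb : v = b
  · rw [if_pos hvb] at hv; exact hbu hv.symm
  · rw [if_neg hvb] at hv; exact hvb hv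

namespace Frame

set_option linter.unusedSectionVars false

variable {V ι : Type*} [Fintype ι] [DecidableEq ι] {G : SimpleGraph V} {F : Frame G ι}

variable (F) in
/-- Distinct maximal types are disjoint and do not cover the index set. -/
def MaxDisjoint : Prop :=
  ∀ A B, F.IsMaxTyp A → F.IsMaxTyp B → A ≠ B → Disjoint A B ∧ A ∪ B ≠ Finset.univ

theorem MaxDisjoint.subset_or_disjoint (hd : F.MaxDisjoint) {A : Finset ι} (hA : F.IsMaxTyp A)
    {v : V} (hv : F.R v) :
    (F.typ v ⊆ A ∨ Disjoint A (F.typ v)) ∧ A ∪ F.typ v ≠ Finset.univ := by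
  have hAu : A ≠ Finset.univ := by
    obtain ⟨u, hu, rfl⟩ := hA.2.1
    exact typ_ne_univ hu
  rcases (F.typ v).eq_empty_or_nonempty with he | hn
  · rw [he]; simpa using hAu
  obtain ⟨C, hC, hvC⟩ := exists_isMaxTyp hv hn
  by_cases hAC : A = C
  · rw [← hAC] at hvC
    exact ⟨Or.inl hvC, by rwa [Finset.union_eq_left.2 hvC]⟩
  · obtain ⟨h1, h2⟩ := hd A C hA hC hAC
    refine ⟨Or.inr (h1.mono_right hvC), fun h => h2 ?_⟩
    rw [Finset.eq_univ_iff_forall] at h ⊢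
    exact fun q => Finset.union_subset_union_right hvC (h q)

theorem MaxDisjoint.exists_notMem_union (hd : F.MaxDisjoint) {A : Finset ι} (hA : F.IsMaxTyp A)
    {v : V} (hv : F.R v) : ∃ q, q ∉ A ∧ q ∉ F.typ v := by
  by_contra! h
  refine (hd.subset_or_disjoint hA hv).2 (Finset.eq_univ_iff_forall.2 fun q => ?_)
  by_cases hq : q ∈ A
  · exact Finset.mem_union_left _ hq
  · exact Finset.mem_union_right _ (h q hq)

theorem MaxDisjoint.adj_of_adj_low (hd : F.MaxDisjoint) {u b v : V} (hu : F.R u)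
    (hA : F.IsMaxTyp (F.typ u)) (hb : F.R b) (hbn : (F.typ b).Nonempty)
    (hbu : F.typ b ⊂ F.typ u) (hbv : G.Adj b v) (hn : ¬ G.Adj u v) :
    F.R v ∧ F.typ v = F.typ u \ F.typ b := by
  have h2 : 2 ≤ (F.typ u).card := by
    have h1 := Finset.card_lt_card hbu
    have := hbn.card_pos
    omega
  have hv : F.R v := by
    by_contra h
    obtain ⟨q, hq⟩ := Option.ne_none_iff_exists'.1 h
    exact hn (F.complete hu h2 (hbu.1 ((F.mem_typ hb).2 ⟨v, hq, hbv⟩)) hq)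
  have hbu' : ¬ G.Adj u b := fun h => not_adj_of_ssubset hb hu hbn hbu h.symm
  obtain ⟨q, hqu, hqv⟩ := hd.exists_notMem_union hA hv
  have hqb : q ∉ F.typ b := fun h => hqu (hbu.1 h)
  have hcov : ∀ a ∈ F.typ u, a ∉ F.typ b → a ∈ F.typ v := by
    intro a ha hab
    by_contra hav
    rcases touch hu hb hv hbv ha hab hav hqu hqb hqv with h | h
    · exact hbu' h
    · exact hn h
  obtain ⟨a, ha, hab⟩ := Finset.exists_of_ssubset hbu
  have hsub : F.typ v ⊆ F.typ u := (hd.subset_or_disjoint hA hv).1.resolve_right fun h =>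
    Finset.disjoint_left.1 h ha (hcov a ha hab)
  refine ⟨hv, Finset.Subset.antisymm (fun c hc => ?_) fun c hc => ?_⟩
  · refine Finset.mem_sdiff.2 ⟨hsub hc, fun hcb => ?_⟩
    rcases typ_eq_or_union hb hv hbv hcb hc with h | h
    · exact hab (h ▸ hcov a ha hab)
    · have := Finset.mem_univ q
      rw [← h, Finset.mem_union] at this
      exact this.elim hqb hqv
  · obtain ⟨h, h'⟩ := Finset.mem_sdiff.1 hc
    exact hcov c h h'

variable (F) in
/-- The vertex `v` has a nonempty type strictly contained in `A`. -/
def Low (A : Finset ι) (v : V) : Prop := F.R v ∧ (F.typ v).Nonempty ∧ F.typ v ⊂ A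

theorem MaxDisjoint.typ_of_low_adj_low (hd : F.MaxDisjoint) {A : Finset ι} (hA : F.IsMaxTyp A)
    {v w : V} (hv : F.Low A v) (hw : F.Low A w) (h : G.Adj v w) : F.typ w = A \ F.typ v := by
  obtain ⟨u, hu, rfl⟩ := hA.2.1
  exact (hd.adj_of_adj_low hu hA hv.1 hv.2.1 hv.2.2 h fun h' =>
    not_adj_of_ssubset hw.1 hu hw.2.1 hw.2.2 h'.symm).2

theorem low_of_typ_eq {A : Finset ι} {v w : V} (hv : F.Low A v) (hw : F.R w)
    (h : F.typ w = A \ F.typ v) : F.Low A w := by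
  obtain ⟨a, ha, ha'⟩ := Finset.exists_of_ssubset hv.2.2
  obtain ⟨c, hc⟩ := hv.2.1
  refine ⟨hw, ⟨a, by rw [h]; exact Finset.mem_sdiff.2 ⟨ha, ha'⟩⟩, ?_⟩
  rw [h]
  exact Finset.sdiff_ssubset hv.2.2.1 ⟨c, hc⟩

theorem MaxDisjoint.stable_of_low (hd : F.MaxDisjoint)
    (hcore : ∀ f : G →g G, Function.Surjective f) {A : Finset ι} (hA : F.IsMaxTyp A)
    {b : V} (hb : F.Low A b) {u u' : V} (hu : F.R u) (hu' : F.R u') (huA : F.typ u = A)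
    (huA' : F.typ u' = A) : ¬ G.Adj u u' := by
  classical
  intro huu
  obtain ⟨a, ha⟩ := hA.1
  have hnl : ∀ t v w, F.R t → F.typ t = A → F.Low A v → ¬ F.Low A w → G.Adj v w → G.Adj t w := by
    rintro t v w ht rfl hv hw hvw
    by_contra hn
    obtain ⟨h1, h2⟩ := hd.adj_of_adj_low ht hA hv.1 hv.2.1 hv.2.2 hvw hn
    exact hw (low_of_typ_eq hv h1 h2)
  let f : G →g G := ⟨fun v => if F.Low A v then (if a ∈ F.typ v then u else u') else v, by
    intro v w hvw
    by_cases hv : F.Low A v <;> by_cases hw : F.Low A w <;>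
      simp only [hv, hw, if_true, if_false]
    · have h := hd.typ_of_low_adj_low hA hv hw hvw
      by_cases hav : a ∈ F.typ v
      · have : a ∉ F.typ w := by rw [h]; simp [hav]
        simpa [hav, this] using huu
      · have : a ∈ F.typ w := by rw [h]; simp [hav, ha]
        simpa [hav, this] using huu.symm
    · split_ifs
      · exact hnl u v w hu huA hv hw hvw
      · exact hnl u' v w hu' huA' hv hw hvw
    · split_ifs
      · exact (hnl u w v hu huA hw hv hvw.symm).symm
      · exact (hnl u' w v hu' huA' hw hv hvw.symm).symm
    · exact hvw⟩
  obtain ⟨v, hv⟩ := hcore f b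
  change (if F.Low A v then (if a ∈ F.typ v then u else u') else v) = b at hv
  split_ifs at hv with h1 h2
  · rw [← hv] at hb; exact hb.2.2.ne huA
  · rw [← hv] at hb; exact hb.2.2.ne huA'
  · rw [hv] at h1; exact h1 hb

/-- A low vertex has a neighbour of complementary type, so every vertex of maximal type `A`
sees all vertices whose nonempty type is disjoint from `A`. -/
theorem MaxDisjoint.adj_of_low (hd : F.MaxDisjoint)
    (hcore : ∀ f : G →g G, Function.Surjective f) {u b w : V} (hu : F.R u)
    (hA : F.IsMaxTyp (F.typ u)) (hb : F.Low (F.typ u) b) (hw : F.R w)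
    (hwn : (F.typ w).Nonempty) (hdj : Disjoint (F.typ u) (F.typ w)) :
    G.Adj u w ∧ (F.typ u ∪ F.typ w).card + 1 = Fintype.card ι := by
  obtain ⟨b', hbb', hub'⟩ : ∃ b', G.Adj b b' ∧ ¬ G.Adj u b' := by
    by_contra! h
    exact not_surjective_of_dominated hcore (by rintro rfl; exact hb.2.2.ne rfl) h
  obtain ⟨hb'R, hb't⟩ := hd.adj_of_adj_low hu hA hb.1 hb.2.1 hb.2.2 hbb' hub'
  have hb' := low_of_typ_eq hb hb'R hb't
  obtain ⟨q, hqu, hqw⟩ := hd.exists_notMem_union hA hw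
  obtain ⟨c, hc⟩ := hwn
  have hcu : c ∉ F.typ u := Finset.disjoint_right.1 hdj hc
  have key : ∀ e, F.Low (F.typ u) e → G.Adj w e →
      G.Adj u w ∧ (F.typ u ∪ F.typ w).card + 1 = Fintype.card ι := by
    intro e he hwe
    have huw : G.Adj u w := by
      by_contra hn
      have := (hd.adj_of_adj_low hu hA he.1 he.2.1 he.2.2 hwe.symm hn).2
      rw [this] at hc
      exact hcu (Finset.mem_sdiff.1 hc).1
    refine ⟨huw, ?_⟩
    have h1 : (F.typ u ∪ F.typ w).card < Fintype.card ι := by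
      rw [← Finset.card_univ]
      exact Finset.card_lt_card (Finset.ssubset_univ_iff.2 (hd.subset_or_disjoint hA hw).2)
    by_contra hlt
    refine not_adj_of_ssubset he.1 hu he.2.1 he.2.2 (adj_of_cluster
      (S := F.typ u ∪ F.typ w) (by omega) hu hw he.1 Finset.subset_union_left
      Finset.subset_union_right (he.2.2.1.trans Finset.subset_union_left) huw hwe ?_).symm
    rintro rfl
    exact he.2.2.ne rfl
  rcases touch hw hb.1 hb'.1 hbb' hc (fun h => hcu (hb.2.2.1 h)) (fun h => hcu (hb'.2.2.1 h))
    hqw (fun h => hqu (hb.2.2.1 h)) (fun h => hqu (hb'.2.2.1 h)) with h | h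
  · exact key b hb h
  · exact key b' hb' h

theorem MaxDisjoint.colorable_of_low [Fintype V] (hd : F.MaxDisjoint)
    (hcore : ∀ f : G →g G, Function.Surjective f) {A : Finset ι} (hA : F.IsMaxTyp A) {b : V}
    (hb : F.Low A b) : G.Colorable (Fintype.card ι + 1) := by
  classical
  have := F.nonempty_index
  obtain ⟨u, hu, huA⟩ := hA.2.1
  have hAu : F.IsMaxTyp (F.typ u) := huA ▸ hA
  have hbu : F.Low (F.typ u) b := huA ▸ hb
  have hA2 : 2 ≤ A.card := by
    have h1 := Finset.card_lt_card hb.2.2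
    have := hb.2.1.card_pos
    omega
  have hAc := hA.card_add_two_le
  obtain ⟨y, z, hyz, hy, hz⟩ := exists_two_notMem A hAc
  obtain ⟨a, ha, a', ha', haa'⟩ := Finset.one_lt_card.1 hA2
  have hst : ∀ v w, F.R v → F.R w → F.typ v = A → F.typ w = A → ¬ G.Adj v w :=
    fun v w hv hw h h' => hd.stable_of_low hcore hA hb hv hw h h'
  have hlow : ∀ v w, F.Low A v → F.R w → F.typ w = A → ¬ G.Adj v w := fun v w hv hw h =>
    not_adj_of_ssubset hv.1 hw hv.2.1 (h ▸ hv.2.2)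
  have hlow0 : ∀ v w, F.Low A v → F.R w → F.typ w = ∅ → ¬ G.Adj v w := by
    intro v w hv hw h hadj
    have hvu : F.Low (F.typ u) v := huA ▸ hv
    have huw : G.Adj u w := by
      by_contra hn
      have h1 := (hd.adj_of_adj_low hu hAu hv.1 hv.2.1 hvu.2.2 hadj hn)
      have := (low_of_typ_eq hvu h1.1 h1.2).2.1
      rw [h] at this
      exact Finset.not_nonempty_empty this
    refine hlow v u hv hu huA (adj_of_cluster hAc hu hw hv.1 huA.le (by simp [h]) hv.2.2.1 huw
      hadj.symm ?_).symm
    rintro rfl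
    exact hv.2.2.ne huA
  let W : Set V := {v | F.R v ∧ Disjoint A (F.typ v)}
  have hW : IsCluster G W := (isCluster_avoid haa').mono fun v hv =>
    ⟨hv.1, Finset.disjoint_left.1 hv.2 ha, Finset.disjoint_left.1 hv.2 ha'⟩
  have hcase : ∀ v, F.R v → F.typ v = A ∨ F.Low A v ∨ v ∈ W := by
    intro v hv
    rcases (hd.subset_or_disjoint hA hv).1 with h | h
    · rcases (F.typ v).eq_empty_or_nonempty with he | hn
      · exact Or.inr (Or.inr ⟨hv, by rw [he]; exact Finset.disjoint_empty_right _⟩)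
      · by_cases h' : F.typ v = A
        · exact Or.inl h'
        · exact Or.inr (Or.inl ⟨hv, hn, h.ssubset_of_ne h'⟩)
    · exact Or.inr (Or.inr ⟨hv, h⟩)
  have hdom : ∀ w, w ∈ W → (F.typ w).Nonempty →
      G.Adj u w ∧ (A ∪ F.typ w).card + 1 = Fintype.card ι := by
    intro w hw hn
    rw [← huA]
    exact hd.adj_of_low hcore hu hAu hbu hw.1 hn (huA ▸ hw.2)
  obtain ⟨c, hc, hc'⟩ := hW.exists_coloring_of_subset (α := ι ⊕ Fin 1)
    (fun w => (F.typ w).Nonempty) (L₁ := A.disjSum Finset.univ)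
    (L₂ := Finset.univ.erase (Sum.inl z)) (by
      intro p hp
      refine Finset.mem_erase.2 ⟨?_, Finset.mem_univ _⟩
      rintro rfl
      exact hz (Finset.inl_mem_disjSum.1 hp)) (by
      intro X hX hcl
      rw [Finset.card_disjSum, Finset.card_univ, Fintype.card_fin]
      rcases X.eq_empty_or_nonempty with rfl | ⟨w, hw⟩
      · simp
      have huX : u ∉ X := fun h => by
        have := (hX u h).1.2
        rw [huA, disjoint_self] at this
        exact hA.1.ne_empty this
      have hcard : ∀ w ∈ X, (F.typ w).card + A.card + 1 = Fintype.card ι := by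
        intro w hw
        have := (hdom w (hX w hw).1 (hX w hw).2).2
        rw [Finset.card_union_of_disjoint (hX w hw).1.2] at this
        omega
      by_cases hs : 2 ≤ (F.typ w).card
      · have := Frame.card_add_card_le (F := F) (X := X) hcl (F.typ w) hs (by
          intro v hv
          refine ⟨(hX v hv).1.1, ?_⟩
          by_cases hvw : v = w
          · rw [hvw]
          have h1 := hcard w hw
          have h2 := hcard v hv
          obtain ⟨e, he⟩ : (F.typ v ∩ F.typ w).Nonempty := by
            rw [← Finset.card_pos]
            have h3 := Finset.card_union_add_card_inter (F.typ v) (F.typ w)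
            have h5 : (F.typ v ∪ F.typ w).card ≤ Aᶜ.card := by
              refine Finset.card_le_card (Finset.union_subset ?_ ?_)
              · exact Finset.subset_compl_iff_disjoint_left.2 (hX v hv).1.2
              · exact Finset.subset_compl_iff_disjoint_left.2 (hX w hw).1.2
            rw [Finset.card_compl] at h5
            omega
          rw [Finset.mem_inter] at he
          refine (typ_eq_or_union (hX v hv).1.1 (hX w hw).1.1 (hcl v hv w hw hvw) he.1
            he.2).resolve_right fun h => ?_
          have h6 := Finset.mem_univ a
          rw [← h, Finset.mem_union] at h6
          rcases h6 with h6 | h6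
          · exact Finset.disjoint_left.1 (hX v hv).1.2 ha h6
          · exact Finset.disjoint_left.1 (hX w hw).1.2 ha h6)
        have h1 := hcard w hw
        omega
      · have h1 := hcard w hw
        have h2 := F.card_clique _ (PairAdj.insert (a := u) hcl fun v hv _ =>
          (hdom v (hX v hv).1 (hX v hv).2).1)
        rw [Finset.card_insert_of_notMem huX] at h2
        omega) (by
      intro X _ h2
      rw [Finset.card_erase_of_mem (Finset.mem_univ _), Finset.card_univ, Fintype.card_sum]
      simpa using F.card_clique X h2)
  let f : V → ι ⊕ Fin 1 := fun v =>
    if F.typ v = A then Sum.inl z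
    else if F.Low A v then (if a ∈ F.typ v then Sum.inl z else Sum.inl y) else c v
  have hWA : ∀ v ∈ W, F.typ v ≠ A := by
    intro v hv h
    have := hv.2
    rw [h, disjoint_self] at this
    exact hA.1.ne_empty this
  have hWL : ∀ v ∈ W, ¬ F.Low A v := by
    intro v hv h
    obtain ⟨e, he⟩ := h.2.1
    exact Finset.disjoint_left.1 hv.2 (h.2.2.1 he) he
  have fA : ∀ v, F.typ v = A → f v = Sum.inl z := fun v h => by simp [f, h]
  have fL : ∀ v, F.Low A v → f v = if a ∈ F.typ v then Sum.inl z else Sum.inl y := fun v h => by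
    simp [f, h, h.2.2.ne]
  have fW : ∀ v ∈ W, f v = c v := fun v h => by simp [f, hWA v h, hWL v h]
  have hW1 : ∀ v ∈ W, (F.typ v).Nonempty → ∀ p ∉ A, c v ≠ Sum.inl p := by
    intro v hv hn p hp h
    have := (hc v hv).2 hn
    rw [h, Finset.inl_mem_disjSum] at this
    exact hp this
  have hadjAW : ∀ v w, F.R v → F.typ v = A → w ∈ W → f v ≠ f w := by
    intro v w hv hvA hw
    rw [fA v hvA, fW w hw]
    exact (Finset.ne_of_mem_erase (hc w hw).1).symm
  have hadjLW : ∀ v w, F.Low A v → w ∈ W → G.Adj v w → f v ≠ f w := by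
    intro v w hv hw hvw
    have hn : (F.typ w).Nonempty := by
      rw [Finset.nonempty_iff_ne_empty]
      exact fun h => hlow0 v w hv hw.1 h hvw
    rw [fL v hv, fW w hw]
    split_ifs
    · exact (hW1 w hw hn z hz).symm
    · exact (hW1 w hw hn y hy).symm
  refine colorable_of_coloring (F := F) (κ := Fin 1) f ?_ ?_
  · intro v hv q hq
    rcases hcase v hv with h | h | h
    · rw [fA v h, ne_eq, Sum.inl.injEq]
      rintro rfl
      exact hz (h ▸ hq)
    · have hqA := h.2.2.1 hq
      rw [fL v h]
      split_ifs <;> rw [ne_eq, Sum.inl.injEq] <;> rintro rfl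
      · exact hz hqA
      · exact hy hqA
    · rw [fW v h]
      exact hW1 v h ⟨q, hq⟩ q (Finset.disjoint_right.1 h.2 hq)
  · intro v hv w hw hvw
    rcases hcase v hv with h | h | h <;> rcases hcase w hw with h' | h' | h'
    · exact absurd hvw (hst v w hv hw h h')
    · exact absurd hvw.symm (hlow w v h' hv h)
    · exact hadjAW v w hv h h'
    · exact absurd hvw (hlow v w h hw h')
    · have ht := hd.typ_of_low_adj_low hA h h' hvw
      rw [fL v h, fL w h']
      by_cases hav : a ∈ F.typ v
      · have : a ∉ F.typ w := by rw [ht]; simp [hav]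
        simp [hav, this, hyz.symm]
      · have : a ∈ F.typ w := by rw [ht]; simp [hav, ha]
        simp [hav, this, hyz]
    · exact hadjLW v w h h' hvw
    · exact (hadjAW w v hw h' h).symm
    · exact (hadjLW w v h' h hvw.symm).symm
    · rw [fW v h, fW w h']
      exact hc' v h w h' hvw

/-- A vertex whose nonempty type avoids the class `q` misses exactly one vertex of a maximum
clique attached to `q` only. -/
theorem exists_unique_miss {K : Finset V} (hK : PairAdj G K) (hKc : K.card = Fintype.card ι)
    {q : ι} (hKq : ∀ k ∈ K, F.R k ∧ F.typ k = {q}) {l : V} (hl : F.R l)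
    (hn : (F.typ l).Nonempty) (hql : q ∉ F.typ l) {z : ι} (hzl : z ∉ F.typ l) (hzq : z ≠ q) :
    ∃ k ∈ K, ¬ G.Adj l k ∧ ∀ k' ∈ K, k' ≠ k → G.Adj l k' := by
  classical
  have hlK : l ∉ K := fun h => by
    rw [(hKq l h).2] at hql
    exact hql (Finset.mem_singleton_self q)
  obtain ⟨k, hk, hlk⟩ : ∃ k ∈ K, ¬ G.Adj l k := by
    by_contra! h
    have := F.card_clique _ (PairAdj.insert (a := l) hK fun u hu _ => h u hu)
    rw [Finset.card_insert_of_notMem hlK] at this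
    omega
  obtain ⟨c, hc⟩ := hn
  have hcq : c ≠ q := by rintro rfl; exact hql hc
  refine ⟨k, hk, hlk, fun k' hk' hne => ?_⟩
  exact (touch hl (hKq k hk).1 (hKq k' hk').1 (hK k hk k' hk' hne.symm) hc
    (by rw [(hKq k hk).2]; simpa using hcq) (by rw [(hKq k' hk').2]; simpa using hcq) hzl
    (by rw [(hKq k hk).2]; simpa using hzq)
    (by rw [(hKq k' hk').2]; simpa using hzq)).resolve_left hlk

theorem not_adj_of_big {K : Finset V} (hK : PairAdj G K) (hKc : K.card = Fintype.card ι)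
    {q : ι} (hKq : ∀ k ∈ K, F.R k ∧ F.typ k = {q}) {l l' : V} (hl : F.R l) (hl' : F.R l')
    (hn : (F.typ l).Nonempty) (ht : F.typ l' = F.typ l) (hql : q ∉ F.typ l) {z : ι}
    (hzl : z ∉ F.typ l) (hzq : z ≠ q) : ¬ G.Adj l l' := by
  classical
  intro hll
  obtain ⟨k, hk, hlk, hlo⟩ := exists_unique_miss hK hKc hKq hl hn hql hzl hzq
  obtain ⟨k', hk', hlk', hlo'⟩ :=
    exists_unique_miss hK hKc hKq hl' (ht ▸ hn) (ht ▸ hql) (ht ▸ hzl) hzq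
  have hlK : l ∉ K := fun h => by
    rw [(hKq l h).2] at hql
    exact hql (Finset.mem_singleton_self q)
  have hlK' : l' ∉ K := fun h => by
    rw [← ht, (hKq l' h).2] at hql
    exact hql (Finset.mem_singleton_self q)
  have hkk : k ≠ k' := by
    rintro rfl
    have h1 : PairAdj G (insert l' (K.erase k)) :=
      (hK.mono (Finset.erase_subset _ _)).insert fun u hu _ =>
        hlo' u (Finset.mem_of_mem_erase hu) (Finset.ne_of_mem_erase hu)
    have h2 := F.card_clique _ (h1.insert (a := l) fun u hu _ => by
      rcases Finset.mem_insert.1 hu with rfl | hu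
      · exact hll
      · exact hlo u (Finset.mem_of_mem_erase hu) (Finset.ne_of_mem_erase hu))
    rw [Finset.card_insert_of_notMem, Finset.card_insert_of_notMem
      (fun h => hlK' (Finset.mem_of_mem_erase h)), Finset.card_erase_of_mem hk] at h2
    · have := Finset.card_pos.2 ⟨k, hk⟩
      omega
    · rw [Finset.mem_insert, not_or]
      exact ⟨hll.ne, fun h => hlK (Finset.mem_of_mem_erase h)⟩
  have hkz : ∀ k ∈ K, ¬ G.Adj (F.rep z) k := fun k hk h =>
    (hKq k hk).1.not_adj_rep (by rw [(hKq k hk).2]; simpa using hzq) h.symm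
  obtain ⟨d, hd, hkd⟩ := (hKq k' hk').1.exists_adj (q := q)
    (by rw [(hKq k' hk').2]; exact Finset.mem_singleton_self q)
  have hdl : ¬ G.Adj d l := fun h => hl.not_adj hql hd h.symm
  have hdl' : ¬ G.Adj d l' := fun h => hl'.not_adj (ht ▸ hql) hd h.symm
  by_cases hdk : G.Adj d k
  · obtain ⟨k₂, hk₂, hdk₂⟩ : ∃ k₂ ∈ K, ¬ G.Adj d k₂ := by
      by_contra! h
      have hdK : d ∉ K := fun h' => (hKq d h').1.ne hd rfl
      have := F.card_clique _ (PairAdj.insert (a := d) hK fun u hu _ => h u hu)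
      rw [Finset.card_insert_of_notMem hdK] at this
      omega
    have h1 : k₂ ≠ k := by rintro rfl; exact hdk₂ hdk
    have h2 : k₂ ≠ k' := by rintro rfl; exact hdk₂ hkd.symm
    exact F.noGem hkd (hK k' hk' k hk hkk.symm) (hK k' hk' k₂ hk₂ h2.symm)
      (hlo k' hk' hkk.symm).symm hdk (hK k hk k₂ hk₂ h1.symm) (hlo k₂ hk₂ h1).symm hdk₂ hdl
      (fun h => hlk h.symm)
  · exact F.noP2P3 (adj_of_ne hd (F.part_rep z) hzq.symm) hll (hlo' k hk hkk)
      (fun h => hlK (h ▸ hk)) hlk hdl hdl' hdk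
      (fun h => hl.not_adj_rep hzl h.symm) (fun h => hl'.not_adj_rep (ht ▸ hzl) h.symm) (hkz k hk)

variable (F) in
/-- Distinct types are disjoint and do not cover the index set. -/
def Separated : Prop :=
  ∀ ⦃u v⦄, F.R u → F.R v → F.typ u ≠ F.typ v →
    Disjoint (F.typ u) (F.typ v) ∧ ∃ q, q ∉ F.typ u ∧ q ∉ F.typ v

theorem Separated.exists_notMem (hs : F.Separated) {u v : V} (hu : F.R u) (hv : F.R v) :
    ∃ q, q ∉ F.typ u ∧ q ∉ F.typ v := by
  by_cases h : F.typ u = F.typ v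
  · obtain ⟨q, hq⟩ := Frame.exists_notMem (F.typ u) (by have := F.card_typ hu; omega)
    exact ⟨q, hq, h ▸ hq⟩
  · exact (hs hu hv h).2

theorem Separated.notMem (hs : F.Separated) {u v : V} (hu : F.R u) (hv : F.R v)
    (h : F.typ u ≠ F.typ v) {a : ι} (ha : a ∈ F.typ u) : a ∉ F.typ v :=
  Finset.disjoint_left.1 (hs hu hv h).1 ha

theorem Separated.colorable_of_not_noBig [Fintype V] (hs : F.Separated)
    (h4 : 4 ≤ Fintype.card ι) (hb : ¬ F.NoBig) : G.Colorable (Fintype.card ι + 1) := by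
  classical
  unfold NoBig at hb
  push Not at hb
  obtain ⟨q, K, hK, hKq, hKc⟩ := hb
  have hKc := le_antisymm (F.card_clique K hK) hKc
  obtain ⟨k₀, hk₀⟩ : K.Nonempty := Finset.card_pos.1 (by omega)
  have hne : ∀ u, ¬ F.typ u ⊆ {q} → F.typ u ≠ F.typ k₀ := fun u h h' =>
    h (by rw [h', (hKq k₀ hk₀).2])
  have hqn : ∀ u, F.R u → ¬ F.typ u ⊆ {q} → q ∉ F.typ u := fun u hu h =>
    hs.notMem (hKq k₀ hk₀).1 hu (hne u h).symm (by rw [(hKq k₀ hk₀).2]; simp)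
  have hnon : ∀ u, ¬ F.typ u ⊆ {q} → (F.typ u).Nonempty := fun u h => by
    rw [Finset.nonempty_iff_ne_empty]
    intro h'
    rw [h'] at h
    exact h (Finset.empty_subset _)
  have hz : ∀ u, F.R u → ¬ F.typ u ⊆ {q} → ∃ z, z ∉ F.typ u ∧ z ≠ q := fun u hu h => by
    obtain ⟨z, hz, hz'⟩ := hs.exists_notMem hu (hKq k₀ hk₀).1
    rw [(hKq k₀ hk₀).2, Finset.mem_singleton] at hz'
    exact ⟨z, hz, hz'⟩
  have hlarge : ∀ u, F.R u → ¬ F.typ u ⊆ {q} → Fintype.card ι ≤ (F.typ u).card + 2 := by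
    intro u hu h
    by_contra hlt
    obtain ⟨z, hzu, hzq⟩ := hz u hu h
    obtain ⟨k, hk, huk, hall⟩ := exists_unique_miss hK hKc hKq hu (hnon u h) (hqn u hu h) hzu hzq
    obtain ⟨k', hk', hne⟩ := Finset.exists_mem_ne (show 1 < K.card by omega) k
    refine huk (adj_of_cluster (S := insert q (F.typ u)) ?_ hu (hKq k' hk').1 (hKq k hk).1
      (Finset.subset_insert _ _) (by rw [(hKq k' hk').2]; simp) (by rw [(hKq k hk).2]; simp)
      (hall k' hk' hne) (hK k' hk' k hk hne) ?_)
    · have := Finset.card_insert_le q (F.typ u)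
      omega
    · rintro rfl
      exact h (hKq u hk).2.le
  refine colorable_of_stable_off_singleton q hqn ?_
  intro u v hu hv h h'
  obtain ⟨z, hzu, hzq⟩ := hz u hu h
  by_cases huv : F.typ u = F.typ v
  · exact not_adj_of_big hK hKc hKq hu hv (hnon u h) huv.symm (hqn u hu h) hzu hzq
  · exfalso
    have h1 := Finset.card_union_of_disjoint (hs hu hv huv).1
    have h2 : (F.typ u ∪ F.typ v).card < Fintype.card ι := by
      rw [← Finset.card_univ]
      refine Finset.card_lt_card (Finset.ssubset_univ_iff.2 fun h3 => ?_)
      have := Finset.mem_univ q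
      rw [← h3, Finset.mem_union] at this
      exact this.elim (hqn u hu h) (hqn v hv h')
    have h5 := hlarge u hu h
    have h6 := hlarge v hv h'
    omega

/-- An assignment of distinct colours to the nonempty types, avoiding the types themselves. -/
theorem Separated.exists_typ_coloring [Fintype V] (hs : F.Separated) :
    ∃ σ : Finset ι → ι, (∀ u, F.R u → (F.typ u).Nonempty → σ (F.typ u) ∉ F.typ u) ∧
      ∀ u v, F.R u → F.R v → (F.typ u).Nonempty → (F.typ v).Nonempty → F.typ u ≠ F.typ v →
        σ (F.typ u) ≠ σ (F.typ v) := by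
  classical
  have := F.nonempty_index
  let T : Set (Finset ι) := {A | A.Nonempty ∧ ∃ u, F.R u ∧ F.typ u = A}
  have hT : IsCluster (⊤ : SimpleGraph (Finset ι)) T := fun a _ b _ c _ _ _ h => h
  obtain ⟨σ, h1, h2⟩ := hT.exists_list_coloring (fun A => Aᶜ) (by
    intro X hX _ hne
    by_cases hone : X.card ≤ 1
    · obtain ⟨A, hA⟩ := hne
      obtain ⟨-, u, hu, rfl⟩ := hX A hA
      have h1 := Finset.card_le_card (Finset.subset_biUnion_of_mem (fun A => Aᶜ) hA)
      have h2 := F.card_typ hu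
      have h3 : (F.typ u)ᶜ.card = Fintype.card ι - (F.typ u).card := Finset.card_compl _
      omega
    · have hall : X.biUnion (fun A => Aᶜ) = Finset.univ := by
        obtain ⟨A, hA, B, hB, hAB⟩ := Finset.one_lt_card.1 (not_le.1 hone)
        obtain ⟨-, u, hu, rfl⟩ := hX A hA
        obtain ⟨-, v, hv, rfl⟩ := hX B hB
        rw [Finset.eq_univ_iff_forall]
        intro q
        rw [Finset.mem_biUnion]
        by_cases hq : q ∈ F.typ u
        · exact ⟨_, hB, Finset.mem_compl.2 (hs.notMem hu hv hAB hq)⟩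
        · exact ⟨_, hA, Finset.mem_compl.2 hq⟩
      rw [hall]
      have hch : ∀ A, ∃ a, A ∈ X → a ∈ A := by
        intro A
        by_cases hA : A ∈ X
        · obtain ⟨a, ha⟩ := (hX A hA).1
          exact ⟨a, fun _ => ha⟩
        · exact ⟨Classical.arbitrary ι, fun h => absurd h hA⟩
      choose r hr using hch
      refine Finset.card_le_card_of_injOn r (fun _ _ => Finset.mem_coe.2 (Finset.mem_univ _)) ?_
      intro A hA B hB hAB
      by_contra hne
      have hrA := hr A hA
      have hrB := hr B hB
      obtain ⟨-, u, hu, rfl⟩ := hX A hA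
      obtain ⟨-, v, hv, rfl⟩ := hX B hB
      rw [← hAB] at hrB
      exact hs.notMem hu hv hne hrA hrB)
  exact ⟨σ, fun u hu hn => Finset.mem_compl.1 (h1 _ ⟨hn, u, hu, rfl⟩),
    fun u v hu hv hn hn' hne => h2 _ ⟨hn, u, hu, rfl⟩ _ ⟨hn', v, hv, rfl⟩ hne⟩

/-- If any two distinct nonempty types leave two indices uncovered then one extra colour
suffices. -/
theorem Separated.colorable_of_small_unions [Fintype V] (hs : F.Separated) (hb : F.NoBig)
    (hsmall : ∀ u v, F.R u → F.R v → (F.typ u).Nonempty → (F.typ v).Nonempty →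
      F.typ u ≠ F.typ v → (F.typ u ∪ F.typ v).card + 2 ≤ Fintype.card ι)
    (hex : ∃ u, F.R u ∧ (F.typ u).Nonempty) : G.Colorable (Fintype.card ι + 1) := by
  classical
  by_cases hedge : ∃ t k k', F.R t ∧ (F.typ t).Nonempty ∧ F.R k ∧ F.R k' ∧
      F.typ k ⊆ F.typ t ∧ F.typ k' ⊆ F.typ t ∧ G.Adj k k'
  · obtain ⟨t, k, k', ht, htn, hk, hk', hkt, hkt', hkk⟩ := hedge
    have hsm : ∀ v, F.R v → (F.typ t ∪ F.typ v).card + 2 ≤ Fintype.card ι := by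
      intro v hv
      rcases (F.typ v).eq_empty_or_nonempty with he | hn
      · rw [he, Finset.union_empty]; exact F.card_typ ht
      · by_cases h : F.typ t = F.typ v
        · rw [h, Finset.union_self]; exact F.card_typ hv
        · exact hsmall t v ht hv htn hn h
    have hsub : ∀ v, F.R v → F.typ v ⊆ F.typ t ∨ ((F.typ v).Nonempty ∧ F.typ v ≠ F.typ t) := by
      intro v hv
      rcases (F.typ v).eq_empty_or_nonempty with he | hn
      · left; rw [he]; exact Finset.empty_subset _
      · by_cases h : F.typ v = F.typ t
        · exact Or.inl h.le
        · exact Or.inr ⟨hn, h⟩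
    have hdom : ∀ w, F.R w → (F.typ w).Nonempty → F.typ w ≠ F.typ t → G.Adj w k := by
      intro w hw hn hne
      obtain ⟨c, hc⟩ := hn
      have hct := hs.notMem hw ht hne hc
      obtain ⟨q, hqw, hqt⟩ := hs.exists_notMem hw ht
      rcases touch hw hk hk' hkk hc (fun h => hct (hkt h)) (fun h => hct (hkt' h)) hqw
        (fun h => hqt (hkt h)) (fun h => hqt (hkt' h)) with h | h
      · exact h
      · refine adj_of_cluster (hsm w hw) hw hk' hk Finset.subset_union_right
          (hkt'.trans Finset.subset_union_left) (hkt.trans Finset.subset_union_left) h hkk.symm ?_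
        rintro rfl
        exact hct (hkt hc)
    have hclosed : ∀ v w, F.R v → F.R w → G.Adj v w → (v = k ∨ G.Adj v k) →
        w = k ∨ G.Adj w k := by
      intro v w hv hw hvw h
      by_contra! hn
      rcases h with rfl | h
      · exact hn.2 hvw.symm
      · rcases hsub w hw with h' | ⟨h', h''⟩
        · exact hn.2 (adj_of_cluster (hsm v hv) hw hv hk (h'.trans Finset.subset_union_left)
            Finset.subset_union_right (hkt.trans Finset.subset_union_left) hvw.symm h hn.1)
        · exact hn.2 (hdom w hw h' h'')
    have hbad : ∀ a b c, F.R a → F.R b → F.R c → G.Adj a b → G.Adj b c → a ≠ c →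
        ¬ G.Adj a c → (F.typ a).Nonempty ∧ F.typ a ≠ F.typ t ∧ F.typ a ≠ F.typ c ∧
          Fintype.card ι ≤ (F.typ t ∪ F.typ a ∪ F.typ c).card + 1 ∧
          ∀ v, F.R v → F.typ v = F.typ a → v = a := by
      intro a b c ha hb' hc hab hbc hac hnac
      have hb0 : b = k ∨ G.Adj b k := by
        by_contra hn
        have hak : ¬ (a = k ∨ G.Adj a k) := fun h => hn (hclosed a b ha hb' hab h)
        have hck : ¬ (c = k ∨ G.Adj c k) := fun h => hn (hclosed c b hc hb' hbc.symm h)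
        have hout : ∀ v, F.R v → ¬ (v = k ∨ G.Adj v k) → F.typ v ⊆ F.typ t := fun v hv h =>
          (hsub v hv).resolve_right fun h' => h (Or.inr (hdom v hv h'.1 h'.2))
        exact hnac (adj_of_cluster (F.card_typ ht) ha hb' hc (hout a ha hak) (hout b hb' hn)
          (hout c hc hck) hab hbc hac)
      have hak : G.Adj a k := by
        rcases hclosed b a hb' ha hab.symm hb0 with h | h
        · exfalso
          rcases hclosed b c hb' hc hbc hb0 with h' | h'
          · exact hac (h.trans h'.symm)
          · rw [← h] at h'; exact hnac h'.symm
        · exact h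
      have hck : G.Adj c k := by
        rcases hclosed b c hb' hc hbc hb0 with h | h
        · rw [← h] at hak; exact absurd hak hnac
        · exact h
      have hat : ¬ F.typ a ⊆ F.typ t := fun h =>
        hnac (adj_of_cluster (hsm c hc) ha hk hc (h.trans Finset.subset_union_left)
          (hkt.trans Finset.subset_union_left) Finset.subset_union_right hak hck.symm hac)
      have hct : ¬ F.typ c ⊆ F.typ t := fun h =>
        hnac (adj_of_cluster (hsm a ha) ha hk hc Finset.subset_union_right
          (hkt.trans Finset.subset_union_left) (h.trans Finset.subset_union_left) hak hck.symm hac)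
      obtain ⟨han, hant⟩ := (hsub a ha).resolve_left hat
      obtain ⟨hcn, hcnt⟩ := (hsub c hc).resolve_left hct
      have hne : F.typ a ≠ F.typ c := fun h =>
        hnac (adj_of_cluster (hsm a ha) ha hk hc Finset.subset_union_right
          (hkt.trans Finset.subset_union_left) (h ▸ Finset.subset_union_right) hak hck.symm hac)
      refine ⟨han, hant, hne, ?_, ?_⟩
      · by_contra hlt
        exact hnac (adj_of_cluster (S := F.typ t ∪ F.typ a ∪ F.typ c) (by omega) ha hk hc
          (Finset.subset_union_right.trans Finset.subset_union_left)
          (hkt.trans (Finset.subset_union_left.trans Finset.subset_union_left))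
          Finset.subset_union_right hak hck.symm hac)
      · intro v hv hva
        by_contra hva'
        have hvk := hdom v hv (hva ▸ han) (hva ▸ hant)
        have hav : G.Adj a v := adj_of_cluster (hsm a ha) ha hk hv Finset.subset_union_right
          (hkt.trans Finset.subset_union_left) (hva ▸ Finset.subset_union_right) hak hvk.symm
          (Ne.symm hva')
        obtain ⟨e, he⟩ := hcn
        have hea := hs.notMem hc ha hne.symm he
        obtain ⟨q, hqa, hqc⟩ := hs.exists_notMem ha hc
        rcases touch hc ha hv hav he hea (hva ▸ hea) hqc hqa (hva ▸ hqa) with h | h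
        · exact hnac h.symm
        · exact hnac (adj_of_cluster (hsmall a c ha hc han ⟨e, he⟩ hne) ha hv hc
            Finset.subset_union_left (hva ▸ Finset.subset_union_left) Finset.subset_union_right
            hav h.symm hac)
    by_cases hcl : IsCluster G {u | F.R u}
    · exact hb.colorable_of_cluster hcl
    unfold IsCluster at hcl
    push Not at hcl
    obtain ⟨a, ha, b, hb', c, hc, hab, hbc, hac, hnac⟩ := hcl
    obtain ⟨han, hat, hne, hcard, hau⟩ := hbad a b c ha hb' hc hab hbc hac hnac
    obtain ⟨hcn, hct, -, -, hcu⟩ := hbad c b a hc hb' ha hbc.symm hab.symm hac.symm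
      (fun h => hnac h.symm)
    refine hb.colorable_of_stable_cluster (fun u => u = a ∨ u = c) ?_ ?_
    · rintro u v - - (rfl | rfl) (rfl | rfl) h
      · exact h.ne rfl
      · exact hnac h
      · exact hnac h.symm
      · exact h.ne rfl
    · rintro a' ⟨ha', hna'⟩ b' ⟨hb'', -⟩ c' ⟨hc', hnc'⟩ hab' hbc' hac'
      by_contra hnac'
      obtain ⟨han', hat', hne', -, -⟩ := hbad a' b' c' ha' hb'' hc' hab' hbc' hac' hnac'
      obtain ⟨hcn', hct', -, -, -⟩ := hbad c' b' a' hc' hb'' ha' hbc'.symm hab'.symm hac'.symm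
        (fun h => hnac' h.symm)
      obtain ⟨p, hp⟩ := han'
      obtain ⟨q, hq⟩ := hcn'
      have hpq : p ≠ q := by rintro rfl; exact hs.notMem ha' hc' hne' hp hq
      have hout : ∀ v, F.R v → ¬ (v = a ∨ v = c) → F.typ v ≠ F.typ t → ∀ p ∈ F.typ v,
          p ∈ (F.typ t ∪ F.typ a ∪ F.typ c)ᶜ := by
        intro v hv hvn hvt p hp
        rw [Finset.mem_compl, Finset.mem_union, Finset.mem_union]
        rintro ((h | h) | h)
        · exact hs.notMem hv ht hvt hp h
        · exact hs.notMem hv ha (fun h => hvn (Or.inl (hau v hv h))) hp h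
        · exact hs.notMem hv hc (fun h => hvn (Or.inr (hcu v hv h))) hp h
      have hc1 : (F.typ t ∪ F.typ a ∪ F.typ c)ᶜ.card ≤ 1 := by
        rw [Finset.card_compl]; omega
      exact hpq (Finset.card_le_one.1 hc1 p (hout a' ha' hna' hat' p hp) q
        (hout c' hc' hnc' hct' q hq))
  · push Not at hedge
    obtain ⟨σ, hσ, hσ'⟩ := hs.exists_typ_coloring
    obtain ⟨t, ht, htn⟩ := hex
    refine colorable_of_coloring (F := F) (κ := Fin 1)
      (fun u => if (F.typ u).Nonempty then Sum.inl (σ (F.typ u)) else Sum.inr 0) ?_ ?_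
    · intro u hu q hq
      have hn : (F.typ u).Nonempty := ⟨q, hq⟩
      simp only [hn, if_true, ne_eq, Sum.inl.injEq]
      rintro rfl
      exact hσ u hu hn hq
    · intro u hu v hv huv
      by_cases hn : (F.typ u).Nonempty <;> by_cases hn' : (F.typ v).Nonempty <;>
        simp only [hn, hn', if_true, if_false, ne_eq, Sum.inl.injEq, reduceCtorEq,
          not_false_eq_true, not_true_eq_false]
      · exact hσ' u v hu hv hn hn' fun h => hedge u u v hu hn hu hv subset_rfl h.ge huv
      · exact hedge t u v ht htn hu hv (by simp [Finset.not_nonempty_iff_eq_empty.1 hn])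
          (by simp [Finset.not_nonempty_iff_eq_empty.1 hn']) huv

variable (F) in
/-- Two disjoint sets `A`, `B` cover all indices but `z`, and every type is empty or one of
`A`, `B`, `{z}`. -/
structure NearCover (A B : Finset ι) (z : ι) : Prop where
  disj : ∀ a ∈ A, a ∉ B
  two_le : 2 ≤ A.card
  nonempty : B.Nonempty
  notMem_left : z ∉ A
  notMem_right : z ∉ B
  card_add : A.card + B.card + 1 = Fintype.card ι
  typ_cases : ∀ u, F.R u → F.typ u = ∅ ∨ F.typ u = A ∨ F.typ u = B ∨ F.typ u = {z}

namespace NearCover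

variable {A B : Finset ι} {z : ι}

theorem exists_pair (h : F.NearCover A B z) : ∃ a ∈ A, ∃ a' ∈ A, a ≠ a' :=
  Finset.one_lt_card.1 h.two_le

theorem isCluster_ne (h : F.NearCover A B z) : IsCluster G {u | F.R u ∧ F.typ u ≠ A} := by
  obtain ⟨a, ha, a', ha', hne⟩ := h.exists_pair
  refine (isCluster_avoid (F := F) hne).mono ?_
  rintro u ⟨hu, hn⟩
  have : ∀ q ∈ A, q ∉ F.typ u := by
    intro q hq hqu
    rcases h.typ_cases u hu with h1 | h1 | h1 | h1
    · rw [h1] at hqu; exact absurd hqu (Finset.notMem_empty q)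
    · exact hn h1
    · rw [h1] at hqu; exact h.disj q hq hqu
    · rw [h1, Finset.mem_singleton] at hqu; exact h.notMem_left (hqu ▸ hq)
  exact ⟨hu, this a ha, this a' ha'⟩

theorem isCluster_ne_right (h : F.NearCover A B z) (h2 : 2 ≤ B.card) :
    IsCluster G {u | F.R u ∧ F.typ u ≠ B} := by
  obtain ⟨b, hb, b', hb', hne⟩ := Finset.one_lt_card.1 h2
  refine (isCluster_avoid (F := F) hne).mono ?_
  rintro u ⟨hu, hn⟩
  have : ∀ q ∈ B, q ∉ F.typ u := by
    intro q hq hqu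
    rcases h.typ_cases u hu with h1 | h1 | h1 | h1
    · rw [h1] at hqu; exact absurd hqu (Finset.notMem_empty q)
    · rw [h1] at hqu; exact h.disj q hqu hq
    · exact hn h1
    · rw [h1, Finset.mem_singleton] at hqu; exact h.notMem_right (hqu ▸ hq)
  exact ⟨hu, this b hb, this b' hb'⟩

/-- A vertex `l` attached to `B` touches every edge `kk'` inside the `A`-part; if some `x` is
adjacent to all three of `k`, `k'`, `l`, then `l` is adjacent to `k`. -/
theorem adj_cross (h : F.NearCover A B z) {k k' l x : V} (hk : F.R k) (hk' : F.R k')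
    (hl : F.R l) (hx : F.R x) (hkA : F.typ k = A) (hkA' : F.typ k' = A) (hlB : F.typ l = B)
    (hxA : F.typ x ≠ A) (hkk : G.Adj k k') (hxk : G.Adj x k) (hxk' : G.Adj x k')
    (hxl : G.Adj x l) : G.Adj k l := by
  obtain ⟨a, ha, -⟩ := h.exists_pair
  obtain ⟨b, hb⟩ := h.nonempty
  have hbA : b ∉ A := fun h' => h.disj b h' hb
  have hax : a ∉ F.typ x := by
    intro hax
    rcases h.typ_cases x hx with h1 | h1 | h1 | h1
    · rw [h1] at hax; exact absurd hax (Finset.notMem_empty a)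
    · exact hxA h1
    · rw [h1] at hax; exact h.disj a ha hax
    · rw [h1, Finset.mem_singleton] at hax; exact h.notMem_left (hax ▸ ha)
  have hal : a ∉ F.typ l := by rw [hlB]; exact h.disj a ha
  rcases touch hl hk hk' hkk (a := b) (q := z) (hlB ▸ hb) (hkA ▸ hbA) (hkA' ▸ hbA)
    (hlB ▸ h.notMem_right) (hkA ▸ h.notMem_left) (hkA' ▸ h.notMem_left) with h1 | h1
  · exact h1.symm
  · exact adj_of_typ_eq hk' hk (hkA'.trans hkA.symm) (hkA' ▸ h.two_le) (hkA' ▸ ha) hx hl hax hal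
      hkk.symm hxk'.symm hxk.symm hxl h1.symm

theorem colorable_of_stable [Fintype V] (h : F.NearCover A B z) (hb : F.NoBig)
    (hst : ∀ u v, F.R u → F.R v → F.typ u = A → F.typ v = A → ¬ G.Adj u v) :
    G.Colorable (Fintype.card ι + 1) :=
  hb.colorable_of_stable_cluster (fun u => F.typ u = A) hst h.isCluster_ne

theorem colorable_of_no_third [Fintype V] (h : F.NearCover A B z) (hb : F.NoBig)
    (hz : ∀ u, F.R u → F.typ u ≠ {z}) {k k' : V} (hk : F.R k) (hk' : F.R k')
    (hkA : F.typ k = A) (hkA' : F.typ k' = A) (hkk : G.Adj k k') :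
    G.Colorable (Fintype.card ι + 1) := by
  classical
  have hA0 : A ≠ ∅ := by
    rintro rfl
    have := h.two_le
    simp at this
  have hAle : A.card + 2 ≤ Fintype.card ι := hkA ▸ F.card_typ hk
  have hAB : A ≠ B := by
    intro hAB
    obtain ⟨a, ha, -⟩ := h.exists_pair
    exact h.disj a ha (hAB ▸ ha)
  by_cases hedge : ∃ x y, F.R x ∧ F.R y ∧ F.typ x = ∅ ∧ F.typ y = ∅ ∧ G.Adj x y
  · obtain ⟨x, y, hx, hy, hx0, hy0, hxy⟩ := hedge
    have hdom : ∀ w, F.R w → (F.typ w).Nonempty → G.Adj w x := fun w hw hn =>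
      adj_of_empty_edge hx hy hx0 hy0 hxy hw hn
    have hsame : ∀ v w, F.R v → F.R w → (F.typ v).Nonempty → F.typ v = F.typ w → v ≠ w →
        G.Adj v w := fun v w hv hw hn hvw hne =>
      adj_of_cluster (F.card_typ hv) hv hx hw subset_rfl (by simp [hx0]) hvw.ge (hdom v hv hn)
        (hdom w hw (hvw ▸ hn)).symm hne
    have hcross : ∀ v w, F.R v → F.R w → F.typ v = A → F.typ w = B → G.Adj v w := by
      intro v w hv hw hvA hwB
      obtain ⟨v', hv', hvA', hvv⟩ : ∃ v', F.R v' ∧ F.typ v' = A ∧ v ≠ v' := by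
        by_cases hvk : v = k
        · exact ⟨k', hk', hkA', hvk ▸ hkk.ne⟩
        · exact ⟨k, hk, hkA, hvk⟩
      have hAn := Finset.nonempty_iff_ne_empty.2 hA0
      exact h.adj_cross hv hv' hw hx hvA hvA' hwB (by rw [hx0]; exact hA0.symm)
        (hsame v v' hv hv' (hvA ▸ hAn) (hvA.trans hvA'.symm) hvv)
        (hdom v hv (hvA ▸ hAn)).symm (hdom v' hv' (hvA' ▸ hAn)).symm
        (hdom w hw (hwB ▸ h.nonempty)).symm
    refine hb.colorable_of_cluster (isCluster_of_dominating hx hx0 hdom ?_)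
    intro v w hv hw hvn hwn hvw
    rcases h.typ_cases v hv with h1 | h1 | h1 | h1
    · exact absurd h1 hvn.ne_empty
    · rcases h.typ_cases w hw with h2 | h2 | h2 | h2
      · exact absurd h2 hwn.ne_empty
      · exact hsame v w hv hw hvn (h1.trans h2.symm) hvw
      · exact hcross v w hv hw h1 h2
      · exact absurd h2 (hz w hw)
    · rcases h.typ_cases w hw with h2 | h2 | h2 | h2
      · exact absurd h2 hwn.ne_empty
      · exact (hcross w v hw hv h2 h1).symm
      · exact hsame v w hv hw hvn (h1.trans h2.symm) hvw
      · exact absurd h2 (hz w hw)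
    · exact absurd h1 (hz v hv)
  · have hst : ∀ x y, F.R x → F.R y → F.typ x = ∅ → F.typ y = ∅ → ¬ G.Adj x y :=
      fun x y hx hy hx0 hy0 hxy => hedge ⟨x, y, hx, hy, hx0, hy0, hxy⟩
    have := F.nonempty_index
    let P : V → Prop := fun x => F.typ x = ∅ ∧ ∃ L : Finset V, PairAdj G L ∧
      (∀ l ∈ L, F.R l ∧ F.typ l = B ∧ G.Adj x l) ∧ L.card = A.card + 1
    have hclA : IsCluster G {u | F.R u ∧ (F.typ u = A ∨ P u)} := by
      refine (isCluster_subset (F := F) A hAle).mono ?_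
      rintro u ⟨hu, h1 | h1⟩
      · exact ⟨hu, h1.le⟩
      · exact ⟨hu, by rw [h1.1]; exact Finset.empty_subset A⟩
    have hclB : IsCluster G {u | F.R u ∧ ¬ (F.typ u = A ∨ P u)} :=
      h.isCluster_ne.mono fun u hu => ⟨hu.1, fun h' => hu.2 (Or.inl h')⟩
    have hzero : ∀ X, PairAdj G X → (∀ u ∈ X, F.R u) → ∀ x ∈ X, F.typ x = ∅ →
        ∀ u ∈ X.erase x, F.typ u ≠ ∅ := by
      intro X hX hR x hx hx0 u hu hu0
      exact hst x u (hR x hx) (hR u (Finset.mem_of_mem_erase hu)) hx0 hu0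
        (hX x hx u (Finset.mem_of_mem_erase hu) (Finset.ne_of_mem_erase hu).symm)
    have hcard := h.card_add
    obtain ⟨c, hc, hc'⟩ := hclA.exists_coloring (α := ι) (insert z B) (by
      intro X hXW hX
      rw [Finset.card_insert_of_notMem h.notMem_right]
      have hX' : PairAdj G X := hX
      by_cases hall : ∀ u ∈ X, F.typ u = A
      · have := hb.card_add_card_le hX' A fun u hu => ⟨(hXW u hu).1, hall u hu⟩
        omega
      · push Not at hall
        obtain ⟨x, hxX, hxA⟩ := hall
        obtain ⟨hx0, L, hL, hLB, hLc⟩ := (hXW x hxX).2.resolve_left hxA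
        by_contra hlt
        have hKA : ∀ u ∈ X.erase x, F.typ u = A := fun u hu =>
          (hXW u (Finset.mem_of_mem_erase hu)).2.resolve_right fun h' =>
            hzero X hX (fun u hu => (hXW u hu).1) x hxX hx0 u hu h'.1
        have hKc : (X.erase x).card + 1 = X.card := Finset.card_erase_add_one hxX
        have hBpos := h.nonempty.card_pos
        have hcl := F.card_clique _ ((hX'.mono (Finset.erase_subset x X)).union hL (by
          intro u hu l hl _
          obtain ⟨u', hu', hne⟩ := Finset.exists_mem_ne (s := X.erase x) (by omega) u
          have hu1 := Finset.mem_of_mem_erase hu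
          have hu1' := Finset.mem_of_mem_erase hu'
          exact h.adj_cross (hXW u hu1).1 (hXW u' hu1').1 (hLB l hl).1 (hXW x hxX).1
            (hKA u hu) (hKA u' hu') (hLB l hl).2.1 hxA (hX u hu1 u' hu1' hne.symm)
            (hX x hxX u hu1 (Finset.ne_of_mem_erase hu).symm)
            (hX x hxX u' hu1' (Finset.ne_of_mem_erase hu').symm) (hLB l hl).2.2))
        rw [Finset.card_union_of_disjoint (Finset.disjoint_left.2 fun u hu hu' =>
          hAB ((hKA u hu).symm.trans (hLB u hu').2.1))] at hcl
        omega)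
    obtain ⟨e, he, he'⟩ := hclB.exists_coloring (α := ι ⊕ Fin 1)
      (insert (Sum.inr 0) (A.image Sum.inl)) (by
      intro X hXW hX
      rw [Finset.card_insert_of_notMem (by simp), Finset.card_image_of_injective _
        Sum.inl_injective]
      have hX' : PairAdj G X := hX
      have hB : ∀ u ∈ X, F.typ u ≠ ∅ → F.typ u = B := by
        intro u hu hu0
        obtain ⟨hRu, hnu⟩ := hXW u hu
        rcases h.typ_cases u hRu with h1 | h1 | h1 | h1
        · exact absurd h1 hu0
        · exact absurd (Or.inl h1) hnu
        · exact h1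
        · exact absurd h1 (hz u hRu)
      by_cases hall : ∀ u ∈ X, F.typ u ≠ ∅
      · have := hb.card_add_card_le hX' B fun u hu => ⟨(hXW u hu).1, hB u hu (hall u hu)⟩
        omega
      · push Not at hall
        obtain ⟨x, hxX, hx0⟩ := hall
        by_contra hlt
        have hKc : (X.erase x).card + 1 = X.card := Finset.card_erase_add_one hxX
        obtain ⟨L, hLX, hLc⟩ := Finset.exists_subset_card_eq
          (show A.card + 1 ≤ (X.erase x).card by omega)
        refine (hXW x hxX).2 (Or.inr ⟨hx0, L, hX'.mono (hLX.trans (Finset.erase_subset x X)),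
          fun l hl => ?_, hLc⟩)
        have hlX := Finset.mem_of_mem_erase (hLX hl)
        exact ⟨(hXW l hlX).1, hB l hlX (hzero X hX (fun u hu => (hXW u hu).1) x hxX hx0 l
          (hLX hl)), hX x hxX l hlX (Finset.ne_of_mem_erase (hLX hl)).symm⟩)
    have hce : ∀ u v, F.R u → (F.typ u = A ∨ P u) → F.R v → ¬ (F.typ v = A ∨ P v) →
        Sum.inl (c u) ≠ e v := by
      intro u v hu hu' hv hv' heq
      have h1 := he v ⟨hv, hv'⟩
      rw [← heq, Finset.mem_insert, Finset.mem_image] at h1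
      rcases h1 with h1 | ⟨a, ha, h1⟩
      · exact absurd h1 (by simp)
      · have h2 := hc u ⟨hu, hu'⟩
        rw [← Sum.inl.inj h1, Finset.mem_insert] at h2
        rcases h2 with h2 | h2
        · exact h.notMem_left (h2 ▸ ha)
        · exact h.disj a ha h2
    refine colorable_of_coloring (F := F) (κ := Fin 1)
      (fun u => if F.typ u = A ∨ P u then Sum.inl (c u) else e u) ?_ ?_
    · intro u hu q hq
      by_cases hu' : F.typ u = A ∨ P u
      · simp only [hu', if_true, ne_eq, Sum.inl.injEq]
        rintro rfl
        have h1 := hc u ⟨hu, hu'⟩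
        rw [Finset.mem_insert] at h1
        have h2 : c u ∈ A := by
          rcases hu' with h2 | h2
          · rwa [h2] at hq
          · rw [h2.1] at hq; exact absurd hq (Finset.notMem_empty _)
        rcases h1 with h1 | h1
        · exact h.notMem_left (h1 ▸ h2)
        · exact h.disj _ h2 h1
      · simp only [hu', if_false]
        intro heq
        have h1 := he u ⟨hu, hu'⟩
        rw [heq, Finset.mem_insert, Finset.mem_image] at h1
        rcases h1 with h1 | ⟨a, ha, h1⟩
        · exact absurd h1 (by simp)
        · rw [Sum.inl.inj h1] at ha
          rcases h.typ_cases u hu with h2 | h2 | h2 | h2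
          · rw [h2] at hq; exact absurd hq (Finset.notMem_empty q)
          · exact hu' (Or.inl h2)
          · rw [h2] at hq; exact h.disj q ha hq
          · exact hz u hu h2
    · intro u hu v hv huv
      by_cases hu' : F.typ u = A ∨ P u <;> by_cases hv' : F.typ v = A ∨ P v <;>
        simp only [hu', hv', if_true, if_false]
      · exact fun heq => hc' u ⟨hu, hu'⟩ v ⟨hv, hv'⟩ huv (Sum.inl.inj heq)
      · exact hce u v hu hu' hv hv'
      · exact (hce v u hv hv' hu hu').symm
      · exact he' u ⟨hu, hu'⟩ v ⟨hv, hv'⟩ huv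

theorem colorable_of_third [Fintype V] (h : F.NearCover A B z) (hb : F.NoBig) (h2 : 2 ≤ B.card)
    {x : V} (hx : F.R x) (hxz : F.typ x = {z}) {k k' : V} (hk : F.R k) (hk' : F.R k')
    (hkA : F.typ k = A) (hkA' : F.typ k' = A) (hkk : G.Adj k k') :
    G.Colorable (Fintype.card ι + 1) := by
  classical
  have hz0 : ({z} : Finset ι) ≠ ∅ := Finset.singleton_ne_empty z
  have hzA : ({z} : Finset ι) ≠ A := by
    rintro rfl
    exact h.notMem_left (Finset.mem_singleton_self z)
  have hzB : ({z} : Finset ι) ≠ B := by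
    rintro rfl
    exact h.notMem_right (Finset.mem_singleton_self z)
  have hA0 : ∅ ≠ A := by
    rintro rfl
    have := h.two_le
    simp at this
  have hAB : A ≠ B := by
    intro hAB
    obtain ⟨a, ha, -⟩ := h.exists_pair
    exact h.disj a ha (hAB ▸ ha)
  obtain ⟨a, ha, -⟩ := h.exists_pair
  obtain ⟨b, hbB⟩ := h.nonempty
  have hbA : b ∉ A := fun h' => h.disj b h' hbB
  have haB := h.disj a ha
  have haz : a ≠ z := fun h' => h.notMem_left (h' ▸ ha)
  have hbz : b ≠ z := fun h' => h.notMem_right (h' ▸ hbB)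
  have hcl := h.isCluster_ne
  have hcl' := h.isCluster_ne_right h2
  let C : V → Prop := fun v => v = x ∨ G.Adj v x
  have hedgeA : ∀ u, F.R u → F.typ u = {z} → ∀ v w, F.R v → F.R w → F.typ v = A → F.typ w = A →
      G.Adj v w → G.Adj u v := by
    intro u hu huz v w hv hw hvA hwA hvw
    rcases touch hu hv hw hvw (a := z) (q := b) (by simp [huz]) (hvA ▸ h.notMem_left)
      (hwA ▸ h.notMem_left) (by simpa [huz] using hbz) (hvA ▸ hbA) (hwA ▸ hbA) with h1 | h1
    · exact h1
    · exact hcl' ⟨hu, huz ▸ hzB⟩ ⟨hw, hwA ▸ hAB⟩ ⟨hv, hvA ▸ hAB⟩ h1 hvw.symm fun h' =>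
        hzA (huz ▸ h' ▸ hvA)
  have hedgeB : ∀ v w, F.R v → F.R w → F.typ v = B → F.typ w = B → G.Adj v w → G.Adj x v := by
    intro v w hv hw hvB hwB hvw
    rcases touch hx hv hw hvw (a := z) (q := a) (by simp [hxz]) (hvB ▸ h.notMem_right)
      (hwB ▸ h.notMem_right) (by simpa [hxz] using haz) (hvB ▸ haB) (hwB ▸ haB) with h1 | h1
    · exact h1
    · exact hcl ⟨hx, hxz ▸ hzA⟩ ⟨hw, hwB ▸ hAB.symm⟩ ⟨hv, hvB ▸ hAB.symm⟩ h1 hvw.symm fun h' =>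
        hzB (hxz ▸ h' ▸ hvB)
  have hsingle : ∀ u, F.R u → F.typ u = {z} → C u := by
    intro u hu huz
    by_cases hux : u = x
    · exact Or.inl hux
    · exact Or.inr (hcl' ⟨hu, huz ▸ hzB⟩ ⟨hk, hkA ▸ hAB⟩ ⟨hx, hxz ▸ hzB⟩
        (hedgeA u hu huz k k' hk hk' hkA hkA' hkk)
        (hedgeA x hx hxz k k' hk hk' hkA hkA' hkk).symm hux)
  have hsame : ∀ u v, F.R u → F.R v → F.typ u = F.typ v → G.Adj u v → C u := by
    intro u v hu hv huv hadj
    rcases h.typ_cases u hu with h1 | h1 | h1 | h1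
    · exact Or.inr (adj_of_empty_edge hu hv h1 (huv ▸ h1) hadj hx ⟨z, by simp [hxz]⟩).symm
    · exact Or.inr (hedgeA x hx hxz u v hu hv h1 (huv ▸ h1) hadj).symm
    · exact Or.inr (hedgeB u v hu hv h1 (huv ▸ h1) hadj).symm
    · exact hsingle u hu h1
  have hmix : ∀ u v, F.R u → F.R v → C u → C v → u ≠ v → F.typ u = A → F.typ v = B →
      G.Adj u v := by
    intro u v hu hv huC hvC huv huA hvB
    have hux : G.Adj u x := huC.resolve_left fun h' => hzA (hxz ▸ h' ▸ huA)
    have hvx : G.Adj v x := hvC.resolve_left fun h' => hzB (hxz ▸ h' ▸ hvB)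
    obtain ⟨u', hu', huA', hne, hux'⟩ : ∃ u', F.R u' ∧ F.typ u' = A ∧ u ≠ u' ∧ G.Adj u' x := by
      by_cases huk : u = k
      · exact ⟨k', hk', hkA', huk ▸ hkk.ne,
          (hedgeA x hx hxz k' k hk' hk hkA' hkA hkk.symm).symm⟩
      · exact ⟨k, hk, hkA, huk, (hedgeA x hx hxz k k' hk hk' hkA hkA' hkk).symm⟩
    exact h.adj_cross hu hu' hv hx huA huA' hvB (hxz ▸ hzA)
      (hcl' ⟨hu, huA ▸ hAB⟩ ⟨hx, hxz ▸ hzB⟩ ⟨hu', huA' ▸ hAB⟩ hux hux'.symm hne)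
      hux.symm hux'.symm hvx.symm
  have hclique : ∀ u v, F.R u → F.R v → C u → C v → u ≠ v → G.Adj u v := by
    intro u v hu hv huC hvC huv
    by_cases hxu : u = x
    · subst hxu
      exact (hvC.resolve_left huv.symm).symm
    by_cases hxv : v = x
    · subst hxv
      exact huC.resolve_left huv
    have hux := huC.resolve_left hxu
    have hvx := hvC.resolve_left hxv
    by_cases huA : F.typ u = A
    · by_cases hvB : F.typ v = B
      · exact hmix u v hu hv huC hvC huv huA hvB
      · exact hcl' ⟨hu, huA ▸ hAB⟩ ⟨hx, hxz ▸ hzB⟩ ⟨hv, hvB⟩ hux hvx.symm huv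
    · by_cases hvA : F.typ v = A
      · by_cases huB : F.typ u = B
        · exact (hmix v u hv hu hvC huC huv.symm hvA huB).symm
        · exact hcl' ⟨hu, huB⟩ ⟨hx, hxz ▸ hzB⟩ ⟨hv, hvA ▸ hAB⟩ hux hvx.symm huv
      · exact hcl ⟨hu, huA⟩ ⟨hx, hxz ▸ hzA⟩ ⟨hv, hvA⟩ hux hvx.symm huv
  have hout : ∀ u v, F.R u → F.R v → C u → ¬ C v → G.Adj u v →
      (F.typ u = A ∧ F.typ v = B) ∨ (F.typ u = B ∧ F.typ v = A) := by
    intro u v hu hv huC hvC huv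
    by_contra hn
    rw [not_or, not_and_or, not_and_or] at hn
    have hux : G.Adj u x := huC.resolve_left fun h' => hvC (Or.inr (h' ▸ huv.symm))
    have hvx : v ≠ x := fun h' => hvC (Or.inl h')
    by_cases hA : F.typ u ≠ A ∧ F.typ v ≠ A
    · exact hvC (Or.inr (hcl ⟨hv, hA.2⟩ ⟨hu, hA.1⟩ ⟨hx, hxz ▸ hzA⟩ huv.symm hux hvx))
    by_cases hB : F.typ u ≠ B ∧ F.typ v ≠ B
    · exact hvC (Or.inr (hcl' ⟨hv, hB.2⟩ ⟨hu, hB.1⟩ ⟨hx, hxz ▸ hzB⟩ huv.symm hux hvx))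
    by_cases h1 : F.typ u = A
    · rw [h1] at hB
      exact hn.1.elim (fun h' => h' h1) fun h' => hB ⟨hAB, h'⟩
    · have h2 : F.typ v = A := by
        by_contra h'
        exact hA ⟨h1, h'⟩
      rw [h2] at hB
      exact hn.2.elim (fun h' => hB ⟨h', hAB⟩) fun h' => h' h2
  have hWC : IsCluster G {u | F.R u ∧ C u} := fun u hu _ _ v hv _ _ huv =>
    hclique u v hu.1 hv.1 hu.2 hv.2 huv
  have := F.nonempty_index
  obtain ⟨c, hc, hc'⟩ := hWC.exists_list_coloring (fun u => (F.typ u)ᶜ)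
    fun X h1 h2 _ => hb.card_le_biUnion h2 fun u hu => (h1 u hu).1
  let e : V → ι := fun u => if F.typ u = A then b else if F.typ u = B then a else z
  have hce : ∀ u v, F.R u → F.R v → C u → ¬ C v → G.Adj u v → c u ≠ e v := by
    intro u v hu hv huC hvC huv heq
    have h1 := Finset.mem_compl.1 (hc u ⟨hu, huC⟩)
    rw [heq] at h1
    rcases hout u v hu hv huC hvC huv with ⟨h2, h3⟩ | ⟨h2, h3⟩
    · simp only [e, h3, hAB.symm, if_true, if_false] at h1
      exact h1 (h2 ▸ ha)
    · simp only [e, h3, if_true] at h1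
      exact h1 (h2 ▸ hbB)
  refine colorable_of_coloring (F := F) (κ := Fin 1)
    (fun u => Sum.inl (if C u then c u else e u)) ?_ ?_
  · intro u hu q hq heq
    rw [Sum.inl.injEq] at heq
    by_cases huC : C u
    · rw [if_pos huC] at heq
      exact Finset.mem_compl.1 (hc u ⟨hu, huC⟩) (heq ▸ hq)
    · rw [if_neg huC] at heq
      rcases h.typ_cases u hu with h1 | h1 | h1 | h1
      · rw [h1] at hq; exact absurd hq (Finset.notMem_empty q)
      · simp only [e, h1, if_true] at heq
        exact hbA (heq ▸ h1 ▸ hq)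
      · simp only [e, h1, hAB.symm, if_true, if_false] at heq
        exact haB (heq ▸ h1 ▸ hq)
      · exact huC (hsingle u hu h1)
  · intro u hu v hv huv heq
    rw [Sum.inl.injEq] at heq
    by_cases huC : C u <;> by_cases hvC : C v <;> simp only [huC, hvC, if_true, if_false] at heq
    · exact hc' u ⟨hu, huC⟩ v ⟨hv, hvC⟩ huv heq
    · exact hce u v hu hv huC hvC huv heq
    · exact hce v u hv hu hvC huC huv.symm heq.symm
    · have hne : F.typ u ≠ F.typ v := fun h' => huC (hsame u v hu hv h' huv)
      by_cases h1 : F.typ u = A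
      · have h2 : F.typ v ≠ A := fun h' => hne (h1.trans h'.symm)
        by_cases h3 : F.typ v = B <;> simp only [e, h1, h2, h3, hAB.symm, if_true, if_false] at heq
        · exact hbA (heq ▸ ha)
        · exact hbz heq
      · by_cases h2 : F.typ v = A
        · by_cases h3 : F.typ u = B <;>
            simp only [e, h1, h2, h3, hAB.symm, if_true, if_false] at heq
          · exact hbA (heq ▸ ha)
          · exact hbz heq.symm
        · by_cases h3 : F.typ u = B
          · have h4 : F.typ v ≠ B := fun h' => hne (h3.trans h'.symm)
            simp only [e, h2, h3, h4, hAB.symm, if_true, if_false] at heq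
            exact haz heq
          · by_cases h4 : F.typ v = B
            · simp only [e, h1, h3, h4, hAB.symm, if_true, if_false] at heq
              exact haz heq.symm
            · have h5 : ∀ w, F.R w → ¬ C w → F.typ w ≠ A → F.typ w ≠ B → F.typ w = ∅ := by
                intro w hw hwC hwA hwB
                rcases h.typ_cases w hw with h5 | h5 | h5 | h5
                · exact h5
                · exact absurd h5 hwA
                · exact absurd h5 hwB
                · exact absurd (hsingle w hw h5) hwC
              exact hne ((h5 u hu huC h1 h3).trans (h5 v hv hvC h2 h4).symm)

/-- A clique in the parts attached to `{y}` and `{z}` all of whose vertices miss an end of an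
edge in the `A`-part has at most two vertices attached to `y`, and if it has two then no vertex
is attached to `z`. -/
theorem false_of_three {y : ι} (h : F.NearCover A {y} z) {k k' : V} (hk : F.R k) (hk' : F.R k')
    (hkA : F.typ k = A) (hkA' : F.typ k' = A) (hkk : G.Adj k k') {w w' v : V} (hw : F.R w)
    (hw' : F.R w') (hv : F.R v) (hwy : F.typ w = {y}) (hwy' : F.typ w' = {y})
    (hvz : F.typ v = {z}) (hww : G.Adj w w') (hwv : G.Adj w v) (hwv' : G.Adj w' v)
    (hwk : G.Adj w k) (hwk' : ¬ G.Adj w k') (hwk₂ : ¬ G.Adj w' k) (hvk : G.Adj v k) : False := by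
  have hyA : y ∉ A := fun h' => h.disj y h' (Finset.mem_singleton_self y)
  have hyz : y ≠ z := fun h' => h.notMem_right (by simp [h'])
  obtain ⟨d, hd, hwd⟩ := hw'.exists_adj (q := y) (by simp [hwy'])
  have hdk : ¬ G.Adj d k := fun h' => hk.not_adj (hkA ▸ hyA) hd h'.symm
  have hdk' : ¬ G.Adj d k' := fun h' => hk'.not_adj (hkA' ▸ hyA) hd h'.symm
  have hdv : ¬ G.Adj d v := fun h' => hv.not_adj (by simpa [hvz] using hyz) hd h'.symm
  by_cases hdw : G.Adj d w
  · exact F.noGem hdw.symm hww hwv hwk hwd.symm hwv' hvk hdv hdk hwk₂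
  · refine F.noP2P3 (adj_of_ne hd (F.part_rep z) hyz) hkk.symm hwk.symm ?_
      (fun h' => hwk' h'.symm) hdk' hdk hdw
      (fun h' => hk'.not_adj_rep (hkA' ▸ h.notMem_left) h'.symm)
      (fun h' => hk.not_adj_rep (hkA ▸ h.notMem_left) h'.symm)
      (fun h' => hw.not_adj_rep (by simpa [hwy] using hyz.symm) h'.symm)
    rintro rfl
    exact hyA (by rw [← hkA', hwy]; simp)

theorem card_clique_le {y : ι} (h : F.NearCover A {y} z) (h4 : 4 ≤ Fintype.card ι) {k k' : V}
    (hk : F.R k) (hk' : F.R k') (hkA : F.typ k = A) (hkA' : F.typ k' = A) (hkk : G.Adj k k')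
    {X : Finset V} (hX : PairAdj G X) (hXR : ∀ u ∈ X, F.R u ∧ F.typ u ≠ A) :
    X.card + 1 ≤ Fintype.card ι ∧
      ((∀ u ∈ X, F.typ u = {y}) → X.card + 2 ≤ Fintype.card ι) := by
  classical
  obtain ⟨a, ha, a', ha', haa⟩ := h.exists_pair
  have hyA : y ∉ A := fun h' => h.disj y h' (Finset.mem_singleton_self y)
  have hyz : y ≠ z := fun h' => h.notMem_right (by simp [h'])
  have hzA := h.notMem_left
  have hay : a ≠ y := fun h' => hyA (h' ▸ ha)
  have haz : a ≠ z := fun h' => hzA (h' ▸ ha)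
  have hcases : ∀ u ∈ X, F.typ u = ∅ ∨ F.typ u = {y} ∨ F.typ u = {z} := by
    intro u hu
    rcases h.typ_cases u (hXR u hu).1 with h1 | h1 | h1 | h1
    · exact Or.inl h1
    · exact absurd h1 (hXR u hu).2
    · exact Or.inr (Or.inl h1)
    · exact Or.inr (Or.inr h1)
  have haX : ∀ u ∈ X, a ∉ F.typ u := by
    intro u hu
    rcases hcases u hu with h1 | h1 | h1 <;> simp [h1, hay, haz]
  have hne : ∀ u ∈ X, ∀ p, F.R p → F.typ p = A → u ≠ p := by
    rintro u hu p - hp rfl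
    exact (hXR u hu).2 hp
  have htouch : ∀ w ∈ X, F.typ w ≠ ∅ → G.Adj w k ∨ G.Adj w k' := by
    intro w hw hw0
    rcases hcases w hw with h1 | h1 | h1
    · exact absurd h1 hw0
    · exact touch (hXR w hw).1 hk hk' hkk (a := y) (q := z) (by simp [h1]) (hkA ▸ hyA)
        (hkA' ▸ hyA) (by simpa [h1] using hyz.symm) (hkA ▸ hzA) (hkA' ▸ hzA)
    · exact touch (hXR w hw).1 hk hk' hkk (a := z) (q := y) (by simp [h1]) (hkA ▸ hzA)
        (hkA' ▸ hzA) (by simpa [h1] using hyz) (hkA ▸ hyA) (hkA' ▸ hyA)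
  have htouch' : ∀ p, F.R p → F.typ p = A → ∀ w ∈ X, ∀ w' ∈ X, w ≠ w' → ∀ q, q ∉ A →
      q ∉ F.typ w → q ∉ F.typ w' → G.Adj w p ∨ G.Adj w' p := by
    intro p hp hpA w hw w' hw' hww q hqA hqw hqw'
    exact (touch hp (hXR w hw).1 (hXR w' hw').1 (hX w hw w' hw' hww) (hpA ▸ ha) (haX w hw)
      (haX w' hw') (hpA ▸ hqA) hqw hqw').imp SimpleGraph.Adj.symm SimpleGraph.Adj.symm
  have hspread : ∀ v ∈ X, G.Adj v k → G.Adj v k' → ∀ w ∈ X, F.typ w ≠ ∅ →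
      G.Adj w k ∧ G.Adj w k' := by
    intro v hv hvk hvk' w hw hw0
    by_cases hvw : v = w
    · exact hvw ▸ ⟨hvk, hvk'⟩
    rcases htouch w hw hw0 with h1 | h1
    · exact ⟨h1, (adj_of_typ_eq hk hk' (hkA.trans hkA'.symm) (hkA ▸ h.two_le) (hkA ▸ ha)
        (hXR v hv).1 (hXR w hw).1 (haX v hv) (haX w hw) hkk hvk.symm hvk'.symm (hX v hv w hw hvw)
        h1.symm).symm⟩
    · exact ⟨(adj_of_typ_eq hk' hk (hkA'.trans hkA.symm) (hkA' ▸ h.two_le) (hkA' ▸ ha)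
        (hXR v hv).1 (hXR w hw).1 (haX v hv) (haX w hw) hkk.symm hvk'.symm hvk.symm
        (hX v hv w hw hvw) h1.symm).symm, h1⟩
  have hemp : ∀ x ∈ X, F.typ x = ∅ → ∀ p p' : V, F.R p → F.R p' → F.typ p = A → F.typ p' = A →
      G.Adj p p' → G.Adj x p → G.Adj x p' := by
    intro x hx hx0 p p' hp hp' hpA hpA' hpp hxp
    exact adj_of_cluster (S := A) (hkA ▸ F.card_typ hk) (hXR x hx).1 hp hp' (by simp [hx0]) hpA.le
      hpA'.le hxp hpp (hne x hx p' hp' hpA')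
  have hfull : ∀ Y : Finset V, Y ⊆ X → (∀ u ∈ Y, G.Adj u k ∧ G.Adj u k') →
      Y.card + 2 ≤ Fintype.card ι := by
    intro Y hY hYk
    have hcl := F.card_clique _ ((hX.mono hY).union (pairAdj_pair hkk) (by
      intro u hu v hv _
      simp only [Finset.mem_insert, Finset.mem_singleton] at hv
      rcases hv with rfl | rfl
      · exact (hYk u hu).1
      · exact (hYk u hu).2))
    rwa [Finset.card_union_of_disjoint, Finset.card_pair hkk.ne] at hcl
    rw [Finset.disjoint_left]
    intro u hu hu'
    simp only [Finset.mem_insert, Finset.mem_singleton] at hu'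
    rcases hu' with rfl | rfl
    · exact (hYk u hu).1.ne rfl
    · exact (hYk u hu).2.ne rfl
  by_cases h0 : ∃ x ∈ X, F.typ x = ∅ ∧ G.Adj x k
  · obtain ⟨x, hx, hx0, hxk⟩ := h0
    have hxk' := hemp x hx hx0 k k' hk hk' hkA hkA' hkk hxk
    have := hfull X subset_rfl (by
      intro u hu
      by_cases hu0 : F.typ u = ∅
      · by_cases hux : u = x
        · exact hux ▸ ⟨hxk, hxk'⟩
        · have huk : G.Adj u k := adj_of_cluster (S := A) (hkA ▸ F.card_typ hk) (hXR u hu).1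
            (hXR x hx).1 hk (by simp [hu0]) (by simp [hx0]) hkA.le (hX u hu x hx hux) hxk
            (hne u hu k hk hkA)
          exact ⟨huk, hemp u hu hu0 k k' hk hk' hkA hkA' hkk huk⟩
      · exact hspread x hx hxk hxk' u hu hu0)
    exact ⟨by omega, fun _ => this⟩
  push Not at h0
  have h0' : ∀ x ∈ X, F.typ x = ∅ → ¬ G.Adj x k' := fun x hx hx0 hxk =>
    h0 x hx hx0 (hemp x hx hx0 k' k hk' hk hkA' hkA hkk.symm hxk)
  have hX0 : (X.filter fun u => F.typ u = ∅).card ≤ 1 := by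
    rw [Finset.card_le_one]
    intro u hu v hv
    rw [Finset.mem_filter] at hu hv
    by_contra huv
    rcases htouch' k hk hkA u hu.1 v hv.1 huv z hzA (by simp [hu.2]) (by simp [hv.2]) with h1 | h1
    · exact h0 u hu.1 hu.2 h1
    · exact h0 v hv.1 hv.2 h1
  have hsplit := Finset.card_filter_add_card_filter_not (s := X) fun u => F.typ u = ∅
  by_cases hall : ∀ w ∈ X, F.typ w ≠ ∅ → G.Adj w k ∧ G.Adj w k'
  · have := hfull (X.filter fun u => ¬ F.typ u = ∅) (Finset.filter_subset _ _)
      fun u hu => hall u (Finset.mem_filter.1 hu).1 (Finset.mem_filter.1 hu).2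
    refine ⟨by omega, fun hy => ?_⟩
    have h1 : (X.filter fun u => F.typ u = ∅) = ∅ := by
      rw [Finset.filter_eq_empty_iff]
      intro u hu h1
      rw [hy u hu] at h1
      exact Finset.singleton_ne_empty y h1
    rw [h1, Finset.card_empty] at hsplit
    omega
  · push Not at hall
    obtain ⟨w, hw, hwn, hwk⟩ := hall
    have hw0 := hwn.ne_empty
    have hX0' : ∀ u ∈ X, F.typ u ≠ ∅ := by
      intro x hx hx0
      have hxw : x ≠ w := by rintro rfl; exact hw0 hx0
      obtain ⟨q, hqA, hqw⟩ : ∃ q, q ∉ A ∧ q ∉ F.typ w := by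
        rcases hcases w hw with h1 | h1 | h1
        · exact absurd h1 hw0
        · exact ⟨z, hzA, by simpa [h1] using hyz.symm⟩
        · exact ⟨y, hyA, by simpa [h1] using hyz⟩
      exact hwk ((htouch' k hk hkA x hx w hw hxw q hqA (by simp [hx0]) hqw).resolve_left
        (h0 x hx hx0)) ((htouch' k' hk' hkA' x hx w hw hxw q hqA (by simp [hx0]) hqw).resolve_left
        (h0' x hx hx0))
    have hno : ∀ v ∈ X, ¬ (G.Adj v k ∧ G.Adj v k') := fun v hv h1 =>
      hwk (hspread v hv h1.1 h1.2 w hw hw0).1 (hspread v hv h1.1 h1.2 w hw hw0).2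
    have htwo : ∀ q ∉ A, ∀ Y ⊆ X, (∀ u ∈ Y, q ∉ F.typ u) → Y.card ≤ 2 := by
      intro q hqA Y hY hYq
      have h1 : ∀ p, F.R p → F.typ p = A → (Y.filter fun u => ¬ G.Adj u p).card ≤ 1 := by
        intro p hp hpA
        rw [Finset.card_le_one]
        intro u hu v hv
        rw [Finset.mem_filter] at hu hv
        by_contra huv
        exact (htouch' p hp hpA u (hY hu.1) v (hY hv.1) huv q hqA (hYq u hu.1)
          (hYq v hv.1)).elim hu.2 hv.2
      have h2 : Y ⊆ (Y.filter fun u => ¬ G.Adj u k) ∪ (Y.filter fun u => ¬ G.Adj u k') := by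
        intro u hu
        rw [Finset.mem_union, Finset.mem_filter, Finset.mem_filter]
        by_cases hku : G.Adj u k
        · exact Or.inr ⟨hu, fun h' => hno u (hY hu) ⟨hku, h'⟩⟩
        · exact Or.inl ⟨hu, hku⟩
      have := (Finset.card_le_card h2).trans (Finset.card_union_le _ _)
      have := h1 k hk hkA
      have := h1 k' hk' hkA'
      omega
    have hsplit' := Finset.card_filter_add_card_filter_not (s := X) fun u => F.typ u = {y}
    have hY2 := htwo z hzA (X.filter fun u => F.typ u = {y}) (Finset.filter_subset _ _) (by
      intro u hu
      rw [(Finset.mem_filter.1 hu).2]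
      simpa using hyz.symm)
    have hZ2 := htwo y hyA (X.filter fun u => ¬ F.typ u = {y}) (Finset.filter_subset _ _) (by
      intro u hu
      rw [Finset.mem_filter] at hu
      rcases hcases u hu.1 with h1 | h1 | h1
      · exact absurd h1 (hX0' u hu.1)
      · exact absurd h1 hu.2
      · simpa [h1] using hyz)
    refine ⟨?_, fun hy => ?_⟩
    · by_contra hlt
      obtain ⟨w, hw, w', hw', hww⟩ := Finset.one_lt_card.1
        (show 1 < (X.filter fun u => F.typ u = {y}).card by omega)
      obtain ⟨v, hv⟩ := Finset.card_pos.1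
        (show 0 < (X.filter fun u => ¬ F.typ u = {y}).card by omega)
      rw [Finset.mem_filter] at hw hw' hv
      have hvz : F.typ v = {z} := by
        rcases hcases v hv.1 with h1 | h1 | h1
        · exact absurd h1 (hX0' v hv.1)
        · exact absurd h1 hv.2
        · exact h1
      have hwz : z ∉ F.typ w := by simpa [hw.2] using hyz.symm
      have hwz' : z ∉ F.typ w' := by simpa [hw'.2] using hyz.symm
      have hwv : w ≠ v := by rintro rfl; exact hv.2 hw.2
      have hwv' : w' ≠ v := by rintro rfl; exact hv.2 hw'.2
      have e1 := hX w hw.1 w' hw'.1 hww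
      have e2 := hX w hw.1 v hv.1 hwv
      have e3 := hX w' hw'.1 v hv.1 hwv'
      have t1 := htouch' k hk hkA w hw.1 w' hw'.1 hww z hzA hwz hwz'
      have t2 := htouch' k' hk' hkA' w hw.1 w' hw'.1 hww z hzA hwz hwz'
      have n1 := hno w hw.1
      have n2 := hno w' hw'.1
      have fin := fun {w w'} => h.false_of_three hk hk' hkA hkA' hkk (w := w) (w' := w') (v := v)
      have fin' := fun {w w'} =>
        h.false_of_three hk' hk hkA' hkA hkk.symm (w := w) (w' := w') (v := v)
      have hRw := (hXR w hw.1).1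
      have hRw' := (hXR w' hw'.1).1
      have hRv := (hXR v hv.1).1
      rcases htouch v hv.1 (hX0' v hv.1) with hvk | hvk
      · by_cases hwk : G.Adj w k
        · exact fin hRw hRw' hRv hw.2 hw'.2 hvz e1 e2 e3 hwk (fun h' => n1 ⟨hwk, h'⟩)
            (fun h' => n2 ⟨h', t2.resolve_left fun h'' => n1 ⟨hwk, h''⟩⟩) hvk
        · have hwk' := t1.resolve_left hwk
          exact fin hRw' hRw hRv hw'.2 hw.2 hvz e1.symm e3 e2 hwk' (fun h' => n2 ⟨hwk', h'⟩)
            hwk hvk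
      · by_cases hwk : G.Adj w k'
        · exact fin' hRw hRw' hRv hw.2 hw'.2 hvz e1 e2 e3 hwk (fun h' => n1 ⟨h', hwk⟩)
            (fun h' => n2 ⟨t1.resolve_left fun h'' => n1 ⟨h'', hwk⟩, h'⟩) hvk
        · have hwk' := t2.resolve_left hwk
          exact fin' hRw' hRw hRv hw'.2 hw.2 hvz e1.symm e3 e2 hwk' (fun h' => n2 ⟨h', hwk'⟩)
            hwk hvk
    · rw [Finset.filter_true_of_mem hy] at hY2
      omega

theorem colorable_of_singleton [Fintype V] {y : ι} (h : F.NearCover A {y} z) (hb : F.NoBig)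
    (h4 : 4 ≤ Fintype.card ι) {k k' : V}
    (hk : F.R k) (hk' : F.R k') (hkA : F.typ k = A) (hkA' : F.typ k' = A) (hkk : G.Adj k k') :
    G.Colorable (Fintype.card ι + 1) := by
  classical
  have := F.nonempty_index
  have hyA : y ∉ A := fun h' => h.disj y h' (Finset.mem_singleton_self y)
  have hyz : y ≠ z := fun h' => h.notMem_right (by simp [h'])
  have hzA := h.notMem_left
  have hcard := h.card_add
  rw [Finset.card_singleton] at hcard
  have hclA : IsCluster G {u | F.R u ∧ F.typ u = A} :=
    (isCluster_subset (F := F) A (hkA ▸ F.card_typ hk)).mono fun u hu => ⟨hu.1, hu.2.le⟩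
  obtain ⟨c, hc, hc'⟩ := hclA.exists_coloring (α := ι ⊕ Fin 1) {Sum.inl z, Sum.inr 0} (by
    intro X hXW hX
    rw [Finset.card_pair (by simp)]
    have := hb.card_add_card_le (X := X) hX A hXW
    omega)
  obtain ⟨e, he, he'⟩ := h.isCluster_ne.exists_coloring_of_subset (α := ι)
    (fun u => F.typ u = {y}) (Finset.subset_insert y A)
    (fun X hXW hX => by
      have := (h.card_clique_le h4 hk hk' hkA hkA' hkk (X := X) hX fun u hu => (hXW u hu).1).2
        fun u hu => (hXW u hu).2
      omega)
    (fun X hXW hX => by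
      have := (h.card_clique_le h4 hk hk' hkA hkA' hkk (X := X) hX hXW).1
      rw [Finset.card_insert_of_notMem hyA]
      omega)
  have hce : ∀ u v, F.R u → F.R v → F.typ u = A → F.typ v ≠ A → c u ≠ Sum.inl (e v) := by
    intro u v hu hv huA hvA heq
    have h1 := hc u ⟨hu, huA⟩
    have h2 := (he v ⟨hv, hvA⟩).1
    rw [heq, Finset.mem_insert, Finset.mem_singleton] at h1
    rcases h1 with h1 | h1
    · rw [Sum.inl.inj h1, Finset.mem_insert] at h2
      exact h2.elim (fun h' => hyz h'.symm) hzA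
    · exact absurd h1 (by simp)
  refine colorable_of_coloring (F := F) (κ := Fin 1)
    (fun u => if F.typ u = A then c u else Sum.inl (e u)) ?_ ?_
  · intro u hu q hq heq
    by_cases huA : F.typ u = A
    · simp only [huA, if_true] at heq
      have h1 := hc u ⟨hu, huA⟩
      rw [heq, Finset.mem_insert, Finset.mem_singleton] at h1
      rcases h1 with h1 | h1
      · exact hzA (Sum.inl.inj h1 ▸ huA ▸ hq)
      · exact absurd h1 (by simp)
    · simp only [huA, if_false, Sum.inl.injEq] at heq
      have h1 := he u ⟨hu, huA⟩
      rw [heq] at h1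
      rcases h.typ_cases u hu with h2 | h2 | h2 | h2
      · rw [h2] at hq; exact absurd hq (Finset.notMem_empty q)
      · exact huA h2
      · rw [h2, Finset.mem_singleton] at hq
        exact hyA (hq ▸ h1.2 h2)
      · rw [h2, Finset.mem_singleton] at hq
        have h3 := h1.1
        rw [hq, Finset.mem_insert] at h3
        exact h3.elim (fun h' => hyz h'.symm) hzA
  · intro u hu v hv huv
    by_cases huA : F.typ u = A <;> by_cases hvA : F.typ v = A <;>
      simp only [huA, hvA, if_true, if_false]
    · exact hc' u ⟨hu, huA⟩ v ⟨hv, hvA⟩ huv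
    · exact hce u v hu hv huA hvA
    · exact (hce v u hv hu hvA huA).symm
    · exact fun heq => he' u ⟨hu, huA⟩ v ⟨hv, hvA⟩ huv (Sum.inl.inj heq)

theorem colorable [Fintype V] (h : F.NearCover A B z) (hb : F.NoBig)
    (h4 : 4 ≤ Fintype.card ι) : G.Colorable (Fintype.card ι + 1) := by
  by_cases hst : ∀ u v, F.R u → F.R v → F.typ u = A → F.typ v = A → ¬ G.Adj u v
  · exact h.colorable_of_stable hb hst
  push Not at hst
  obtain ⟨k, k', hk, hk', hkA, hkA', hkk⟩ := hst
  by_cases h2 : 2 ≤ B.card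
  · by_cases hz : ∃ u, F.R u ∧ F.typ u = {z}
    · obtain ⟨x, hx, hxz⟩ := hz
      exact h.colorable_of_third hb h2 hx hxz hk hk' hkA hkA' hkk
    · push Not at hz
      exact h.colorable_of_no_third hb hz hk hk' hkA hkA' hkk
  · obtain ⟨y, rfl⟩ := Finset.card_eq_one.1
      (show B.card = 1 by have := h.nonempty.card_pos; omega)
    exact h.colorable_of_singleton hb h4 hk hk' hkA hkA' hkk

end NearCover

/-- Frames with separated types on at least four classes need at most one extra colour. -/
theorem Separated.colorable [Fintype V] (hs : F.Separated) (h4 : 4 ≤ Fintype.card ι)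
    (hex : ∃ u, F.R u ∧ (F.typ u).Nonempty) : G.Colorable (Fintype.card ι + 1) := by
  by_cases hb : F.NoBig
  swap
  · exact hs.colorable_of_not_noBig h4 hb
  by_cases hsmall : ∀ u v, F.R u → F.R v → (F.typ u).Nonempty → (F.typ v).Nonempty →
      F.typ u ≠ F.typ v → (F.typ u ∪ F.typ v).card + 2 ≤ Fintype.card ι
  · exact hs.colorable_of_small_unions hb hsmall hex
  push Not at hsmall
  obtain ⟨u, v, hu, hv, hun, hvn, huv, hcard⟩ := hsmall
  have hdis := (hs hu hv huv).1
  obtain ⟨z, hzu, hzv⟩ := hs.exists_notMem hu hv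
  have hle : (insert z (F.typ u ∪ F.typ v)).card ≤ Fintype.card ι := Finset.card_le_univ _
  rw [Finset.card_insert_of_notMem (by simp [hzu, hzv])] at hle
  have hadd := Finset.card_union_of_disjoint hdis
  have hcases : ∀ w, F.R w → F.typ w = ∅ ∨ F.typ w = F.typ u ∨ F.typ w = F.typ v ∨
      F.typ w = {z} := by
    intro w hw
    by_contra! hn
    obtain ⟨h0, h1, h2, h3⟩ := hn
    have hall : insert z (F.typ u ∪ F.typ v) = Finset.univ := by
      rw [← Finset.card_eq_iff_eq_univ, Finset.card_insert_of_notMem (by simp [hzu, hzv])]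
      omega
    apply h3
    refine (Finset.subset_singleton_iff.1 fun q hq => ?_).resolve_left h0.ne_empty
    have := Finset.mem_univ q
    rw [← hall, Finset.mem_insert, Finset.mem_union] at this
    rcases this with h' | h' | h'
    · simp [h']
    · exact absurd h' (hs.notMem hw hu h1 hq)
    · exact absurd h' (hs.notMem hw hv h2 hq)
  by_cases h2 : 2 ≤ (F.typ u).card
  · exact NearCover.colorable (A := F.typ u) (B := F.typ v) (z := z)
      ⟨fun a ha hb' => Finset.disjoint_left.1 hdis ha hb', h2, hvn, hzu, hzv, by omega, hcases⟩
      hb h4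
  · have := hun.card_pos
    exact NearCover.colorable (A := F.typ v) (B := F.typ u) (z := z)
      ⟨fun a ha hb' => Finset.disjoint_left.1 hdis hb' ha, by omega, hun, hzv, hzu, by omega,
        fun w hw => by rcases hcases w hw with h | h | h | h <;> simp [h]⟩ hb h4

theorem IsMaxTyp.eq_of_subset {A B : Finset ι} (hA : F.IsMaxTyp A) (hB : F.IsMaxTyp B)
    (h : A ⊆ B) : A = B := by
  obtain ⟨u, hu, rfl⟩ := hB.2.1
  exact (hA.2.2 u hu h).symm

theorem IsMaxTyp.disjoint_or_cover {A B : Finset ι} (hA : F.IsMaxTyp A) (hB : F.IsMaxTyp B)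
    (h : A ≠ B) : Disjoint A B ∨ A ∪ B = Finset.univ := by
  by_cases hd : Disjoint A B
  · exact Or.inl hd
  obtain ⟨c, hcA, hcB⟩ := Finset.not_disjoint_iff.1 hd
  obtain ⟨a, ha, haB⟩ := Finset.not_subset.1 fun h' => h (hA.eq_of_subset hB h')
  obtain ⟨b, hb, hbA⟩ := Finset.not_subset.1 fun h' => h (hB.eq_of_subset hA h').symm
  obtain ⟨u, hu, rfl⟩ := hA.2.1
  obtain ⟨v, hv, rfl⟩ := hB.2.1
  exact Or.inr (adj_of_incomparable hu hv hcA hcB ha haB hbA hb).2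

/-- A single non-covering pair of maximal types forces all pairs to be disjoint and
non-covering. -/
theorem maxDisjoint_of_not_cover {A B : Finset ι} (hA : F.IsMaxTyp A) (hB : F.IsMaxTyp B)
    (hAB : A ≠ B) (hn : A ∪ B ≠ Finset.univ) : F.MaxDisjoint := by
  have key : ∀ {A B : Finset ι}, F.IsMaxTyp A → F.IsMaxTyp B → A ≠ B → A ∪ B ≠ Finset.univ →
      ∀ C, F.IsMaxTyp C → A ≠ C → A ∪ C ≠ Finset.univ := by
    intro A B hA hB hAB hn C hC hAC hcov
    have hd := (hA.disjoint_or_cover hB hAB).resolve_right hn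
    have hBC : B ⊆ C := fun b hb => by
      have := Finset.mem_univ b
      rw [← hcov, Finset.mem_union] at this
      exact this.resolve_left fun h' => Finset.disjoint_left.1 hd h' hb
    exact hn (hB.eq_of_subset hC hBC ▸ hcov)
  have kA := key hA hB hAB hn
  have kB := key hB hA hAB.symm (by rwa [Finset.union_comm])
  have hmem : ∀ {E : Finset ι}, F.IsMaxTyp E →
      (∀ C, F.IsMaxTyp C → E ≠ C → E ∪ C ≠ Finset.univ) →
      ∀ C D, F.IsMaxTyp C → F.IsMaxTyp D → C ∪ D = Finset.univ → E = C ∨ E = D := by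
    intro E hE kE C D hC hD hcov
    by_contra! hn'
    have h1 := (hE.disjoint_or_cover hC hn'.1).resolve_right (kE C hC hn'.1)
    refine hn'.2 (hE.eq_of_subset hD fun e he => ?_)
    have := Finset.mem_univ e
    rw [← hcov, Finset.mem_union] at this
    exact this.resolve_left fun h' => Finset.disjoint_left.1 h1 he h'
  have hno : ∀ C D, F.IsMaxTyp C → F.IsMaxTyp D → C ≠ D → C ∪ D ≠ Finset.univ := by
    intro C D hC hD hCD hcov
    rcases hmem hA kA C D hC hD hcov with rfl | rfl
    · exact kA D hD hCD hcov
    · exact kA C hC hCD.symm (by rwa [Finset.union_comm])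
  intro C D hC hD hCD
  exact ⟨(hC.disjoint_or_cover hD hCD).resolve_right (hno C D hC hD hCD), hno C D hC hD hCD⟩

theorem MaxDisjoint.separated (hd : F.MaxDisjoint)
    (hlow : ∀ A v, F.IsMaxTyp A → ¬ F.Low A v) : F.Separated := by
  have hmax : ∀ u, F.R u → (F.typ u).Nonempty → F.IsMaxTyp (F.typ u) := by
    intro u hu hn
    obtain ⟨A, hA, huA⟩ := exists_isMaxTyp hu hn
    rcases huA.eq_or_ssubset with h | h
    · exact h ▸ hA
    · exact absurd ⟨hu, hn, h⟩ (hlow A u hA)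
  have hout : ∀ u, F.R u → ∃ q, q ∉ F.typ u := fun u hu =>
    Frame.exists_notMem (F.typ u) (by have := F.card_typ hu; omega)
  intro u v hu hv huv
  rcases (F.typ u).eq_empty_or_nonempty with h1 | h1
  · obtain ⟨q, hq⟩ := hout v hv
    rw [h1]
    exact ⟨Finset.disjoint_empty_left _, q, Finset.notMem_empty q, hq⟩
  rcases (F.typ v).eq_empty_or_nonempty with h2 | h2
  · obtain ⟨q, hq⟩ := hout u hu
    rw [h2]
    exact ⟨Finset.disjoint_empty_right _, q, hq, Finset.notMem_empty q⟩
  obtain ⟨h3, h4⟩ := hd _ _ (hmax u hu h1) (hmax v hv h2) huv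
  refine ⟨h3, ?_⟩
  by_contra! h5
  refine h4 (Finset.eq_univ_iff_forall.2 fun q => ?_)
  by_cases hq : q ∈ F.typ u
  · exact Finset.mem_union_left _ hq
  · exact Finset.mem_union_right _ (h5 q hq)

/-- The bound for graphs of clique number at least four without proper retracts. -/
theorem colorable_of_four_le [Fintype V] (F : Frame G ι) (h4 : 4 ≤ Fintype.card ι)
    (hcore : ∀ f : G →g G, Function.Surjective f) :
    G.Colorable (Fintype.card ι + (Fintype.card ι + 2) / 4) := by
  by_cases hcov : ∀ A B, F.IsMaxTyp A → F.IsMaxTyp B → A ≠ B → A ∪ B = Finset.univ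
  · exact colorable_of_cover h4 hcov
  push Not at hcov
  obtain ⟨A, B, hA, hB, hAB, hn⟩ := hcov
  have hd := maxDisjoint_of_not_cover hA hB hAB hn
  refine SimpleGraph.Colorable.mono (n := Fintype.card ι + 1) (by omega) ?_
  by_cases hlow : ∃ A v, F.IsMaxTyp A ∧ F.Low A v
  · obtain ⟨A, v, hA, hv⟩ := hlow
    exact hd.colorable_of_low hcore hA hv
  push Not at hlow
  obtain ⟨u, hu, hut⟩ := hA.2.1
  exact (hd.separated hlow).colorable h4 ⟨u, hu, hut ▸ hA.1⟩

theorem exists_typ_eq_singleton (F : Frame G ι) (h3 : Fintype.card ι = 3) :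
    ∃ r : V → ι, ∀ u, F.R u → (F.typ u).Nonempty → F.typ u = {r u} := by
  have := F.nonempty_index
  have h : ∀ u, ∃ q, F.R u → (F.typ u).Nonempty → F.typ u = {q} := by
    intro u
    by_cases hu : F.R u ∧ (F.typ u).Nonempty
    · obtain ⟨q, hq⟩ := Finset.card_eq_one.1
        (show (F.typ u).card = 1 by have := F.card_typ hu.1; have := hu.2.card_pos; omega)
      exact ⟨q, fun _ _ => hq⟩
    · exact ⟨Classical.arbitrary ι, fun h1 h2 => absurd ⟨h1, h2⟩ hu⟩
  choose r hr using h
  exact ⟨r, hr⟩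

theorem exists_injective_ne (h3 : Fintype.card ι = 3) :
    ∃ σ : ι → ι, Function.Injective σ ∧ ∀ q, σ q ≠ q := by
  let e := Fintype.equivFinOfCardEq h3
  refine ⟨fun q => e.symm (e q + 1), fun p q h => ?_, fun q h => ?_⟩
  · exact e.injective (add_right_cancel (e.symm.injective h))
  · have h1 : e q + 1 = e q :=
      (e.apply_symm_apply (e q + 1)).symm.trans (congrArg e h)
    exact absurd h1 (by generalize e q = i; revert i; decide)

theorem exists_third (h3 : Fintype.card ι = 3) (p q : ι) : ∃ z, z ≠ p ∧ z ≠ q := by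
  obtain ⟨z, hz⟩ := exists_notMem ({p, q} : Finset ι)
    (by have := Finset.card_le_two (a := p) (b := q); omega)
  simp only [Finset.mem_insert, Finset.mem_singleton, not_or] at hz
  exact ⟨z, hz⟩

theorem colorable_of_stable_off_class [Fintype V] (F : Frame G ι) (h3 : Fintype.card ι = 3) (q : ι)
    (hst : ∀ u v, F.R u → F.R v → (F.typ u).Nonempty → q ∉ F.typ u → F.typ v = F.typ u →
      ¬ G.Adj u v) : G.Colorable (Fintype.card ι + Fintype.card ι) := by
  classical
  obtain ⟨r, hr⟩ := F.exists_typ_eq_singleton h3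
  obtain ⟨σ, hσ, hσ'⟩ := exists_injective_ne h3
  have := F.nonempty_index
  obtain ⟨e, -, he'⟩ := (isCluster_subset (F := F) {q} (by simp [h3])).exists_coloring
    (α := ι) Finset.univ fun X _ hX => F.card_clique X hX
  have hnon : ∀ u, ¬ F.typ u ⊆ {q} → (F.typ u).Nonempty := fun u h => by
    by_contra h'
    rw [Finset.not_nonempty_iff_eq_empty] at h'
    exact h (by simp [h'])
  refine colorable_of_coloring (F := F) (κ := ι)
    (fun u => if F.typ u ⊆ {q} then Sum.inr (e u) else Sum.inl (σ (r u))) ?_ ?_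
  · intro u hu p hp
    by_cases h : F.typ u ⊆ {q}
    · simp [h]
    · simp only [h, if_false, ne_eq, Sum.inl.injEq]
      rw [hr u hu (hnon u h), Finset.mem_singleton] at hp
      exact hp ▸ hσ' p
  · intro u hu v hv huv
    by_cases h : F.typ u ⊆ {q} <;> by_cases h' : F.typ v ⊆ {q} <;> simp only [h, h', if_true,
      if_false, ne_eq, Sum.inl.injEq, Sum.inr.injEq, reduceCtorEq, not_false_eq_true]
    · exact he' u ⟨hu, h⟩ v ⟨hv, h'⟩ huv
    · intro heq
      have h1 := hr u hu (hnon u h)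
      have h2 := hr v hv (hnon v h')
      refine hst u v hu hv (hnon u h) ?_ (by rw [h1, h2, hσ heq]) huv
      intro hq
      rw [h1, Finset.mem_singleton] at hq
      exact h (by rw [h1, hq])

/-- A vertex of empty type cannot be complete to edges attached to two different classes. -/
theorem false_of_attached_twice (F : Frame G ι) (h3 : Fintype.card ι = 3) {p q : ι} (hpq : p ≠ q)
    {x a a' b b' : V} (hx : F.R x) (hx0 : F.typ x = ∅) (ha : F.R a) (ha' : F.R a') (hb : F.R b)
    (hb' : F.R b') (hap : F.typ a = {p}) (hap' : F.typ a' = {p}) (hbq : F.typ b = {q})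
    (hbq' : F.typ b' = {q}) (haa : G.Adj a a') (hbb : G.Adj b b') (hxa : G.Adj x a)
    (hxa' : G.Adj x a') (hxb : G.Adj x b) (hxb' : G.Adj x b') : False := by
  classical
  obtain ⟨z, hzp, hzq⟩ := exists_third h3 p q
  have hnot : ∀ u v w : V, G.Adj x u → G.Adj x v → G.Adj x w → G.Adj u v → G.Adj u w →
      ¬ G.Adj v w := by
    intro u v w hxu hxv hxw huv huw hvw
    have h1 : PairAdj G (insert x (insert u {v, w})) :=
      ((pairAdj_pair hvw).insert fun t ht _ => by
        simp only [Finset.mem_insert, Finset.mem_singleton] at ht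
        rcases ht with rfl | rfl <;> assumption).insert fun t ht _ => by
        simp only [Finset.mem_insert, Finset.mem_singleton] at ht
        rcases ht with rfl | rfl | rfl <;> assumption
    have h2 := F.card_clique _ h1
    rw [Finset.card_insert_of_notMem, Finset.card_insert_of_notMem, Finset.card_pair hvw.ne] at h2
    · omega
    · simp [huv.ne, huw.ne]
    · simp [hxu.ne, hxv.ne, hxw.ne]
  have main : ∀ b b', F.R b → F.R b' → F.typ b = {q} → F.typ b' = {q} → G.Adj b b' → G.Adj x b →
      G.Adj x b' → ¬ G.Adj a b := by
    intro b b' hb hb' hbq hbq' hbb hxb hxb' hab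
    have hba' : ¬ G.Adj b a' := fun h' => hnot a b a' hxa hxb hxa' hab haa h'
    have hab' : ¬ G.Adj a b' := fun h' => hnot a b b' hxa hxb hxb' hab h' hbb
    obtain ⟨d, hd, hbd⟩ := hb'.exists_adj (q := q) (by simp [hbq'])
    have hda : ¬ G.Adj d a := fun h' => ha.not_adj (by simpa [hap] using hpq.symm) hd h'.symm
    have hda' : ¬ G.Adj d a' := fun h' => ha'.not_adj (by simpa [hap'] using hpq.symm) hd h'.symm
    by_cases hdb : G.Adj d b
    · exact F.noGem hdb.symm hbb hxb.symm hab.symm hbd.symm hxb'.symm hxa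
        (fun h' => hx.not_adj (by simp [hx0]) hd h'.symm) hda fun h' => hab' h'.symm
    · refine F.noP2P3 (adj_of_ne hd (F.part_rep z) hzq.symm) hab.symm haa ?_ hba' hdb hda hda'
        (fun h' => hb.not_adj_rep (by simpa [hbq] using hzq) h'.symm)
        (fun h' => ha.not_adj_rep (by simpa [hap] using hzp) h'.symm)
        (fun h' => ha'.not_adj_rep (by simpa [hap'] using hzp) h'.symm)
      rintro rfl
      rw [hbq] at hap'
      exact hpq (Finset.singleton_injective hap').symm
  have hpq' : p ∉ ({q} : Finset ι) := by simpa using hpq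
  rcases touch ha hb hb' hbb (a := p) (q := z) (by simp [hap]) (hbq ▸ hpq') (hbq' ▸ hpq')
    (by simpa [hap] using hzp) (by simpa [hbq] using hzq) (by simpa [hbq'] using hzq) with h | h
  · exact main b b' hb hb' hbq hbq' hbb hxb hxb' h
  · exact main b' b hb' hb hbq' hbq hbb.symm hxb' hxb h

/-- The bound for graphs of clique number three. -/
theorem colorable_of_card_eq_three [Fintype V] (F : Frame G ι) (h3 : Fintype.card ι = 3) :
    G.Colorable 6 := by
  classical
  rw [show 6 = Fintype.card ι + Fintype.card ι by omega]
  have := F.nonempty_index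
  by_cases hb : F.NoBig
  swap
  · unfold NoBig at hb
    push Not at hb
    obtain ⟨q, K, hK, hKq, hKc⟩ := hb
    refine F.colorable_of_stable_off_class h3 q fun u v hu hv hn hq huv => ?_
    obtain ⟨p, hp⟩ := Finset.card_eq_one.1
      (show (F.typ u).card = 1 by have := F.card_typ hu; have := hn.card_pos; omega)
    obtain ⟨z, hzp, hzq⟩ := exists_third h3 p q
    exact not_adj_of_big hK (le_antisymm (F.card_clique K hK) hKc) hKq hu hv hn huv hq
      (by simpa [hp] using hzp) hzq
  by_cases hedge : ∃ x y, F.R x ∧ F.R y ∧ F.typ x = ∅ ∧ F.typ y = ∅ ∧ G.Adj x y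
  · obtain ⟨x, y, hx, hy, hx0, hy0, hxy⟩ := hedge
    refine F.colorable_of_stable_off_class h3 (Classical.arbitrary ι)
      fun u v hu hv hn _ huv hadj => ?_
    have hvn := huv ▸ hn
    have ux := adj_of_empty_edge hx hy hx0 hy0 hxy hu hn
    have uy := adj_of_empty_edge hy hx hy0 hx0 hxy.symm hu hn
    have vx := adj_of_empty_edge hx hy hx0 hy0 hxy hv hvn
    have vy := adj_of_empty_edge hy hx hy0 hx0 hxy.symm hv hvn
    have h1 : PairAdj G (insert u (insert v {x, y})) :=
      ((pairAdj_pair hxy).insert fun t ht _ => by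
        simp only [Finset.mem_insert, Finset.mem_singleton] at ht
        rcases ht with rfl | rfl <;> assumption).insert fun t ht _ => by
        simp only [Finset.mem_insert, Finset.mem_singleton] at ht
        rcases ht with rfl | rfl | rfl <;> assumption
    have h2 := F.card_clique _ h1
    rw [Finset.card_insert_of_notMem, Finset.card_insert_of_notMem, Finset.card_pair hxy.ne] at h2
    · omega
    · simp [vx.ne, vy.ne]
    · simp [hadj.ne, ux.ne, uy.ne]
  have hst : ∀ x y, F.R x → F.R y → F.typ x = ∅ → F.typ y = ∅ → ¬ G.Adj x y :=
    fun x y hx hy hx0 hy0 hxy => hedge ⟨x, y, hx, hy, hx0, hy0, hxy⟩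
  obtain ⟨r, hr⟩ := F.exists_typ_eq_singleton h3
  obtain ⟨σ, hσ, hσ'⟩ := exists_injective_ne h3
  have hg : ∀ x, ∃ q, F.R x → F.typ x = ∅ → ∀ a a', F.R a → F.R a' → F.typ a = {q} →
      F.typ a' = {q} → G.Adj a a' → G.Adj x a → ¬ G.Adj x a' := by
    intro x
    by_contra! hn
    obtain ⟨hx, hx0, -⟩ := hn (Classical.arbitrary ι)
    obtain ⟨p, q, hpq⟩ := Fintype.exists_pair_of_one_lt_card (α := ι) (by omega)
    obtain ⟨-, -, a, a', ha, ha', hap, hap', haa, hxa, hxa'⟩ := hn p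
    obtain ⟨-, -, b, b', hb, hb', hbq, hbq', hbb, hxb, hxb'⟩ := hn q
    exact F.false_of_attached_twice h3 hpq hx hx0 ha ha' hb hb' hap hap' hbq hbq' haa hbb hxa
      hxa' hxb hxb'
  choose g hg using hg
  let s : V → ι := fun u => if F.typ u = ∅ then g u else r u
  have hs : ∀ u, F.R u → F.typ u ⊆ {s u} := by
    intro u hu
    by_cases h0 : F.typ u = ∅
    · simp [h0]
    · simp only [s, h0, if_false]
      exact (hr u hu (Finset.nonempty_iff_ne_empty.2 h0)).le
  have hcol : ∀ q, ∃ c : V → ι ⊕ ι, (∀ u ∈ {u | F.R u ∧ s u = q}, c u ∈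
      ({Sum.inl (σ q), Sum.inr q} : Finset (ι ⊕ ι))) ∧ ∀ u ∈ {u | F.R u ∧ s u = q},
        ∀ v ∈ {u | F.R u ∧ s u = q}, G.Adj u v → c u ≠ c v := by
    intro q
    have hcl : IsCluster G {u | F.R u ∧ s u = q} :=
      (isCluster_subset (F := F) {q} (by simp [h3])).mono fun u hu => ⟨hu.1, hu.2 ▸ hs u hu.1⟩
    refine hcl.exists_coloring _ fun X hXW hX => ?_
    rw [Finset.card_pair (by simp)]
    by_contra hlt
    have htyp : ∀ u ∈ X, F.typ u ≠ ∅ → F.typ u = {q} := fun u hu h0 =>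
      (Finset.subset_singleton_iff.1 ((hXW u hu).2 ▸ hs u (hXW u hu).1)).resolve_left h0
    by_cases hall : ∀ u ∈ X, F.typ u ≠ ∅
    · have := hb q X hX fun u hu => ⟨(hXW u hu).1, htyp u hu (hall u hu)⟩
      omega
    · push Not at hall
      obtain ⟨x, hxX, hx0⟩ := hall
      have hKc : (X.erase x).card + 1 = X.card := Finset.card_erase_add_one hxX
      obtain ⟨a, ha, a', ha', haa⟩ := Finset.one_lt_card.1 (show 1 < (X.erase x).card by omega)
      rw [Finset.mem_erase] at ha ha'
      have hx := (hXW x hxX).1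
      have hgq : g x = q := by
        have := (hXW x hxX).2
        simpa [s, hx0] using this
      have hne : ∀ u ∈ X, u ≠ x → F.typ u ≠ ∅ := fun u hu hux h0 =>
        hst x u hx (hXW u hu).1 hx0 h0 (hX x hxX u hu hux.symm)
      exact hg x hx hx0 a a' (hXW a ha.2).1 (hXW a' ha'.2).1
        (hgq ▸ htyp a ha.2 (hne a ha.2 ha.1)) (hgq ▸ htyp a' ha'.2 (hne a' ha'.2 ha'.1))
        (hX a ha.2 a' ha'.2 haa) (hX x hxX a ha.2 ha.1.symm) (hX x hxX a' ha'.2 ha'.1.symm)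
  choose c hc hc' using hcol
  refine colorable_of_coloring (F := F) (κ := ι) (fun u => c (s u) u) ?_ ?_
  · intro u hu q hq heq
    have hq' := hs u hu hq
    rw [Finset.mem_singleton] at hq'
    have h1 := hc (s u) u ⟨hu, rfl⟩
    rw [heq, Finset.mem_insert, Finset.mem_singleton] at h1
    rcases h1 with h1 | h1
    · rw [hq'] at h1
      exact hσ' (s u) (Sum.inl.inj h1).symm
    · exact absurd h1 (by simp)
  · intro u hu v hv huv heq
    by_cases hsuv : s u = s v
    · simp only [hsuv] at heq
      exact hc' (s v) u ⟨hu, hsuv⟩ v ⟨hv, rfl⟩ huv heq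
    · have h1 := hc (s u) u ⟨hu, rfl⟩
      have h2 := hc (s v) v ⟨hv, rfl⟩
      rw [← heq] at h2
      simp only [Finset.mem_insert, Finset.mem_singleton] at h1 h2
      rcases h1 with h1 | h1 <;> rcases h2 with h2 | h2 <;> rw [h1] at h2
      · exact hsuv (hσ (Sum.inl.inj h2))
      · exact absurd h2 (by simp)
      · exact absurd h2 (by simp)
      · exact hsuv (Sum.inr.inj h2)

end Frame
/-- Every finite graph retracts onto an induced subgraph all of whose endomorphisms are
surjective. -/
theorem exists_induce_surjective_endomorphisms {V : Type*} [Finite V] (G : SimpleGraph V) :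
    ∃ W : Set V, Nonempty (G →g G.induce W) ∧
      ∀ f : G.induce W →g G.induce W, Function.Surjective f := by
  obtain ⟨W, ⟨g⟩, hmin⟩ := (wellFounded_lt (α := Set V)).has_min
    {W | Nonempty (G →g G.induce W)}
    ⟨Set.univ, ⟨⟨fun v => ⟨v, Set.mem_univ v⟩, fun h => h⟩⟩⟩
  refine ⟨W, ⟨g⟩, fun f => ?_⟩
  have hsub : Subtype.val '' Set.range f ⊆ W := by
    rintro _ ⟨y, -, rfl⟩
    exact y.2
  by_contra hf
  refine hmin (Subtype.val '' Set.range f)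
    ⟨⟨fun v => ⟨f (g v), f (g v), ⟨g v, rfl⟩, rfl⟩, fun h => f.map_adj (g.map_adj h)⟩⟩
    (lt_of_le_of_ne hsub fun h => hf fun y => ?_)
  obtain ⟨z, hz, hzy⟩ := h.symm.subset y.2
  exact Subtype.val_injective hzy ▸ hz

theorem NoGem.induce {V : Type*} {G : SimpleGraph V} (h : NoGem G) (W : Set V) :
    NoGem (G.induce W) :=
  fun _ _ _ _ _ h1 h2 h3 h4 h5 h6 h7 h8 h9 h10 => h h1 h2 h3 h4 h5 h6 h7 h8 h9 h10

theorem NoP2P3.induce {V : Type*} {G : SimpleGraph V} (h : NoP2P3 G) (W : Set V) :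
    NoP2P3 (G.induce W) :=
  fun _ _ _ _ _ h1 h2 h3 hne h4 h5 h6 h7 h8 h9 h10 =>
    h h1 h2 h3 (fun e => hne (Subtype.ext e)) h4 h5 h6 h7 h8 h9 h10

theorem cliqueNum_le_of_hom {V V' : Type*} [Finite V'] {G : SimpleGraph V}
    {G' : SimpleGraph V'} (f : G →g G') : G.cliqueNum ≤ G'.cliqueNum := by
  classical
  obtain ⟨s, hs⟩ := G.exists_isNClique_cliqueNum
  have hinj : Set.InjOn f s := by
    intro a ha b hb hab
    by_contra hne
    exact (f.map_adj (hs.isClique ha hb hne)).ne hab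
  rw [← hs.card_eq, ← Finset.card_image_of_injOn hinj]
  refine SimpleGraph.IsClique.card_le_cliqueNum (tc := ?_)
  rw [Finset.coe_image]
  rintro _ ⟨a, ha, rfl⟩ _ ⟨b, hb, rfl⟩ hne
  exact f.map_adj (hs.isClique ha hb fun h => hne (h ▸ rfl))

theorem NoGem.exists_frame {V : Type*} [Finite V] {G : SimpleGraph V} (hgem : NoGem G)
    (hp : NoP2P3 G) (h3 : 3 ≤ G.cliqueNum) :
    ∃ Q : Finset V, Q.card = G.cliqueNum ∧ Nonempty (Frame G {x // x ∈ Q}) := by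
  obtain ⟨Q, hQ⟩ := G.exists_isNClique_cliqueNum
  refine ⟨Q, hQ.card_eq, hgem.nonempty_frame hp Q (fun u hu v hv => hQ.isClique hu hv)
    (fun X hX => ?_) (hQ.card_eq ▸ h3)⟩
  rw [hQ.card_eq]
  exact SimpleGraph.IsClique.card_le_cliqueNum (tc := fun u hu v hv => hX u hu v hv)

theorem colorable_of_four_le_cliqueNum {V : Type*} [Fintype V] {G : SimpleGraph V}
    (hgem : NoGem G) (hp : NoP2P3 G) (h4 : 4 ≤ G.cliqueNum) :
    G.Colorable (G.cliqueNum + (G.cliqueNum + 2) / 4) := by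
  classical
  obtain ⟨W, ⟨g⟩, hW⟩ := exists_induce_surjective_endomorphisms G
  have hn : (G.induce W).cliqueNum = G.cliqueNum :=
    le_antisymm (G.cliqueNum_induce_le W) (cliqueNum_le_of_hom g)
  obtain ⟨Q, hQ, ⟨F⟩⟩ := (hgem.induce W).exists_frame (hp.induce W) (by omega)
  have hcard := Fintype.card_coe Q
  rw [hQ, hn] at hcard
  have h := F.colorable_of_four_le (by omega) hW
  rw [hcard] at h
  exact h.of_hom g

theorem colorable_four_of_cliqueNum_eq_two {V : Type*} [Fintype V] {G : SimpleGraph V}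
    (hp : NoP2P3 G) (h2 : G.cliqueNum = 2) : G.Colorable 4 := by
  classical
  have hmax : ∀ X : Finset V, (∀ u ∈ X, ∀ v ∈ X, u ≠ v → G.Adj u v) → X.card ≤ 2 :=
    fun X hX => h2 ▸
      SimpleGraph.IsClique.card_le_cliqueNum (tc := fun u hu v hv => hX u hu v hv)
  have htri : ∀ x y z, G.Adj x y → G.Adj x z → ¬ G.Adj y z := by
    intro x y z hxy hxz hyz
    have h := SimpleGraph.IsClique.card_le_cliqueNum
      (tc := (SimpleGraph.is3Clique_triple_iff.2 ⟨hxy, hxz, hyz⟩).isClique)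
    rw [(SimpleGraph.is3Clique_triple_iff.2 ⟨hxy, hxz, hyz⟩).card_eq] at h
    omega
  obtain ⟨s, hs⟩ := G.exists_isNClique_cliqueNum
  rw [h2] at hs
  obtain ⟨a, b, hne, rfl⟩ := Finset.card_eq_two.1 hs.card_eq
  have hab : G.Adj a b := hs.isClique (by simp) (by simp) hne
  have hcl : IsCluster G {u | ¬ G.Adj a u ∧ ¬ G.Adj b u} := by
    intro x hx y hy z hz hxy hyz hxz
    by_contra h
    exact hp hab hxy hyz hxz h hx.1 hy.1 hz.1 hx.2 hy.2 hz.2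
  obtain ⟨c, hc, hcc⟩ := hcl.exists_coloring ({2, 3} : Finset (Fin 4))
    (fun X _ hX => hmax X hX)
  have hrange : ∀ u, ¬ G.Adj a u → ¬ G.Adj b u → c u = 2 ∨ c u = 3 :=
    fun u h1 h2 => by simpa using hc u ⟨h1, h2⟩
  refine ⟨SimpleGraph.Coloring.mk
    (fun u => if G.Adj a u then 0 else if G.Adj b u then 1 else c u) fun {u v} huv => ?_⟩
  by_cases hau : G.Adj a u <;> by_cases hav : G.Adj a v
  · exact absurd huv (htri a u v hau hav)
  · by_cases hbv : G.Adj b v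
    · simp [hau, hav, hbv]
    · rcases hrange v hav hbv with h | h <;> simp [hau, hav, hbv, h]
  · by_cases hbu : G.Adj b u
    · simp [hau, hav, hbu]
    · rcases hrange u hau hbu with h | h <;> simp [hau, hav, hbu, h]
  · by_cases hbu : G.Adj b u <;> by_cases hbv : G.Adj b v
    · exact absurd huv (htri b u v hbu hbv)
    · rcases hrange v hav hbv with h | h <;> simp [hau, hav, hbu, hbv, h]
    · rcases hrange u hau hbu with h | h <;> simp [hau, hav, hbu, hbv, h]
    · simpa [hau, hav, hbu, hbv] using hcc u ⟨hau, hbu⟩ v ⟨hav, hbv⟩ huv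

theorem colorable_one_of_cliqueNum_le_one {V : Type*} [Finite V] {G : SimpleGraph V}
    (h1 : G.cliqueNum ≤ 1) : G.Colorable 1 := by
  classical
  refine ⟨SimpleGraph.Coloring.mk (fun _ => 0) fun {u v} huv => ?_⟩
  have h := SimpleGraph.IsClique.card_le_cliqueNum (G := G) (t := {u, v})
    (tc := by simpa using fun _ => huv)
  rw [Finset.card_pair huv.ne] at h
  omega

theorem cliqueNum_pos {V : Type*} [Finite V] [Nonempty V] (G : SimpleGraph V) :
    0 < G.cliqueNum := by
  have h := SimpleGraph.IsClique.card_le_cliqueNum (G := G) (t := {Classical.arbitrary V})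
    (tc := by simp)
  simpa [Nat.succ_le_iff] using h

theorem le_phi_of_four_le {x : ℕ} (hx : 4 ≤ x) : x + (x + 2) / 4 ≤ phi x := by
  rw [phi, if_neg (by omega), if_neg (by omega), if_neg (by omega)]
  by_contra! h
  have h1 : ⌈(5 * (x : ℚ) - 1) / 4⌉₊ ≤ x + (x + 2) / 4 - 1 := by omega
  rw [Nat.ceil_le, div_le_iff₀ (by norm_num), sub_le_iff_le_add] at h1
  have h2 : 5 * x ≤ (x + (x + 2) / 4 - 1) * 4 + 1 := by exact_mod_cast h1
  omega

/-- Every (P2+P3, gem)-free graph `G` (with at least one vertex) satisfies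
`χ(G) ≤ φ(ω(G))`. -/
theorem chi_le_phi_of_p2p3_gem_free {V : Type*} [Fintype V] [Nonempty V] (G : SimpleGraph V)
    (h1 : IsFreeOf G graphP2P3) (h2 : IsFreeOf G graphGem) :
    G.chromaticNumber ≤ (phi G.cliqueNum : ℕ∞) := by
  classical
  have hgem := noGem_of_isFreeOf h2
  have hp := noP2P3_of_isFreeOf h1
  have hpos := cliqueNum_pos G
  rw [SimpleGraph.chromaticNumber_le_iff_colorable]
  obtain hw | hw | hw | hw : G.cliqueNum = 1 ∨ G.cliqueNum = 2 ∨ G.cliqueNum = 3 ∨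
      4 ≤ G.cliqueNum := by omega
  · simpa [hw, phi] using colorable_one_of_cliqueNum_le_one hw.le
  · simpa [hw, phi] using colorable_four_of_cliqueNum_eq_two hp hw
  · obtain ⟨Q, hQ, ⟨F⟩⟩ := hgem.exists_frame hp hw.ge
    have h := F.colorable_of_card_eq_three (by rw [Fintype.card_coe, hQ, hw])
    simpa [hw, phi] using h
  · exact (colorable_of_four_le_cliqueNum hgem hp hw).mono (le_phi_of_four_le hw)
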